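/- Let n ≥ 1, let Y be a connected, non-compact, Hausdorff topological manifold modelled on ℝ^n, and let f : S^n → Y be a continuous map. Then there exists x ∈ S^n with f(x) = f(−x); in particular, some two points at geodesic distance π (antipodal points) are mapped to a single point, so the width w(S^n, Y) is at least π. -/

import Mathlib

set_option autoImplicit false
namespace AC

/-- mod 2 chains on lists of points (ordered simplices, including the empty one) -/
abbrev Ch (E : Type*) := List E →₀ ZMod 2

section chains
variable {E F : Type*}

noncomputable def one (l : List E) : Ch E := Finsupp.single l 1

theorem ch_add_self (c : Ch E) : c + c = 0 := by
  ext l; simp [CharTwo.add_self_eq_zero]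

theorem ch_eq_of_add (a b : Ch E) (h : a + b = 0) : a = b := by
  have := congrArg (· + b) h
  simpa [add_assoc, ch_add_self] using this

/-- linear extension of a function on lists -/
noncomputable def lin {M : Type*} [AddCommGroup M] [Module (ZMod 2) M] (g : List E → M) :
    Ch E →ₗ[ZMod 2] M := Finsupp.linearCombination (ZMod 2) g

@[simp] theorem lin_one {M : Type*} [AddCommGroup M] [Module (ZMod 2) M] (g : List E → M)
    (l : List E) : lin g (one l) = g l := by simp [lin, one]

theorem lin_ext {M : Type*} [AddCommGroup M] [Module (ZMod 2) M] {f g : Ch E →ₗ[ZMod 2] M}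
    (h : ∀ l, f (one l) = g (one l)) : f = g := by
  apply Finsupp.lhom_ext'
  intro l
  ext
  exact h l

noncomputable def cone (x : E) : Ch E →ₗ[ZMod 2] Ch E := lin (fun l => one (x :: l))

@[simp] theorem cone_one (x : E) (l : List E) : cone x (one l) = one (x :: l) := by simp [cone]

noncomputable def push (f : E → F) : Ch E →ₗ[ZMod 2] Ch F := lin (fun l => one (l.map f))

@[simp] theorem push_one (f : E → F) (l : List E) : push f (one l) = one (l.map f) := by
  simp [push]

theorem push_cone (f : E → F) (x : E) (c : Ch E) : push f (cone x c) = cone (f x) (push f c) := by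
  have : push f ∘ₗ cone x = cone (f x) ∘ₗ push f := lin_ext (by intro l; simp)
  exact congrArg (fun g => g c) this

noncomputable def bdL : List E → Ch E
  | [] => 0
  | x :: l => one l + cone x (bdL l)

noncomputable def bd : Ch E →ₗ[ZMod 2] Ch E := lin bdL

@[simp] theorem bd_one (l : List E) : bd (one l) = bdL l := by simp [bd]

theorem bd_cone (x : E) (c : Ch E) : bd (cone x c) = c + cone x (bd c) := by
  have : bd ∘ₗ cone x = LinearMap.id + cone x ∘ₗ bd := lin_ext (by intro l; simp [bdL])
  exact congrArg (fun g => g c) this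

theorem bd_bd (c : Ch E) : bd (bd c) = 0 := by
  have : bd ∘ₗ bd = (0 : Ch E →ₗ[ZMod 2] Ch E) := by
    apply lin_ext
    intro l
    induction l with
    | nil => simp [bdL]
    | cons x l ih =>
      simp only [LinearMap.comp_apply, bd_one, LinearMap.zero_apply] at ih
      simp [bdL, bd_cone, ih, ch_add_self]
  exact congrArg (fun g => g c) this

theorem bd_push (f : E → F) (c : Ch E) : bd (push f c) = push f (bd c) := by
  have : bd ∘ₗ push f = push f ∘ₗ bd := by
    apply lin_ext
    intro l
    induction l with
    | nil => simp [bdL]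
    | cons x l ih =>
      simp only [LinearMap.comp_apply, bd_one, push_one] at ih
      simp [bdL, push_cone, ih]
  exact congrArg (fun g => g c) this

theorem push_push {G : Type*} (f : E → F) (g : F → G) (c : Ch E) :
    push g (push f c) = push (g ∘ f) c := by
  have : push g ∘ₗ push f = push (g ∘ f) := lin_ext (by intro l; simp)
  exact congrArg (fun g => g c) this

/-- evaluation of a cochain -/
theorem lin_push {M : Type*} [AddCommGroup M] [Module (ZMod 2) M] (g : List F → M) (f : E → F)
    (c : Ch E) : lin g (push f c) = lin (fun l => g (l.map f)) c := by
  have : lin g ∘ₗ push f = lin (fun l => g (l.map f)) := lin_ext (by intro l; simp)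
  exact congrArg (fun g => g c) this

/-- chains supported on lists with a property -/
def Sup (P : List E → Prop) : Submodule (ZMod 2) (Ch E) := Finsupp.supported (ZMod 2) (ZMod 2) {l | P l}

theorem one_mem {P : List E → Prop} {l : List E} (h : P l) : one l ∈ Sup P :=
  Finsupp.single_mem_supported _ _ h

theorem Sup_eq_span (P : List E → Prop) : Sup P = Submodule.span (ZMod 2) (one '' {l | P l}) :=
  Finsupp.supported_eq_span_single _ _

theorem mem_Sup_iff {P : List E → Prop} {c : Ch E} : c ∈ Sup P ↔ ∀ l ∈ c.support, P l := by
  simp [Sup, Finsupp.mem_supported, Set.subset_def]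

theorem self_mem (c : Ch E) : c ∈ Sup (fun l => l ∈ c.support) := mem_Sup_iff.2 (fun _ h => h)

theorem Sup_mono {P Q : List E → Prop} (h : ∀ l, P l → Q l) : Sup P ≤ Sup Q :=
  Finsupp.supported_mono (fun l hl => h l hl)

theorem map_mem {M : Type*} [AddCommGroup M] [Module (ZMod 2) M] {P : List E → Prop}
    (f : Ch E →ₗ[ZMod 2] M) (S : Submodule (ZMod 2) M)
    (h : ∀ l, P l → f (one l) ∈ S) {c : Ch E} (hc : c ∈ Sup P) : f c ∈ S := by
  rw [Sup_eq_span] at hc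
  induction hc using Submodule.span_induction with
  | mem x hx => obtain ⟨l, hl, rfl⟩ := hx; exact h l hl
  | zero => simp
  | add x y _ _ hx hy => rw [map_add]; exact S.add_mem hx hy
  | smul a x _ hx => rw [map_smul]; exact S.smul_mem a hx

theorem map_eq {M : Type*} [AddCommGroup M] [Module (ZMod 2) M] {P : List E → Prop}
    (f g : Ch E →ₗ[ZMod 2] M)
    (h : ∀ l, P l → f (one l) = g (one l)) {c : Ch E} (hc : c ∈ Sup P) : f c = g c := by
  have := map_mem (f - g) ⊥ (P := P) (fun l hl => by simp [h l hl]) hc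
  simpa [sub_eq_zero] using this

theorem bdL_mem (l : List E) : bdL l ∈ Sup (fun m => m.length + 1 = l.length ∧ ∀ x ∈ m, x ∈ l) := by
  induction l with
  | nil => simp [bdL]
  | cons x l ih =>
    rw [bdL]
    refine Submodule.add_mem _ (one_mem ⟨by simp, fun y hy => by simp [hy]⟩) ?_
    refine map_mem _ _ ?_ ih
    intro m hm
    rw [cone_one]
    refine one_mem ⟨by simp [hm.1], ?_⟩
    intro y hy
    simp only [List.mem_cons] at hy ⊢
    exact hy.imp id (hm.2 y)

/-- the prism operator -/
noncomputable def prL (i j : E → F) : List E → Ch F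
  | [] => 0
  | x :: l => cone (i x) (one ((x :: l).map j) + prL i j l)

noncomputable def pr (i j : E → F) : Ch E →ₗ[ZMod 2] Ch F := lin (prL i j)

@[simp] theorem pr_one (i j : E → F) (l : List E) : pr i j (one l) = prL i j l := by simp [pr]

theorem pr_cone (i j : E → F) (x : E) (c : Ch E) :
    pr i j (cone x c) = cone (i x) (cone (j x) (push j c) + pr i j c) := by
  have : pr i j ∘ₗ cone x = cone (i x) ∘ₗ (cone (j x) ∘ₗ push j + pr i j) :=
    lin_ext (by intro l; simp [prL])
  exact congrArg (fun g => g c) this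

theorem bd_pr (i j : E → F) (c : Ch E) :
    bd (pr i j c) + pr i j (bd c) = push i c + push j c := by
  have : bd ∘ₗ pr i j + pr i j ∘ₗ bd = push i + push j := by
    apply lin_ext
    intro l
    induction l with
    | nil => simp [prL, bdL, ch_add_self]
    | cons x l ih =>
      simp only [LinearMap.add_apply, LinearMap.comp_apply, pr_one, bd_one, push_one] at ih
      have ih2 : bd (prL i j l) = one (l.map i) + one (l.map j) + pr i j (bdL l) := by
        rw [← ih, add_assoc, ch_add_self, add_zero]
      have e : push j (bdL l) = bdL (l.map j) := by rw [← bd_one, ← bd_push]; simp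
      simp only [LinearMap.add_apply, LinearMap.comp_apply, pr_one, bd_one, push_one, prL, bdL,
        map_add, bd_cone, pr_cone, ih2, List.map_cons, cone_one, e]
      generalize one (i x :: j x :: List.map j l) = a1
      generalize one (i x :: l.map i) = a2
      generalize one (i x :: l.map j) = a3
      generalize (cone (i x)) ((pr i j) (bdL l)) = a4
      generalize one (j x :: l.map j) = a5
      generalize prL i j l = a6
      generalize (cone (i x)) ((cone (j x)) (bdL (List.map j l))) = a7
      have h3 := ch_add_self a3
      have h4 := ch_add_self a4
      have h6 := ch_add_self a6
      have h7 := ch_add_self a7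
      calc _ = a2 + a5 + (a3 + a3) + (a4 + a4) + (a6 + a6) + (a7 + a7) := by abel
        _ = _ := by rw [h3, h4, h6, h7]; simp
  exact congrArg (fun g => g c) this

theorem prL_mem (i j : E → F) (l : List E) : prL i j l ∈
    Sup (fun m => m.length = l.length + 1 ∧ ∀ y ∈ m, ∃ x ∈ l, y = i x ∨ y = j x) := by
  induction l with
  | nil => simp [prL]
  | cons x l ih =>
    rw [prL, map_add, cone_one]
    refine Submodule.add_mem _ (one_mem ⟨by simp, ?_⟩) ?_
    · intro y hy
      simp only [List.map_cons, List.mem_cons, List.mem_map] at hy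
      rcases hy with rfl | rfl | ⟨z, hz, rfl⟩
      · exact ⟨x, by simp, Or.inl rfl⟩
      · exact ⟨x, by simp, Or.inr rfl⟩
      · exact ⟨z, by simp [hz], Or.inr rfl⟩
    · refine map_mem _ _ ?_ ih
      intro m hm
      rw [cone_one]
      refine one_mem ⟨by simp [hm.1], ?_⟩
      intro y hy
      rcases List.mem_cons.1 hy with rfl | hy
      · exact ⟨x, by simp, Or.inl rfl⟩
      · obtain ⟨z, hz, h⟩ := hm.2 y hy
        exact ⟨z, by simp [hz], h⟩

theorem pr_push {G H : Type*} (i j : E → F) (f : G → E) (i' j' : G → H) (g : H → F)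
    (hi : ∀ x, g (i' x) = i (f x)) (hj : ∀ x, g (j' x) = j (f x)) (c : Ch G) :
    pr i j (push f c) = push g (pr i' j' c) := by
  have : pr i j ∘ₗ push f = push g ∘ₗ pr i' j' := by
    apply lin_ext
    intro l
    induction l with
    | nil => simp [prL]
    | cons x l ih =>
      simp only [LinearMap.comp_apply, pr_one, push_one] at ih
      simp only [LinearMap.comp_apply, pr_one, push_one, List.map_cons, prL, push_cone, map_add, ih, hi,
        hj, List.map_map]
      congr 4
      apply List.map_congr_left
      intro y _; simp [hj]
  exact congrArg (fun g => g c) this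

end chains
end AC

namespace AC

section labels
open Classical in
noncomputable def chi (A : Multiset ℕ) (L : List ℕ) : ZMod 2 := if (L : Multiset ℕ) = A then 1 else 0

open Classical in
theorem chi_bd (L : List ℕ) : ∀ A : Multiset ℕ, A.Nodup →
    lin (chi A) (bdL L) = if ∃ b, b ∉ A ∧ (L : Multiset ℕ) = b ::ₘ A then 1 else 0 := by
  induction L with
  | nil =>
    intro A _
    have : ¬ ∃ b, b ∉ A ∧ (([] : List ℕ) : Multiset ℕ) = b ::ₘ A := by
      rintro ⟨b, _, h⟩
      exact Multiset.cons_ne_zero h.symm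
    simp [bdL]
  | cons x l ih =>
    intro A hA
    have hc : lin (chi A) (cone x (bdL l)) = if x ∈ A then lin (chi (A.erase x)) (bdL l) else 0 := by
      have : lin (chi A) ∘ₗ cone x = if x ∈ A then lin (chi (A.erase x)) else 0 := by
        apply lin_ext
        intro m
        by_cases hx : x ∈ A
        · simp only [LinearMap.comp_apply, cone_one, lin_one, hx, if_true, chi]
          have : ((x :: m : List ℕ) : Multiset ℕ) = A ↔ (m : Multiset ℕ) = A.erase x := by
            rw [← Multiset.cons_coe]
            constructor
            · rintro rfl; simp
            · intro h; rw [h, Multiset.cons_erase hx]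
          simp [this]
        · simp only [LinearMap.comp_apply, cone_one, lin_one, hx, if_false, chi, LinearMap.zero_apply]
          rw [if_neg]
          rintro rfl
          simp at hx
      have h2 := congrArg (fun g => g (bdL l)) this
      simp only [LinearMap.comp_apply] at h2
      rw [h2]
      split_ifs <;> simp
    rw [bdL, map_add, hc, lin_one]
    by_cases hx : x ∈ A
    · rw [if_pos hx, ih _ (hA.erase x)]
      have h1 : (∃ b, b ∉ A ∧ ((x :: l : List ℕ) : Multiset ℕ) = b ::ₘ A) ↔
          ∃ b, b ∉ A ∧ (l : Multiset ℕ) = b ::ₘ A.erase x := by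
        refine exists_congr fun b => and_congr_right fun hb => ?_
        rw [← Multiset.cons_coe]
        conv_lhs => rw [← Multiset.cons_erase hx, Multiset.cons_swap]
        exact Multiset.cons_inj_right x
      have h2 : (∃ b, b ∉ A.erase x ∧ (l : Multiset ℕ) = b ::ₘ A.erase x) ↔
          ((l : Multiset ℕ) = A ∨ ∃ b, b ∉ A ∧ (l : Multiset ℕ) = b ::ₘ A.erase x) := by
        constructor
        · rintro ⟨b, hb, h⟩
          by_cases hbA : b ∈ A
          · have : b = x := by
              by_contra hne
              exact hb ((Multiset.mem_erase_of_ne hne).2 hbA)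
            subst this
            left; rw [h, Multiset.cons_erase hx]
          · exact Or.inr ⟨b, hbA, h⟩
        · rintro (h | ⟨b, hb, h⟩)
          · exact ⟨x, hA.notMem_erase, by rw [h, Multiset.cons_erase hx]⟩
          · exact ⟨b, fun hb2 => hb (Multiset.mem_of_mem_erase hb2), h⟩
      rw [h1]
      simp only [h2, chi]
      by_cases hl : (l : Multiset ℕ) = A
      · have : ¬ ∃ b, b ∉ A ∧ (l : Multiset ℕ) = b ::ₘ A.erase x := by
          rintro ⟨b, hb, h⟩
          apply hb
          rw [← hl, h]; simp
        simp only [hl, true_or, if_true]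
        rw [hl] at this
        rw [if_neg this]
        decide
      · simp [hl]
    · rw [if_neg hx, add_zero]
      have : (∃ b, b ∉ A ∧ ((x :: l : List ℕ) : Multiset ℕ) = b ::ₘ A) ↔ (l : Multiset ℕ) = A := by
        rw [← Multiset.cons_coe]
        constructor
        · rintro ⟨b, hb, h⟩
          have hxb : x ∈ b ::ₘ A := by rw [← h]; simp
          rcases Multiset.mem_cons.1 hxb with rfl | h3
          · exact (Multiset.cons_inj_right x).1 h
          · exact absurd h3 hx
        · intro h; exact ⟨x, hx, by rw [h]⟩
      simp [this, chi]
end labels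

section subdiv
variable {E F : Type*} [AddCommGroup E] [Module ℝ E] [AddCommGroup F] [Module ℝ F]

noncomputable def bary (l : List E) : E := (l.length : ℝ)⁻¹ • l.sum

noncomputable def recF (z0 : Ch E) (e : List E → Ch E) : ℕ → List E → Ch E
  | 0, _ => z0
  | k + 1, l => cone (bary l) (e l + lin (recF z0 e k) (bdL l))

noncomputable def sdL (l : List E) : Ch E := recF (one []) (fun _ => 0) l.length l
noncomputable def TL (l : List E) : Ch E := recF 0 one l.length l
noncomputable def sd : Ch E →ₗ[ZMod 2] Ch E := lin sdL
noncomputable def TT : Ch E →ₗ[ZMod 2] Ch E := lin TL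

@[simp] theorem sd_one (l : List E) : sd (one l) = sdL l := by simp [sd]
@[simp] theorem TT_one (l : List E) : TT (one l) = TL l := by simp [TT]
@[simp] theorem sdL_nil : sdL ([] : List E) = one [] := rfl
@[simp] theorem TL_nil : TL ([] : List E) = 0 := rfl

theorem recF_cons (z0 : Ch E) (e : List E → Ch E) (x : E) (l : List E) :
    recF z0 e (x :: l).length (x :: l) =
      cone (bary (x :: l)) (e (x :: l) + lin (fun m => recF z0 e m.length m) (bdL (x :: l))) := by
  rw [List.length_cons, recF]
  congr 2
  refine map_eq _ _ ?_ (bdL_mem (x :: l))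
  intro m hm
  have : m.length = l.length := by simpa using hm.1
  simp [this]

theorem sdL_cons (x : E) (l : List E) :
    sdL (x :: l) = cone (bary (x :: l)) (sd (bdL (x :: l))) := by
  have := recF_cons (one []) (fun _ => 0) x l
  rw [zero_add] at this
  exact this

theorem TL_cons (x : E) (l : List E) :
    TL (x :: l) = cone (bary (x :: l)) (one (x :: l) + TT (bdL (x :: l))) :=
  recF_cons 0 one x l

theorem bdL_len (l : List E) : bdL l ∈ Sup (fun m => m.length < l.length) :=
  Sup_mono (fun m hm => by omega) (bdL_mem l)

theorem bd_sd (c : Ch E) : bd (sd c) = sd (bd c) := by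
  have key : ∀ (k : ℕ) (l : List E), l.length < k → bd (sdL l) = sd (bdL l) := by
    intro k
    induction k with
    | zero => intro l hl; omega
    | succ k ih =>
      intro l hl
      cases l with
      | nil => simp [bdL]
      | cons x l =>
        rw [sdL_cons, bd_cone]
        have : bd (sd (bdL (x :: l))) = sd (bd (bdL (x :: l))) := by
          have h3 : (bd ∘ₗ sd) (bdL (x :: l)) = (sd ∘ₗ bd) (bdL (x :: l)) := by
            apply map_eq _ _ _ (bdL_len (x :: l))
            intro m hm
            rw [LinearMap.comp_apply, LinearMap.comp_apply, sd_one, bd_one]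
            exact ih m (by omega)
          rwa [LinearMap.comp_apply, LinearMap.comp_apply] at h3
        rw [this, ← bd_one (x :: l), bd_bd]
        simp
  have : bd ∘ₗ sd = sd ∘ₗ (bd : Ch E →ₗ[ZMod 2] Ch E) := by
    apply lin_ext
    intro l
    simpa using key _ l (Nat.lt_succ_self _)
  exact congrArg (fun g => g c) this

theorem bd_TT (c : Ch E) : bd (TT c) + TT (bd c) = c + sd c := by
  have key : ∀ (k : ℕ) (l : List E), l.length < k → bd (TL l) + TT (bdL l) = one l + sdL l := by
    intro k
    induction k with
    | zero => intro l hl; omega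
    | succ k ih =>
      intro l hl
      cases l with
      | nil => simp [bdL, ch_add_self]
      | cons x l =>
        rw [TL_cons, bd_cone]
        have h0 : bd (TT (bdL (x :: l))) + TT (bd (bdL (x :: l))) =
            bdL (x :: l) + sd (bdL (x :: l)) := by
          refine map_eq (bd ∘ₗ TT + TT ∘ₗ bd) (LinearMap.id + sd) ?_ (bdL_len (x :: l))
          intro m hm
          simp only [LinearMap.comp_apply, LinearMap.add_apply, TT_one, bd_one, sd_one,
            LinearMap.id_apply]
          exact ih m (by omega)
        have h1 : bd (bdL (x :: l)) = 0 := by rw [← bd_one, bd_bd]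
        rw [h1, map_zero, add_zero] at h0
        rw [map_add, h0, bd_one, ← add_assoc (bdL (x :: l)), ch_add_self, zero_add, sdL_cons]
        rw [add_right_comm, add_assoc (one (x :: l)), ch_add_self, add_zero]
  have : bd ∘ₗ TT + TT ∘ₗ bd = LinearMap.id + (sd : Ch E →ₗ[ZMod 2] Ch E) := by
    apply lin_ext
    intro l
    simpa using key _ l (Nat.lt_succ_self _)
  exact congrArg (fun g => g c) this

theorem sd_push (f : E → F) (hf : ∀ (x : E) (l : List E), f (bary (x :: l)) = bary ((x :: l).map f))
    (c : Ch E) : sd (push f c) = push f (sd c) := by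
  have key : ∀ (k : ℕ) (l : List E), l.length < k → sdL (l.map f) = push f (sdL l) := by
    intro k
    induction k with
    | zero => intro l hl; omega
    | succ k ih =>
      intro l hl
      cases l with
      | nil => simp
      | cons x l =>
        have h0 : sd (push f (bdL (x :: l))) = push f (sd (bdL (x :: l))) := by
          refine map_eq (sd ∘ₗ push f) (push f ∘ₗ sd) ?_ (bdL_len (x :: l))
          intro m hm
          simp only [LinearMap.comp_apply, push_one, sd_one]
          exact ih m (by omega)
        have h1 : push f (bdL (x :: l)) = bdL ((x :: l).map f) := by
          rw [← bd_one, ← bd_push, push_one, bd_one]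
        rw [sdL_cons, push_cone, ← h0, h1, hf, List.map_cons, sdL_cons]
  have : sd ∘ₗ push f = push f ∘ₗ (sd : Ch E →ₗ[ZMod 2] Ch E) := by
    apply lin_ext
    intro l
    simpa using key _ l (Nat.lt_succ_self _)
  exact congrArg (fun g => g c) this

theorem bary_perm {l m : List E} (h : l.Perm m) : bary l = bary m := by
  rw [bary, bary, h.length_eq, h.sum_eq]

/-- subdivision does not see the order of the vertices -/
theorem sdL_perm (k : ℕ) : ∀ l m : List E, l.length < k → l.Perm m → sdL l = sdL m := by
  induction k with
  | zero => intro l m hl; omega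
  | succ k ih =>
    -- faces of permuted lists agree after subdivision
    have aux : ∀ l m : List E, l.Perm m → l.length < k + 1 → ∀ p : List E,
        (∀ q r : List E, q.Perm r → q.length < l.length → sdL (p ++ q) = sdL (p ++ r)) →
        sd (lin (fun q => one (p ++ q)) (bdL l)) = sd (lin (fun q => one (p ++ q)) (bdL m)) := by
      intro l m hlm
      induction hlm with
      | nil => intros; rfl
      | @cons x l m hlm ih2 =>
        intro hl p hp
        have e : ∀ c : Ch E, lin (fun q => one (p ++ q)) (cone x c) =
            lin (fun q => one ((p ++ [x]) ++ q)) c := by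
          intro c
          have : lin (fun q => one (p ++ q)) ∘ₗ cone x = lin (fun q => one ((p ++ [x]) ++ q)) :=
            lin_ext (by intro l; simp)
          exact congrArg (fun g => g c) this
        simp only [bdL, map_add, lin_one, e, sd_one]
        congr 1
        · exact hp _ _ hlm (by simp)
        · apply ih2 (by simp at hl; omega)
          intro q r hqr hq
          simpa using hp (x :: q) (x :: r) (hqr.cons x) (by simpa using hq)
      | swap x y l =>
        intro hl p hp
        simp only [bdL, map_add, cone_one, lin_one, sd_one]
        have e : sd (lin (fun q => one (p ++ q)) (cone y (cone x (bdL l)))) =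
            sd (lin (fun q => one (p ++ q)) (cone x (cone y (bdL l)))) := by
          have h3 : (sd ∘ₗ lin (fun q => one (p ++ q)) ∘ₗ cone y ∘ₗ cone x) (bdL l) =
              (sd ∘ₗ lin (fun q => one (p ++ q)) ∘ₗ cone x ∘ₗ cone y) (bdL l) := by
            apply map_eq _ _ _ (bdL_mem l)
            intro q hq
            simp only [LinearMap.comp_apply, cone_one, lin_one, sd_one]
            exact hp _ _ (List.Perm.swap _ _ _) (by simp; omega)
          simp only [LinearMap.comp_apply] at h3
          exact h3
        rw [e]; abel
      | @trans l m r h1 h2 ih1 ih2 =>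
        intro hl p hp
        rw [ih1 hl p hp]
        exact ih2 (by rw [← h1.length_eq]; exact hl) p
          (fun q r hqr hq => hp q r hqr (by rw [h1.length_eq]; exact hq))
    intro l m hl hlm
    cases l with
    | nil => rw [List.nil_perm] at hlm; rw [hlm]
    | cons x l =>
      cases m with
      | nil => simp at hlm
      | cons y m =>
        rw [sdL_cons, sdL_cons, bary_perm hlm]
        congr 1
        have := aux _ _ hlm hl [] (fun q r hqr hq => ih _ _ (by simpa using by simp at hq hl; omega) hqr)
        have e : lin (fun q => one ([] ++ q)) = (LinearMap.id : Ch E →ₗ[ZMod 2] Ch E) :=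
          lin_ext (by intro l; simp)
        rw [e] at this
        simpa using this

theorem sd_perm {l m : List E} (h : l.Perm m) : sdL l = sdL m := sdL_perm _ l m (Nat.lt_succ_self _) h

/-- generic support control for subdivision-like operators by convex sets -/
theorem bary_mem {C : Set E} (hC : Convex ℝ C) (x : E) (l : List E) (h : ∀ y ∈ x :: l, y ∈ C) :
    bary (x :: l) ∈ C := by
  have h1 : bary (x :: l) = ∑ i : Fin (x :: l).length, (((x :: l).length : ℝ)⁻¹) • (x :: l).get i := by
    rw [← Finset.smul_sum, bary]
    congr 1
    rw [← List.sum_ofFn, List.ofFn_get]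
  rw [h1]
  refine hC.sum_mem (fun i _ => by positivity) ?_ (fun i _ => h _ (List.get_mem _ _))
  rw [Finset.sum_const, Finset.card_univ, Fintype.card_fin, nsmul_eq_mul]
  have : ((x :: l).length : ℝ) ≠ 0 := by simp; positivity
  field_simp

theorem sdL_sub {C : Set E} (hC : Convex ℝ C) (k : ℕ) : ∀ l : List E, l.length < k →
    (∀ y ∈ l, y ∈ C) → sdL l ∈ Sup (fun m => m.length = l.length ∧ ∀ y ∈ m, y ∈ C) := by
  induction k with
  | zero => intro l hl; omega
  | succ k ih =>
    intro l hl h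
    cases l with
    | nil => exact one_mem ⟨rfl, by simp⟩
    | cons x l =>
      rw [sdL_cons]
      have h0 : sd (bdL (x :: l)) ∈ Sup (fun m => m.length = l.length ∧ ∀ y ∈ m, y ∈ C) := by
        refine map_mem sd _ ?_ (bdL_mem (x :: l))
        intro m hm
        rw [sd_one]
        have e : m.length = l.length := by simpa using hm.1
        rw [← e]
        exact ih m (by simp at hl; omega) (fun y hy => h y (hm.2 y hy))
      refine map_mem _ _ ?_ h0
      intro m hm
      rw [cone_one]
      refine one_mem ⟨by simp [hm.1], ?_⟩
      intro y hy
      rcases List.mem_cons.1 hy with rfl | hy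
      · exact bary_mem hC x l h
      · exact hm.2 y hy

theorem TL_sub {C : Set E} (hC : Convex ℝ C) (k : ℕ) : ∀ l : List E, l.length < k →
    (∀ y ∈ l, y ∈ C) → TL l ∈ Sup (fun m => ∀ y ∈ m, y ∈ C) := by
  induction k with
  | zero => intro l hl; omega
  | succ k ih =>
    intro l hl h
    cases l with
    | nil => simp
    | cons x l =>
      rw [TL_cons]
      have h0 : TT (bdL (x :: l)) ∈ Sup (fun m => ∀ y ∈ m, y ∈ C) := by
        refine map_mem TT _ ?_ (bdL_mem (x :: l))
        intro m hm
        rw [TT_one]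
        exact ih m (by simp at hl hm; omega) (fun y hy => h y (hm.2 y hy))
      refine map_mem (P := fun m => ∀ y ∈ m, y ∈ C) _ _ ?_ (Submodule.add_mem _ (one_mem h) h0)
      intro m hm
      rw [cone_one]
      refine one_mem ?_
      intro y hy
      rcases List.mem_cons.1 hy with rfl | hy
      · exact bary_mem hC x l h
      · exact hm y hy

end subdiv
end AC

namespace AC
open Filter Topology

section mesh
variable {E : Type*} [NormedAddCommGroup E] [NormedSpace ℝ E]

/-- convex hull of the points of a list -/
def hull (L : List E) : Set E := convexHull ℝ {x | x ∈ L}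

theorem mem_hull {L : List E} {x : E} (h : x ∈ L) : x ∈ hull L := subset_convexHull ℝ _ h

theorem hull_convex (L : List E) : Convex ℝ (hull L) := convex_convexHull ℝ _

theorem hull_sub {L : List E} {C : Set E} (hC : Convex ℝ C) (h : ∀ x ∈ L, x ∈ C) : hull L ⊆ C :=
  convexHull_min h hC

theorem hull_mono {L M : List E} (h : ∀ x ∈ L, x ∈ M) : hull L ⊆ hull M := convexHull_mono h

theorem hull_compact (L : List E) : IsCompact (hull L) :=
  Set.Finite.isCompact_convexHull ℝ (List.finite_toSet L)

theorem hull_nil : hull ([] : List E) = ∅ := by simp [hull]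

def Dm (r : ℝ) (L : List E) : Prop := ∀ x ∈ L, ∀ y ∈ L, dist x y ≤ r

theorem dist_bary (x0 : E) (l : List E) (r : ℝ) (h : Dm r (x0 :: l)) (x : E) (hx : x ∈ x0 :: l) :
    dist (bary (x0 :: l)) x ≤ (l.length / (l.length + 1) : ℝ) * r := by
  obtain ⟨s, t, e⟩ := List.append_of_mem hx
  have hp : (x0 :: l).Perm (x :: (s ++ t)) := by rw [e]; exact List.perm_middle
  have hlen : (s ++ t).length = l.length := by simpa using hp.length_eq.symm
  rw [bary_perm hp]
  set m := s ++ t with hm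
  have hD : ∀ y ∈ m, dist y x ≤ r := fun y hy => h _ (hp.mem_iff.2 (List.mem_cons_of_mem _ hy)) _ hx
  have h1 : ∀ q : List E, (∀ y ∈ q, dist y x ≤ r) → ‖q.sum - (q.length : ℝ) • x‖ ≤ q.length * r := by
    intro q
    induction q with
    | nil => simp
    | cons y q ih =>
      intro hq
      have e : (y :: q).sum - ((y :: q).length : ℝ) • x = (y - x) + (q.sum - (q.length : ℝ) • x) := by
        simp [add_smul]; abel
      rw [e]
      refine (norm_add_le _ _).trans ?_
      have a1 := ih (fun z hz => hq z (List.mem_cons_of_mem _ hz))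
      have a2 := hq y List.mem_cons_self
      rw [dist_eq_norm] at a2
      push_cast [List.length_cons]
      linarith
  have h2 := h1 m hD
  have hpos : (0:ℝ) < (m.length : ℝ) + 1 := by positivity
  have e2 : bary (x :: m) - x = ((m.length : ℝ) + 1)⁻¹ • (m.sum - (m.length : ℝ) • x) := by
    rw [bary, List.length_cons, List.sum_cons]
    have : x = ((m.length : ℝ) + 1)⁻¹ • (((m.length : ℝ) + 1) • x) := by
      rw [smul_smul, inv_mul_cancel₀ hpos.ne', one_smul]
    rw [Nat.cast_succ]
    nth_rewrite 2 [this]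
    rw [← smul_sub]
    congr 1
    rw [add_smul, one_smul]; abel
  rw [dist_eq_norm, e2, norm_smul, Real.norm_of_nonneg (by positivity), ← hlen]
  calc ((m.length : ℝ) + 1)⁻¹ * ‖m.sum - (m.length : ℝ) • x‖ ≤ ((m.length : ℝ) + 1)⁻¹ * (m.length * r) := by gcongr
    _ = _ := by field_simp

theorem Dm_sd (N : ℕ) (r : ℝ) (hr : 0 ≤ r) (k : ℕ) : ∀ l : List E, l.length < k → l.length ≤ N + 1 → Dm r l →
    sdL l ∈ Sup (fun m => Dm ((N / (N + 1) : ℝ) * r) m) := by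
  have hN : (0:ℝ) ≤ (N / (N + 1) : ℝ) * r := by positivity
  induction k with
  | zero => intro l hl; omega
  | succ k ih =>
    intro l hl hlN h
    cases l with
    | nil => exact one_mem (by intro x hx; simp at hx)
    | cons x l =>
      rw [sdL_cons]
      have h0 : sd (bdL (x :: l)) ∈ Sup (fun m => Dm ((N / (N + 1) : ℝ) * r) m ∧ ∀ y ∈ m, y ∈ hull (x :: l)) := by
        refine map_mem sd _ ?_ (bdL_mem (x :: l))
        intro m hm
        rw [sd_one]
        have hm1 : m.length = l.length := by simpa using hm.1
        have a1 := ih m (by simp at hl; omega) (by simp at hlN; omega) (fun y hy z hz => h y (hm.2 y hy) z (hm.2 z hz))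
        have a2 := sdL_sub (hull_convex (x :: l)) _ m (Nat.lt_succ_self _) (fun y hy => mem_hull (hm.2 y hy))
        rw [mem_Sup_iff] at a1 a2 ⊢
        exact fun q hq => ⟨a1 q hq, (a2 q hq).2⟩
      refine map_mem _ _ ?_ h0
      intro m hm
      rw [cone_one]
      have key : ∀ y ∈ hull (x :: l), dist (bary (x :: l)) y ≤ (N / (N + 1) : ℝ) * r := by
        have : hull (x :: l) ⊆ Metric.closedBall (bary (x :: l)) ((N / (N + 1) : ℝ) * r) := by
          refine hull_sub (convex_closedBall _ _) ?_
          intro y hy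
          rw [Metric.mem_closedBall, dist_comm]
          refine (dist_bary x l r h y hy).trans ?_
          have : (l.length : ℝ) ≤ N := by simp at hlN; exact_mod_cast hlN
          gcongr ?_ * r
          rw [div_le_div_iff₀ (by positivity) (by positivity)]
          nlinarith
        intro y hy
        have := this hy
        rwa [Metric.mem_closedBall, dist_comm] at this
      refine one_mem ?_
      intro y hy z hz
      rcases List.mem_cons.1 hy with rfl | hy <;> rcases List.mem_cons.1 hz with rfl | hz
      · simpa using hN
      · exact key _ (hm.2 z hz)
      · rw [dist_comm]; exact key _ (hm.2 y hy)
      · exact hm.1 y hy z hz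

theorem sd_iter_mesh (L : List E) (N : ℕ) (hN : L.length ≤ N + 1) (r : ℝ) (hr : 0 ≤ r) (hD : Dm r L) (M : ℕ) :
    sd^[M] (one L) ∈ Sup (fun m => m.length = L.length ∧ (∀ y ∈ m, y ∈ hull L) ∧ Dm ((N / (N + 1) : ℝ) ^ M * r) m) := by
  induction M with
  | zero => exact one_mem ⟨rfl, fun y hy => mem_hull hy, by simpa using hD⟩
  | succ M ih =>
    rw [Function.iterate_succ_apply']
    refine map_mem sd _ ?_ ih
    intro m hm
    rw [sd_one]
    have a1 := Dm_sd N _ (by positivity) _ m (Nat.lt_succ_self _) (by omega) hm.2.2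
    have a2 := sdL_sub (hull_convex L) _ m (Nat.lt_succ_self _) hm.2.1
    rw [mem_Sup_iff] at a1 a2 ⊢
    refine fun q hq => ⟨(a2 q hq).1.trans hm.1, (a2 q hq).2, ?_⟩
    have := a1 q hq
    rwa [← mul_assoc, ← pow_succ'] at this

theorem iter_zero (M : ℕ) : sd^[M] (0 : Ch E) = 0 := by
  induction M with
  | zero => rfl
  | succ M ih => rw [Function.iterate_succ_apply', ih, map_zero]

theorem iter_add (M : ℕ) (a b : Ch E) : sd^[M] (a + b) = sd^[M] a + sd^[M] b := by
  induction M with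
  | zero => rfl
  | succ M ih => simp only [Function.iterate_succ_apply', ih, map_add]

theorem iter_eq (M : ℕ) (a : Ch E) : sd^[M] a = (sd ^ M) a := by
  rw [Module.End.pow_apply]

theorem bd_iter (M : ℕ) (a : Ch E) : bd (sd^[M] a) = sd^[M] (bd a) := by
  induction M with
  | zero => rfl
  | succ M ih => simp only [Function.iterate_succ_apply', bd_sd, ih]

/-- Lebesgue number lemma for one simplex -/
theorem leb1 (P : Set E → Prop) (hP : ∀ A B, A ⊆ B → P B → P A) (h0 : P ∅) (L : List E)
    (h : ∀ x ∈ hull L, ∃ N ∈ 𝓝[hull L] x, P N) :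
    ∀ᶠ M in atTop, sd^[M] (one L) ∈ Sup (fun l => l.length = L.length ∧ hull l ⊆ hull L ∧ P (hull l)) := by
  choose! c hc hPc using h
  obtain ⟨δ, hδ, hleb⟩ : ∃ δ > 0, ∀ x ∈ hull L, ∃ y ∈ hull L, Metric.ball x δ ∩ hull L ⊆ c y := by
    have h2 : ∀ x : hull L, ∃ U : Set E, IsOpen U ∧ x.1 ∈ U ∧ U ∩ hull L ⊆ c x := fun x =>
      mem_nhdsWithin.1 (hc x.1 x.2)
    choose U hU1 hU2 hU3 using h2
    obtain ⟨δ, hδ, h3⟩ := lebesgue_number_lemma_of_metric (hull_compact L) hU1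
      (fun x hx => Set.mem_iUnion.2 ⟨⟨x, hx⟩, hU2 _⟩)
    refine ⟨δ, hδ, fun x hx => ?_⟩
    obtain ⟨i, hi⟩ := h3 x hx
    exact ⟨i.1, i.2, fun y hy => hU3 i ⟨hi hy.1, hy.2⟩⟩
  obtain ⟨r, hr, hD⟩ : ∃ r, 0 ≤ r ∧ Dm r L := by
    refine ⟨Metric.diam (hull L), Metric.diam_nonneg, fun x hx y hy => ?_⟩
    exact Metric.dist_le_diam_of_mem (hull_compact L).isBounded (mem_hull hx) (mem_hull hy)
  have ht : Tendsto (fun M : ℕ => ((L.length : ℝ) / (L.length + 1)) ^ M * r) atTop (𝓝 (0 * r)) := by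
    refine Tendsto.mul_const _ (tendsto_pow_atTop_nhds_zero_of_lt_one (by positivity) ?_)
    rw [div_lt_one (by positivity)]; linarith
  rw [zero_mul] at ht
  filter_upwards [ht.eventually (gt_mem_nhds hδ)] with M hM
  refine Sup_mono ?_ (sd_iter_mesh L L.length (by omega) r hr hD M)
  rintro l ⟨h1, h2, h3⟩
  have hl := hull_sub (hull_convex L) h2
  refine ⟨h1, hl, ?_⟩
  cases l with
  | nil => rw [hull_nil]; exact h0
  | cons x l =>
    obtain ⟨y, hy, hyc⟩ := hleb x (h2 x List.mem_cons_self)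
    refine hP _ _ ?_ (hPc y hy)
    refine Set.Subset.trans (Set.subset_inter ?_ hl) hyc
    refine hull_sub (convex_ball _ _) ?_
    intro z hz
    exact (h3 z hz x List.mem_cons_self).trans_lt hM

theorem leb (P : Set E → Prop) (hP : ∀ A B, A ⊆ B → P B → P A) (h0 : P ∅) (z : Ch E)
    (h : ∀ L ∈ z.support, ∀ x ∈ hull L, ∃ N ∈ 𝓝[hull L] x, P N) :
    ∀ᶠ M in atTop, sd^[M] z ∈ Sup (fun l => ∃ L ∈ z.support, l.length = L.length ∧ hull l ⊆ hull L ∧ P (hull l)) := by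
  have h1 : ∀ᶠ M in atTop, ∀ L ∈ z.support, 
      sd^[M] (one L) ∈ Sup (fun l => l.length = L.length ∧ hull l ⊆ hull L ∧ P (hull l)) := by
    rw [Filter.eventually_all_finset]
    exact fun L hL => leb1 P hP h0 L (h L hL)
  filter_upwards [h1] with M hM
  rw [iter_eq]
  refine map_mem (sd ^ M) _ ?_ (self_mem z)
  intro L hL
  rw [← iter_eq]
  exact Sup_mono (fun l hl => ⟨L, hL, hl⟩) (hM L hL)

end mesh
end AC

namespace AC
open Filter Topology

abbrev V (n : ℕ) := EuclideanSpace ℝ (Fin n)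

open Classical in
noncomputable def lab {n : ℕ} (v : V n) : ℕ := if h : ∃ i, v i < 0 then (Classical.choose h).val else n

theorem lab_lt {n : ℕ} {v : V n} (h : lab v < n) : v ⟨lab v, h⟩ < 0 := by
  unfold lab at h ⊢
  by_cases hv : ∃ i, v i < 0
  · simp only [dif_pos hv]
    exact Classical.choose_spec hv
  · rw [dif_neg hv] at h; omega

theorem lab_le {n : ℕ} (v : V n) : lab v ≤ n := by
  unfold lab
  split_ifs with hv
  · exact (Classical.choose hv).2.le
  · exact le_rfl

theorem lab_ge {n : ℕ} {v : V n} (h : n ≤ lab v) (i : Fin n) : 0 ≤ v i := by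
  unfold lab at h
  by_cases hv : ∃ i, v i < 0
  · rw [dif_pos hv] at h
    have := (Classical.choose hv).2
    omega
  · push Not at hv; exact hv i

def NF {n : ℕ} (B : Set (V n)) : Prop := ¬ ((∀ i, ∃ v ∈ B, v i < 0) ∧ ∃ v ∈ B, ∀ i, 0 ≤ v i)

theorem NF_mono {n : ℕ} {A B : Set (V n)} (h : A ⊆ B) (hB : NF B) : NF A := by
  rintro ⟨h1, v, hv, h2⟩
  exact hB ⟨fun i => (h1 i).imp (fun v hv => ⟨h hv.1, hv.2⟩), v, h hv, h2⟩

theorem NF_empty {n : ℕ} : NF (∅ : Set (V n)) := by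
  rintro ⟨_, v, hv, _⟩; exact hv

section ev
variable {n : ℕ} {E F : Type*}

noncomputable def ev (w : E → V n) : Ch E →ₗ[ZMod 2] ZMod 2 :=
  lin (fun L => chi (Multiset.range n) (L.map (fun x => lab (w x))))

theorem ev_one (w : E → V n) (L : List E) :
    ev w (one L) = chi (Multiset.range n) (L.map (fun x => lab (w x))) := by simp [ev]

theorem ev_eq (w : E → V n) (c : Ch E) : ev w c = lin (chi (Multiset.range n)) (push (fun x => lab (w x)) c) := by
  rw [lin_push]; rfl

theorem ev_push (g : F → E) (w : E → V n) (c : Ch F) : ev w (push g c) = ev (fun x => w (g x)) c := by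
  rw [ev, lin_push, ev]
  congr 2
  funext l; simp [Function.comp_def]

theorem ev_bd (w : E → V n) (L : List E) (h : NF (w '' {x | x ∈ L})) : ev w (bdL L) = 0 := by
  rw [ev_eq, ← bd_one, ← bd_push, push_one, bd_one, chi_bd _ _ (Multiset.nodup_range n), if_neg]
  rintro ⟨b, hb, he⟩
  apply h
  have hm : ∀ a, a ∈ L.map (fun x => lab (w x)) ↔ a = b ∨ a < n := by
    intro a
    rw [← Multiset.mem_coe, he]; simp
  constructor
  · intro i
    have := (hm i).2 (Or.inr i.2)
    obtain ⟨x, hx, hxi⟩ := List.mem_map.1 this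
    refine ⟨w x, ⟨x, hx, rfl⟩, ?_⟩
    have := lab_lt (v := w x) (by rw [hxi]; exact i.2)
    simpa [hxi] using this
  · obtain ⟨x, hx, hxi⟩ := List.mem_map.1 ((hm b).2 (Or.inl rfl))
    exact ⟨w x, ⟨x, hx, rfl⟩, lab_ge (by rw [hxi]; simpa using hb)⟩

theorem ev_bd_chain (w : E → V n) (c : Ch E) (h : c ∈ Sup (fun L => NF (w '' {x | x ∈ L}))) : ev w (bd c) = 0 := by
  have : (ev w ∘ₗ bd) c = (0 : Ch E →ₗ[ZMod 2] ZMod 2) c := by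
    apply map_eq _ _ _ h
    intro l hl
    rw [LinearMap.comp_apply, bd_one, ev_bd w l hl]; rfl
  simpa using this

theorem ev_congr (w w' : E → V n) (c : Ch E) (h : c ∈ Sup (fun L => ∀ x ∈ L, w x = w' x)) : ev w c = ev w' c := by
  apply map_eq _ _ _ h
  intro l hl
  rw [ev_one, ev_one]
  congr 1
  apply List.map_congr_left
  intro x hx; rw [hl x hx]

theorem z2 {a b : ZMod 2} (h : a + b = 0) : a = b := by
  revert a b; decide

theorem lemB (w w' : E → V n) (c : Ch E) (hc : bd c = 0)
    (h : c ∈ Sup (fun L => NF (w '' {x | x ∈ L} ∪ w' '' {x | x ∈ L}))) : ev w c = ev w' c := by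
  let W : E × Bool → V n := fun p => if p.2 then w' p.1 else w p.1
  have h1 := bd_pr (fun x : E => (x, false)) (fun x => (x, true)) c
  have h2 : ev W (bd (pr (fun x : E => (x, false)) (fun x => (x, true)) c)) = 0 := by
    apply ev_bd_chain
    refine map_mem _ _ ?_ h
    intro l hl
    rw [pr_one]
    refine Sup_mono ?_ (prL_mem _ _ l)
    intro m hm
    refine NF_mono ?_ hl
    rintro _ ⟨y, hy, rfl⟩
    obtain ⟨x, hx, rfl | rfl⟩ := hm.2 y hy
    · exact Or.inl ⟨x, hx, by simp [W]⟩
    · exact Or.inr ⟨x, hx, by simp [W]⟩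
  rw [hc, map_zero, add_zero] at h1
  rw [h1, map_add, ev_push, ev_push] at h2
  simpa [W] using z2 h2

end ev

section deg
variable {n : ℕ} {E F : Type*} [NormedAddCommGroup E] [NormedSpace ℝ E] [NormedAddCommGroup F] [NormedSpace ℝ F]

theorem TT_hull (P : Set E → Prop) (hP : ∀ A B, A ⊆ B → P B → P A) (c : Ch E)
    (h : c ∈ Sup (fun L => P (hull L))) : TT c ∈ Sup (fun L => P (hull L)) := by
  refine map_mem _ _ ?_ h
  intro l hl
  rw [TT_one]
  refine Sup_mono ?_ (TL_sub (hull_convex l) _ l (Nat.lt_succ_self _) (fun y hy => mem_hull hy))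
  intro m hm
  exact hP _ _ (hull_sub (hull_convex l) hm) hl

theorem sd_hull (P : Set E → Prop) (hP : ∀ A B, A ⊆ B → P B → P A) (c : Ch E)
    (h : c ∈ Sup (fun L => P (hull L))) : sd c ∈ Sup (fun L => P (hull L)) := by
  refine map_mem _ _ ?_ h
  intro l hl
  rw [sd_one]
  refine Sup_mono ?_ (sdL_sub (hull_convex l) _ l (Nat.lt_succ_self _) (fun y hy => mem_hull hy))
  intro m hm
  exact hP _ _ (hull_sub (hull_convex l) hm.2) hl

theorem iter_hull (P : Set E → Prop) (hP : ∀ A B, A ⊆ B → P B → P A) (c : Ch E)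
    (h : c ∈ Sup (fun L => P (hull L))) (M : ℕ) : sd^[M] c ∈ Sup (fun L => P (hull L)) := by
  induction M with
  | zero => exact h
  | succ M ih => rw [Function.iterate_succ_apply']; exact sd_hull P hP _ ih

theorem bd_hull (P : Set E → Prop) (hP : ∀ A B, A ⊆ B → P B → P A) (c : Ch E)
    (h : c ∈ Sup (fun L => P (hull L))) : bd c ∈ Sup (fun L => P (hull L)) := by
  refine map_mem _ _ ?_ h
  intro l hl
  rw [bd_one]
  exact Sup_mono (fun m hm => hP _ _ (hull_mono hm.2) hl) (bdL_mem l)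

theorem NFP (w : E → V n) : ∀ A B : Set E, A ⊆ B → NF (w '' B) → NF (w '' A) :=
  fun _ _ h hB => NF_mono (Set.image_mono h) hB

theorem lemA1 (w : E → V n) (c : Ch E) (hc : bd c = 0) (h : c ∈ Sup (fun L => NF (w '' hull L))) :
    ev w (sd c) = ev w c := by
  have h1 := bd_TT c
  rw [hc, map_zero, add_zero] at h1
  have h2 : ev w (bd (TT c)) = 0 := by
    apply ev_bd_chain
    refine Sup_mono ?_ (TT_hull _ (NFP w) c h)
    intro l hl
    exact NFP w _ _ (fun x hx => mem_hull hx) hl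
  rw [h1, map_add] at h2
  exact (z2 h2).symm

theorem lemA (w : E → V n) (c : Ch E) (hc : bd c = 0) (h : c ∈ Sup (fun L => NF (w '' hull L))) (M : ℕ) :
    ev w (sd^[M] c) = ev w c := by
  induction M with
  | zero => rfl
  | succ M ih =>
    rw [Function.iterate_succ_apply', lemA1 w _ _ (iter_hull _ (NFP w) c h M), ih]
    rw [bd_iter, hc, iter_zero]

def Good (w : E → V n) (L : List E) : Prop := ContinuousOn w (hull L) ∧ ∀ x ∈ hull L, w x ≠ 0

theorem NF_nhds {w : E → V n} {A : Set E} (hw : ContinuousOn w A) {x : E} (hx : x ∈ A) (h0 : w x ≠ 0) :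
    ∃ N ∈ 𝓝[A] x, NF (w '' N) := by
  obtain ⟨i, hi⟩ : ∃ i, w x i ≠ 0 := by
    by_contra hcon
    push Not at hcon
    exact h0 (by ext i; simpa using hcon i)
  have hc : ContinuousWithinAt (fun y => w y i) A x :=
    ((EuclideanSpace.proj (𝕜 := ℝ) i).continuous.comp_continuousOn hw) x hx
  rcases lt_or_gt_of_ne hi with h | h
  · refine ⟨{y | w y i < 0}, hc.eventually (gt_mem_nhds h), ?_⟩
    rintro ⟨_, v, ⟨y, hy, rfl⟩, h2⟩
    exact absurd (h2 i) (not_le.2 hy)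
  · refine ⟨{y | 0 < w y i}, hc.eventually (lt_mem_nhds h), ?_⟩
    rintro ⟨h1, _⟩
    obtain ⟨v, ⟨y, hy, rfl⟩, h2⟩ := h1 i
    exact lt_asymm hy h2

theorem good_leb (w : E → V n) (c : Ch E) (h : c ∈ Sup (Good w)) :
    ∀ᶠ M in atTop, sd^[M] c ∈ Sup (fun L => NF (w '' hull L)) := by
  rw [mem_Sup_iff] at h
  filter_upwards [leb (fun A => NF (w '' A)) (NFP w) (by simpa using NF_empty) c
    (fun L hL x hx => NF_nhds (h L hL).1 hx ((h L hL).2 x hx))] with M hM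
  refine Sup_mono ?_ hM
  rintro l ⟨L, _, _, _, h⟩; exact h

def HasDeg (w : E → V n) (z : Ch E) (d : ZMod 2) : Prop := ∀ᶠ M in atTop, ev w (sd^[M] z) = d

theorem HasDeg.unique {w : E → V n} {z : Ch E} {d d' : ZMod 2} (h : HasDeg w z d) (h' : HasDeg w z d') : d = d' := by
  obtain ⟨M, h1, h2⟩ := (h.and h').exists
  exact h1.symm.trans h2

theorem HasDeg.add {w : E → V n} {z z' : Ch E} {d d' : ZMod 2} (h : HasDeg w z d) (h' : HasDeg w z' d') :
    HasDeg w (z + z') (d + d') := by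
  filter_upwards [h, h'] with M h1 h2
  rw [iter_add, map_add, h1, h2]

theorem HasDeg.zero (w : E → V n) : HasDeg w (0 : Ch E) 0 :=
  Eventually.of_forall (fun M => by rw [iter_zero, map_zero])

theorem hasDeg_bd {w : E → V n} {c : Ch E} (h : c ∈ Sup (Good w)) : HasDeg w (bd c) 0 := by
  filter_upwards [good_leb w c h] with M hM
  rw [← bd_iter]
  exact ev_bd_chain _ _ (Sup_mono (fun l hl => NFP w _ _ (fun x hx => mem_hull hx) hl) hM)

theorem hasDeg_exists {w : E → V n} {z : Ch E} (hz : bd z = 0) (h : z ∈ Sup (Good w)) : ∃ d, HasDeg w z d := by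
  obtain ⟨M, hM⟩ := (good_leb w z h).exists
  refine ⟨ev w (sd^[M] z), ?_⟩
  filter_upwards [eventually_ge_atTop M] with M' hM'
  obtain ⟨k, rfl⟩ := Nat.exists_eq_add_of_le hM'
  rw [add_comm, Function.iterate_add_apply]
  exact lemA w _ (by rw [bd_iter, hz, iter_zero]) hM k

theorem hasDeg_NF {w : E → V n} {z : Ch E} (hz : bd z = 0) (h : z ∈ Sup (fun L => NF (w '' hull L))) :
    HasDeg w z (ev w z) := Eventually.of_forall (fun M => lemA w z hz h M)

theorem HasDeg.congr {w w' : E → V n} {z : Ch E} {d : ZMod 2} (h : HasDeg w z d)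
    (hw : z ∈ Sup (fun L => ∀ x ∈ hull L, w x = w' x)) : HasDeg w' z d := by
  filter_upwards [h] with M hM
  rw [← hM]
  refine (ev_congr _ _ _ ?_).symm
  refine Sup_mono ?_ (iter_hull (fun A => ∀ x ∈ A, w x = w' x) (fun A B hAB hB x hx => hB x (hAB hx)) z hw M)
  intro l hl x hx
  exact hl x (mem_hull hx)

theorem iter_push (f : E → F) (hf : ∀ (x : E) (l : List E), f (bary (x :: l)) = bary ((x :: l).map f))
    (c : Ch E) (M : ℕ) : sd^[M] (push f c) = push f (sd^[M] c) := by
  induction M with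
  | zero => rfl
  | succ M ih => rw [Function.iterate_succ_apply', ih, sd_push f hf, Function.iterate_succ_apply']

theorem hasDeg_push {f : E → F} (hf : ∀ (x : E) (l : List E), f (bary (x :: l)) = bary ((x :: l).map f))
    (w : F → V n) (z : Ch E) (d : ZMod 2) : HasDeg w (push f z) d ↔ HasDeg (fun x => w (f x)) z d := by
  unfold HasDeg
  simp only [iter_push f hf, ev_push]

theorem bary_pair (t : ℝ) (x : E) (l : List E) :
    ((bary (x :: l), t) : E × ℝ) = bary ((x :: l).map (fun y => (y, t))) := by
  have h : ∀ q : List E, (q.map (fun y => ((y, t) : E × ℝ))).sum = (q.sum, q.length * t) := by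
    intro q
    induction q with
    | nil => simp; rfl
    | cons y q ih => rw [List.map_cons, List.sum_cons, ih]; ext <;> simp [add_mul, add_comm]
  rw [bary, bary, h, List.length_map]
  have : (((x :: l).length : ℝ)) ≠ 0 := by simp; positivity
  ext
  · simp
  · simp only [Prod.smul_snd, smul_eq_mul]; field_simp

theorem HasDeg.homotopy (H : E × ℝ → V n) {z : Ch E} (hz : bd z = 0) {d : ZMod 2}
    (hH : z ∈ Sup (fun L => ContinuousOn H (hull L ×ˢ Set.Icc (0:ℝ) 1) ∧ ∀ p ∈ hull L ×ˢ Set.Icc (0:ℝ) 1, H p ≠ 0))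
    (h : HasDeg (fun x => H (x, 0)) z d) : HasDeg (fun x => H (x, 1)) z d := by
  have h1 := bd_pr (fun x : E => (x, (0:ℝ))) (fun x => (x, (1:ℝ))) z
  rw [hz, map_zero, add_zero] at h1
  have h2 : HasDeg H (bd (pr (fun x : E => (x, (0:ℝ))) (fun x => (x, (1:ℝ))) z)) 0 := by
    apply hasDeg_bd
    refine map_mem _ _ ?_ hH
    intro l hl
    rw [pr_one]
    refine Sup_mono ?_ (prL_mem _ _ l)
    intro m hm
    have : hull m ⊆ hull l ×ˢ Set.Icc (0:ℝ) 1 := by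
      refine hull_sub ((hull_convex l).prod (convex_Icc _ _)) ?_
      intro y hy
      obtain ⟨x, hx, rfl | rfl⟩ := hm.2 y hy
      · exact ⟨mem_hull hx, by simp⟩
      · exact ⟨mem_hull hx, by simp⟩
    exact ⟨hl.1.mono this, fun x hx => hl.2 x (this hx)⟩
  rw [h1] at h2
  filter_upwards [h, h2] with M a1 a2
  rw [iter_add, map_add, iter_push _ (bary_pair 0), iter_push _ (bary_pair 1), ev_push, ev_push, a1] at a2
  exact (z2 a2).symm

theorem hasDeg_perm {w : E → V n} {L L' : List E} (h : L.Perm L') (d : ZMod 2) :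
    HasDeg w (bdL L) d → HasDeg w (bdL L') d := by
  intro hd
  filter_upwards [hd, eventually_ge_atTop 1] with M h1 h2
  obtain ⟨k, rfl⟩ := Nat.exists_eq_add_of_le h2
  rw [← bd_one, ← bd_iter, add_comm, Function.iterate_add_apply, Function.iterate_one, sd_one] at h1 ⊢
  rw [← sd_perm h]; exact h1

theorem hasDeg_lin {w : E → V n} {c : Ch E} (g : List E → ZMod 2) (h : c ∈ Sup (fun s => HasDeg w (bdL s) (g s))) :
    HasDeg w (bd c) (lin g c) := by
  rw [mem_Sup_iff] at h
  have h1 : ∀ᶠ M in atTop, ∀ s ∈ c.support, ev w (sd^[M] (bdL s)) = g s := by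
    rw [Filter.eventually_all_finset]; exact h
  filter_upwards [h1] with M hM
  have : (ev w ∘ₗ (sd ^ M) ∘ₗ bd) c = lin g c := by
    apply map_eq _ _ _ (self_mem c)
    intro s hs
    rw [LinearMap.comp_apply, LinearMap.comp_apply, bd_one, ← iter_eq, hM s hs, lin_one]
  rw [← this, LinearMap.comp_apply, LinearMap.comp_apply, ← iter_eq]

end deg
end AC

namespace AC
open Filter Topology

section simplex
variable {n : ℕ}

noncomputable def uu (n : ℕ) (θ : ℝ) (j : ℕ) : V n :=
  WithLp.toLp 2 (fun i : Fin n => if j = i then -θ else if j < n then 0 else θ)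

theorem uu_self (θ : ℝ) (i : Fin n) : uu n θ i i = -θ := by simp [uu]
theorem uu_ne (θ : ℝ) (j : ℕ) (hj : j < n) (i : Fin n) (h : j ≠ i) : uu n θ j i = 0 := by simp [uu, h, hj]
theorem uu_top (θ : ℝ) (j : ℕ) (hj : n ≤ j) (i : Fin n) : uu n θ j i = θ := by
  have : j ≠ i := by have := i.2; omega
  simp [uu, this]; omega

theorem uu_sum (θ : ℝ) (j : ℕ) (hj : j < n) : ∑ i, uu n θ j i = -θ := by
  rw [Finset.sum_eq_single ⟨j, hj⟩]
  · exact uu_self θ ⟨j, hj⟩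
  · intro i _ h; exact uu_ne θ j hj i (fun e => h (Fin.ext e.symm))
  · simp

def LP (a b : ℝ) : Prop := 0 ≤ a ∧ (a = 0 → 0 < b)

def Half (S : Set (V n)) : Prop := ∃ i, (∀ v ∈ S, LP (v i) (-∑ k, v k)) ∨ (∀ v ∈ S, LP (-v i) (-∑ k, v k))

theorem LP_convex (f g : V n →ₗ[ℝ] ℝ) : Convex ℝ {v | LP (f v) (g v)} := by
  rintro x ⟨hx1, hx2⟩ y ⟨hy1, hy2⟩ a b ha hb hab
  have p1 := mul_nonneg ha hx1
  have p2 := mul_nonneg hb hy1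
  simp only [Set.mem_ofPred_eq, LP, map_add, map_smul, smul_eq_mul]
  refine ⟨by linarith, fun h => ?_⟩
  have e1 : a * f x = 0 := by linarith
  have e2 : b * f y = 0 := by linarith
  rcases mul_eq_zero.1 e1 with h1 | h1
  · have hb1 : b = 1 := by linarith
    subst h1 hb1
    have := hy2 (by simpa using e2)
    simpa using this
  · rcases mul_eq_zero.1 e2 with h2 | h2
    · have ha1 : a = 1 := by linarith
      subst h2 ha1
      simpa using hx2 h1
    · have := hx2 h1
      have := hy2 h2
      rcases ha.lt_or_eq with h3 | h3
      · have := mul_pos h3 (hx2 h1); have := mul_nonneg hb (hy2 h2).le; linarith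
      · have hb1 : b = 1 := by linarith
        subst hb1 h3; simpa using hy2 h2

noncomputable def co (i : Fin n) : V n →ₗ[ℝ] ℝ := (EuclideanSpace.proj (𝕜 := ℝ) i).toLinearMap
theorem co_apply (i : Fin n) (v : V n) : co i v = v i := rfl

theorem Half_hull {L : List (V n)} (h : Half {x | x ∈ L}) : Half (hull L) := by
  obtain ⟨i, h | h⟩ := h
  · refine ⟨i, Or.inl ?_⟩
    have := LP_convex (co i) (-∑ k, co k)
    have := hull_sub this (L := L) (by intro x hx; simpa [co_apply] using h x hx)
    intro v hv
    simpa [co_apply] using this hv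
  · refine ⟨i, Or.inr ?_⟩
    have := LP_convex (-co i) (-∑ k, co k)
    have := hull_sub this (L := L) (by intro x hx; simpa [co_apply] using h x hx)
    intro v hv
    simpa [co_apply] using this hv

theorem Half_zero {S : Set (V n)} (h : Half S) : (0 : V n) ∉ S := by
  intro h0
  obtain ⟨i, h | h⟩ := h <;> simpa [LP] using h 0 h0

theorem Half_NF {S : Set (V n)} (h : Half S) : NF S := by
  rintro ⟨h1, v, hv, h2⟩
  obtain ⟨i, h | h⟩ := h
  · obtain ⟨v, hv, hlt⟩ := h1 i
    exact absurd (h v hv).1 (not_le.2 hlt)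
  · have a := h v hv
    have b : v i = 0 := le_antisymm (by linarith [a.1]) (h2 i)
    have c := a.2 (by rw [b]; simp)
    have : 0 ≤ ∑ k, v k := Finset.sum_nonneg (fun k _ => h2 k)
    linarith

theorem lab_uu {θ : ℝ} (hθ : 0 < θ) (j : ℕ) (hj : j ≤ n) : lab (uu n θ j) = j := by
  rcases hj.lt_or_eq with h | h
  · have : lab (uu n θ j) < n := by
      by_contra hcon
      have := lab_ge (not_lt.1 hcon) ⟨j, h⟩
      rw [show uu n θ j ⟨j, h⟩ = -θ from uu_self θ ⟨j, h⟩] at this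
      linarith
    have h2 := lab_lt this
    by_contra hne
    rw [uu_ne θ j h _ (fun e => hne (by simpa using e.symm))] at h2
    exact lt_irrefl _ h2
  · subst h
    by_contra hne
    have h3 : lab (uu j θ j) < j := lt_of_le_of_ne (lab_le _) hne
    have h2 := lab_lt h3
    rw [uu_top θ j le_rfl] at h2
    linarith

/-- a set of vertices `uu j` with a missing label is a half set; moreover compatible points may be added -/
theorem Half_uu (hn : 1 ≤ n) {θ : ℝ} (hθ : 0 < θ) (J : Set ℕ) (hJ : ∀ j ∈ J, j ≤ n) (k : ℕ) (hk : k ≤ n) (hkJ : k ∉ J) :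
    Half (uu n θ '' J) := by
  rcases hk.lt_or_eq with h | h
  · refine ⟨⟨k, h⟩, Or.inl ?_⟩
    rintro _ ⟨j, hj, rfl⟩
    rcases (hJ j hj).lt_or_eq with hjn | hjn
    · rw [uu_ne θ j hjn _ (fun e => hkJ (by simp at e; rwa [← e])), uu_sum θ j hjn]
      exact ⟨le_rfl, fun _ => by linarith⟩
    · rw [uu_top θ j hjn.ge]
      exact ⟨hθ.le, fun e => by linarith⟩
  · refine ⟨⟨0, hn⟩, Or.inr ?_⟩
    rintro _ ⟨j, hj, rfl⟩
    have hjn : j < n := lt_of_le_of_ne (hJ j hj) (fun e => hkJ (by rwa [h, ← e]))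
    by_cases e : j = 0
    · subst e
      rw [show uu n θ 0 ⟨0, hn⟩ = -θ from uu_self θ ⟨0, hn⟩]
      exact ⟨by linarith, fun e => by linarith⟩
    · rw [uu_ne θ j hjn _ (by simpa using e), uu_sum θ j hjn]
      exact ⟨by simp, fun _ => by linarith⟩

/-- strict half space -/
def SH (C : Set (V n)) : Prop := ∃ i, (∀ v ∈ C, 0 < v i) ∨ (∀ v ∈ C, v i < 0)

theorem SH_Half {θ : ℝ} (hθ : 0 < θ) {C : Set (V n)} (h : SH C) :
    Half (C ∪ uu n θ '' (lab '' C)) := by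
  obtain ⟨i, h | h⟩ := h
  · refine ⟨i, Or.inl ?_⟩
    rintro v (hv | ⟨_, ⟨v, hv, rfl⟩, rfl⟩)
    · exact ⟨(h v hv).le, fun e => absurd e (h v hv).ne'⟩
    · rcases (lab_le v).lt_or_eq with hl | hl
      · have h2 := lab_lt hl
        have hne : lab v ≠ i := by
          intro e
          have : (⟨lab v, hl⟩ : Fin n) = i := Fin.ext e
          rw [this] at h2
          exact lt_asymm h2 (h v hv)
        rw [uu_ne θ _ hl _ hne, uu_sum θ _ hl]
        exact ⟨le_rfl, fun _ => by linarith⟩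
      · rw [uu_top θ _ hl.ge]; exact ⟨hθ.le, fun e => by linarith⟩
  · refine ⟨i, Or.inr ?_⟩
    rintro v (hv | ⟨_, ⟨v, hv, rfl⟩, rfl⟩)
    · exact ⟨by linarith [h v hv], fun e => by linarith [h v hv]⟩
    · rcases (lab_le v).lt_or_eq with hl | hl
      · rw [uu_sum θ _ hl]
        by_cases e : lab v = i
        · rw [e, uu_self]; exact ⟨by linarith, fun e => by linarith⟩
        · rw [uu_ne θ _ hl _ e]; exact ⟨by simp, fun _ => by linarith⟩
      · exact absurd (lab_ge hl.ge i) (not_le.2 (h v hv))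

theorem SH_nhds {v : V n} (hv : v ≠ 0) : {u : V n | ∃ i, (0 < v i ∧ 0 < u i) ∨ (v i < 0 ∧ u i < 0)} ∈ 𝓝 v := by
  obtain ⟨i, hi⟩ : ∃ i, v i ≠ 0 := by
    by_contra hcon
    push Not at hcon
    exact hv (by ext i; simpa using hcon i)
  have hc : Continuous (fun y : V n => y i) := (EuclideanSpace.proj (𝕜 := ℝ) i).continuous
  rcases lt_or_gt_of_ne hi with h | h
  · filter_upwards [hc.continuousAt.eventually (gt_mem_nhds h)] with u hu
    exact ⟨i, Or.inr ⟨h, hu⟩⟩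
  · filter_upwards [hc.continuousAt.eventually (lt_mem_nhds h)] with u hu
    exact ⟨i, Or.inl ⟨h, hu⟩⟩

theorem SH_ball {v : V n} (hv : v ≠ 0) : ∃ U ∈ 𝓝 v, SH U := by
  obtain ⟨i, hi⟩ : ∃ i, v i ≠ 0 := by
    by_contra hcon
    push Not at hcon
    exact hv (by ext i; simpa using hcon i)
  have hc : Continuous (fun y : V n => y i) := (EuclideanSpace.proj (𝕜 := ℝ) i).continuous
  rcases lt_or_gt_of_ne hi with h | h
  · exact ⟨_, hc.continuousAt.eventually (gt_mem_nhds h), i, Or.inr (fun v hv => hv)⟩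
  · exact ⟨_, hc.continuousAt.eventually (lt_mem_nhds h), i, Or.inl (fun v hv => hv)⟩

theorem SH_mono {A B : Set (V n)} (h : A ⊆ B) : SH B → SH A := by
  rintro ⟨i, h1 | h1⟩
  · exact ⟨i, Or.inl fun v hv => h1 v (h hv)⟩
  · exact ⟨i, Or.inr fun v hv => h1 v (h hv)⟩

theorem SH_NF {C : Set (V n)} (h : SH C) : NF C := by
  obtain ⟨i, h | h⟩ := h
  · rintro ⟨h1, _⟩
    obtain ⟨v, hv, hlt⟩ := h1 i
    exact lt_asymm hlt (h v hv)
  · rintro ⟨_, v, hv, h2⟩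
    exact absurd (h2 i) (not_le.2 (h v hv))

noncomputable def us (n : ℕ) (θ : ℝ) : List (V n) := (List.range (n + 1)).map (uu n θ)

theorem uu_norm : ∃ K : ℝ, 0 < K ∧ ∀ θ, 0 < θ → ∀ j ≤ n, ‖uu n θ j‖ ≤ K * θ := by
  refine ⟨1 + ∑ j ∈ Finset.range (n + 1), ‖uu n 1 j‖, by positivity, ?_⟩
  intro θ hθ j hj
  have e : uu n θ j = θ • uu n 1 j := by
    ext i
    simp only [uu, PiLp.smul_apply, smul_eq_mul]
    split_ifs <;> simp
  rw [e, norm_smul, Real.norm_of_nonneg hθ.le, mul_comm]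
  have := Finset.single_le_sum (f := fun j => ‖uu n 1 j‖) (fun i _ => norm_nonneg _) (Finset.mem_range.2 (Nat.lt_succ_of_le hj))
  gcongr
  linarith

theorem exists_theta (ρ : ℝ) (hρ : 0 < ρ) : ∃ θ > 0, ∀ j ≤ n, uu n θ j ∈ Metric.ball (0 : V n) ρ := by
  obtain ⟨K, hK, h⟩ := uu_norm (n := n)
  refine ⟨ρ / (2 * K), by positivity, fun j hj => ?_⟩
  have := h (ρ / (2 * K)) (by positivity) j hj
  rw [mem_ball_zero_iff]
  refine this.trans_lt ?_
  have : K * (ρ / (2 * K)) = ρ / 2 := by field_simp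
  rw [this]; linarith

theorem perm_range (t : List ℕ) (hlen : t.length = n + 1) (h : ∀ k ≤ n, k ∈ t) : (List.range (n + 1)).Perm t := by
  rw [← Multiset.coe_eq_coe]
  apply Multiset.eq_of_le_of_card_le
  · rw [Multiset.le_iff_subset (by simpa using List.nodup_range)]
    intro k hk
    simp at hk
    exact h k (by omega)
  · simp [hlen]

/-- degree on combinatorial simplices -/
theorem deg_comb (hn : 1 ≤ n) {θ ρ : ℝ} (hθ : 0 < θ) (hu : ∀ j ≤ n, uu n θ j ∈ Metric.ball (0 : V n) ρ)
    (h : V n → V n) (hc : ContinuousOn h (Metric.ball 0 ρ)) (h0 : ∀ v ∈ Metric.ball (0 : V n) ρ, v ≠ 0 → h v ≠ 0)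
    (dh : ZMod 2) (hd : HasDeg h (bdL (us n θ)) dh) (t : List ℕ) (hlen : t.length = n + 1) (ht : ∀ k ∈ t, k ≤ n) :
    HasDeg h (bdL (t.map (uu n θ))) (dh * lin (chi (Multiset.range n)) (bdL t)) := by
  rw [chi_bd _ _ (Multiset.nodup_range n)]
  by_cases hfull : ∀ k ≤ n, k ∈ t
  · have hp := perm_range t hlen hfull
    rw [if_pos, mul_one]
    · exact hasDeg_perm (hp.map _) _ hd
    · refine ⟨n, by simp, ?_⟩
      rw [← Multiset.range_succ, ← Multiset.coe_range, Multiset.coe_eq_coe]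
      exact hp.symm
  · push Not at hfull
    obtain ⟨k, hk, hkt⟩ := hfull
    rw [if_neg, mul_zero]
    · rw [← bd_one]
      apply hasDeg_bd
      apply one_mem
      have hH : Half (hull (t.map (uu n θ))) := by
        apply Half_hull
        have := Half_uu hn hθ {j | j ∈ t} ht k hk hkt
        convert this using 1
        ext x; simp
      have hb : hull (t.map (uu n θ)) ⊆ Metric.ball 0 ρ := by
        refine hull_sub (convex_ball _ _) ?_
        intro x hx
        obtain ⟨j, hj, rfl⟩ := List.mem_map.1 hx
        exact hu j (ht j hj)
      refine ⟨hc.mono hb, fun x hx => h0 x (hb hx) ?_⟩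
      rintro rfl
      exact Half_zero hH hx
    · rintro ⟨b, hb, he⟩
      apply hkt
      have hm : ∀ a, a ∈ t ↔ a = b ∨ a < n := by
        intro a
        rw [← Multiset.mem_coe, he]; simp
      have : b ≤ n := ht b ((hm b).2 (Or.inl rfl))
      have hbn : b = n := by simp at hb; omega
      rw [hm]; omega

theorem hasDeg_id (hn : 1 ≤ n) {θ : ℝ} (hθ : 0 < θ) : HasDeg (fun v : V n => v) (bdL (us n θ)) 1 := by
  have h1 : ev (fun v : V n => v) (bdL (us n θ)) = 1 := by
    rw [ev_eq, ← bd_one, ← bd_push, push_one, bd_one, chi_bd _ _ (Multiset.nodup_range n), if_pos]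
    refine ⟨n, by simp, ?_⟩
    rw [← Multiset.range_succ, ← Multiset.coe_range, us, List.map_map]
    congr 1
    conv_rhs => rw [← List.map_id (List.range (n + 1))]
    apply List.map_congr_left
    intro j hj
    have : j < n + 1 := List.mem_range.1 hj
    exact lab_uu hθ j (by omega)
  rw [← h1]
  apply hasDeg_NF
  · rw [← bd_one, bd_bd]
  · rw [us, ← bd_one, ← push_one, bd_push, bd_one]
    refine map_mem _ _ ?_ (bdL_mem _)
    intro m hm
    rw [push_one]
    apply one_mem
    rw [Set.image_id']
    apply Half_NF
    apply Half_hull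
    obtain ⟨k, hk, hkm⟩ : ∃ k ≤ n, k ∉ m := by
      by_contra hcon
      push Not at hcon
      have : List.range (n + 1) ⊆ m := by
        intro k hk; rw [List.mem_range] at hk; exact hcon k (by omega)
      have := (List.nodup_range (n := n + 1)).subperm this
      have := this.length_le
      have h3 := hm.1
      omega
    have := Half_uu hn hθ {j | j ∈ m} (fun j hj => by have := hm.2 j hj; rw [List.mem_range] at this; omega) k hk hkm
    convert this using 1
    ext x; simp

end simplex
end AC

namespace AC
open Filter Topology

section comp
variable {n : ℕ} {E : Type*} [NormedAddCommGroup E] [NormedSpace ℝ E]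

/-- multiplicativity of the degree for fine cycles in punctured space -/
theorem lemF (hn : 1 ≤ n) {θ ρ : ℝ} (hθ : 0 < θ) (hu : ∀ j ≤ n, uu n θ j ∈ Metric.ball (0 : V n) ρ)
    (h : V n → V n) (hc : ContinuousOn h (Metric.ball 0 ρ)) (h0 : ∀ v ∈ Metric.ball (0 : V n) ρ, v ≠ 0 → h v ≠ 0)
    (dh : ZMod 2) (hd : HasDeg h (bdL (us n θ)) dh) (ζ : Ch (V n)) (hζ : bd ζ = 0)
    (hs : ζ ∈ Sup (fun L => L.length = n ∧ SH {x | x ∈ L} ∧ (∀ x ∈ L, x ∈ Metric.ball (0 : V n) ρ) ∧ NF (h '' hull L))) :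
    ev h ζ = dh * ev (fun v => v) ζ := by
  have h1 : HasDeg h ζ (ev h ζ) := hasDeg_NF hζ (Sup_mono (fun l hl => hl.2.2.2) hs)
  have h2 := bd_pr (fun v : V n => v) (fun v => uu n θ (lab v)) ζ
  rw [hζ, map_zero, add_zero] at h2
  have h3 : HasDeg h (bd (pr (fun v : V n => v) (fun v => uu n θ (lab v)) ζ)) 0 := by
    apply hasDeg_bd
    refine map_mem _ _ ?_ hs
    rintro l ⟨-, hl1, hl2, -⟩
    rw [pr_one]
    refine Sup_mono ?_ (prL_mem _ _ l)
    rintro m ⟨-, hm⟩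
    have hb : hull m ⊆ Metric.ball 0 ρ := by
      refine hull_sub (convex_ball _ _) ?_
      intro y hy
      obtain ⟨x, hx, rfl | rfl⟩ := hm y hy
      · exact hl2 _ hx
      · exact hu _ (lab_le _)
    have hH : Half (hull m) := by
      apply Half_hull
      have : {x | x ∈ m} ⊆ {x | x ∈ l} ∪ uu n θ '' (lab '' {x | x ∈ l}) := by
        intro y hy
        obtain ⟨x, hx, rfl | rfl⟩ := hm y hy
        · exact Or.inl hx
        · exact Or.inr ⟨_, ⟨x, hx, rfl⟩, rfl⟩
      obtain ⟨i, h | h⟩ := SH_Half hθ hl1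
      · exact ⟨i, Or.inl fun v hv => h v (this hv)⟩
      · exact ⟨i, Or.inr fun v hv => h v (this hv)⟩
    refine ⟨hc.mono hb, fun x hx => h0 x (hb hx) ?_⟩
    rintro rfl
    exact Half_zero hH hx
  set ξ : Ch ℕ := push lab ζ with hξ
  have hbξ : bd ξ = 0 := by rw [hξ, bd_push, hζ, map_zero]
  have hξs : ξ ∈ Sup (fun t : List ℕ => t.length = n ∧ ∀ k ∈ t, k ≤ n) := by
    refine map_mem _ _ ?_ hs
    intro l hl
    rw [push_one]
    refine one_mem ⟨by simp [hl.1], ?_⟩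
    intro k hk
    obtain ⟨v, _, rfl⟩ := List.mem_map.1 hk
    exact lab_le v
  have hcone : ξ = bd (cone 0 ξ) := by rw [bd_cone, hbξ, map_zero, add_zero]
  have h4 : HasDeg h (push (uu n θ) ξ) (dh * lin (chi (Multiset.range n)) ξ) := by
    have hcs : cone 0 ξ ∈ Sup (fun t : List ℕ => t.length = n + 1 ∧ ∀ k ∈ t, k ≤ n) := by
      refine map_mem _ _ ?_ hξs
      intro t ht
      rw [cone_one]
      refine one_mem ⟨by simp [ht.1], ?_⟩
      intro k hk
      rcases List.mem_cons.1 hk with rfl | hk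
      · omega
      · exact ht.2 k hk
    have key : ∀ᶠ M in atTop, ∀ t ∈ (cone 0 ξ).support,
        ev h (sd^[M] (bdL (t.map (uu n θ)))) = dh * lin (chi (Multiset.range n)) (bdL t) := by
      rw [Filter.eventually_all_finset]
      intro t ht
      have := mem_Sup_iff.1 hcs t ht
      exact deg_comb hn hθ hu h hc h0 dh hd t this.1 this.2
    filter_upwards [key] with M hM
    have e : (ev h ∘ₗ (sd ^ M) ∘ₗ push (uu n θ) ∘ₗ bd) (cone 0 ξ) =
        (dh • (lin (chi (Multiset.range n)) ∘ₗ bd)) (cone 0 ξ) := by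
      apply map_eq _ _ _ (self_mem _)
      intro t ht
      have := hM t ht
      simp only [LinearMap.comp_apply, LinearMap.smul_apply, bd_one, ← iter_eq, smul_eq_mul]
      rw [← this, ← bd_one, ← bd_push, push_one, bd_one]
    simp only [LinearMap.comp_apply, LinearMap.smul_apply, ← iter_eq, smul_eq_mul, ← hcone] at e
    exact e
  have h5 : push (fun v => uu n θ (lab v)) ζ = push (uu n θ) ξ := by rw [hξ, push_push]; rfl
  have h6 : push (fun v : V n => v) ζ = ζ := by
    have : push (fun v : V n => v) = (LinearMap.id : Ch (V n) →ₗ[ZMod 2] Ch (V n)) := lin_ext (by intro l; simp)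
    rw [this]; rfl
  rw [h2, h5, h6] at h3
  have h7 := h3.unique (h1.add h4)
  have h8 := z2 h7.symm
  rw [h8, ev_eq]

/-- multiplicativity of the degree -/
theorem deg_comp (hn : 1 ≤ n) {θ ρ : ℝ} (hθ : 0 < θ) (hu : ∀ j ≤ n, uu n θ j ∈ Metric.ball (0 : V n) ρ)
    (h : V n → V n) (hc : ContinuousOn h (Metric.ball 0 ρ)) (h0 : ∀ v ∈ Metric.ball (0 : V n) ρ, v ≠ 0 → h v ≠ 0)
    (dh : ZMod 2) (hd : HasDeg h (bdL (us n θ)) dh) (z : Ch E) (hz : bd z = 0) (w : E → V n)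
    (hs : z ∈ Sup (fun L => L.length = n ∧ Good w L ∧ ∀ x ∈ hull L, w x ∈ Metric.ball (0 : V n) ρ)) (d : ZMod 2)
    (hw : HasDeg w z d) : HasDeg (fun x => h (w x)) z (dh * d) := by
  let P : Set E → Prop := fun A => ∃ C, Convex ℝ C ∧ w '' A ⊆ C ∧ SH C ∧ C ⊆ Metric.ball 0 ρ ∧ NF (h '' C)
  have hP : ∀ A B, A ⊆ B → P B → P A := by
    rintro A B hAB ⟨C, h1, h2, h3⟩
    exact ⟨C, h1, (Set.image_mono hAB).trans h2, h3⟩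
  have hP0 : P ∅ := ⟨∅, convex_empty, by simp, ⟨⟨0, hn⟩, by simp⟩, by simp, by simpa using NF_empty⟩
  have hs' := mem_Sup_iff.1 hs
  have key := leb P hP hP0 z (by
    intro L hL x hx
    obtain ⟨-, ⟨hg1, hg2⟩, hg3⟩ := hs' L hL
    have hb : Metric.ball 0 ρ ∈ 𝓝 (w x) := Metric.isOpen_ball.mem_nhds (hg3 x hx)
    obtain ⟨U, hU, hSH⟩ := SH_ball (hg2 x hx)
    obtain ⟨N, hN, hNF⟩ := NF_nhds hc (hg3 x hx) (h0 _ (hg3 x hx) (hg2 x hx))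
    rw [Metric.isOpen_ball.nhdsWithin_eq (hg3 x hx)] at hN
    obtain ⟨ε, hε, hε2⟩ := Metric.mem_nhds_iff.1 (inter_mem (inter_mem hb hU) hN)
    refine ⟨w ⁻¹' (Metric.ball (w x) ε), (hg1 x hx).preimage_mem_nhdsWithin (Metric.ball_mem_nhds _ hε), Metric.ball (w x) ε,
      convex_ball _ _, Set.image_preimage_subset _ _, SH_mono (fun v hv => (hε2 hv).1.2) hSH, fun v hv => (hε2 hv).1.1,
      NF_mono (Set.image_mono fun v hv => (hε2 hv).2) hNF⟩)
  filter_upwards [key, hw] with M hM hM2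
  have h1 := lemF hn hθ hu h hc h0 dh hd (push w (sd^[M] z)) (by rw [bd_push, bd_iter, hz, iter_zero, map_zero]) (by
    refine map_mem _ _ ?_ hM
    rintro l ⟨L, hL, hl1, -, C, hC1, hC2, hC3, hC4, hC5⟩
    rw [push_one]
    have hsub : ∀ v ∈ l.map w, v ∈ C := by
      intro v hv
      obtain ⟨x, hx, rfl⟩ := List.mem_map.1 hv
      exact hC2 ⟨x, mem_hull hx, rfl⟩
    refine one_mem ⟨by simp [hl1, (hs' L hL).1], SH_mono hsub hC3, fun v hv => hC4 (hsub v hv), ?_⟩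
    exact NF_mono (Set.image_mono (hull_sub hC1 hsub)) hC5)
  rw [ev_push, ev_push, hM2] at h1
  exact h1

theorem good_us (hn : 1 ≤ n) {θ ρ : ℝ} (hθ : 0 < θ) (hu : ∀ j ≤ n, uu n θ j ∈ Metric.ball (0 : V n) ρ) :
    bdL (us n θ) ∈ Sup (fun L => L.length = n ∧ hull L ⊆ Metric.ball (0 : V n) ρ ∧ (0 : V n) ∉ hull L) := by
  rw [us, ← bd_one, ← push_one, bd_push, bd_one]
  refine map_mem _ _ ?_ (bdL_mem _)
  intro m hm
  rw [push_one]
  have hle : ∀ j ∈ m, j ≤ n := fun j hj => by have := hm.2 j hj; rw [List.mem_range] at this; omega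
  refine one_mem ⟨by simpa using hm.1, hull_sub (convex_ball _ _) ?_, ?_⟩
  · intro x hx
    obtain ⟨j, hj, rfl⟩ := List.mem_map.1 hx
    exact hu j (hle j hj)
  apply Half_zero
  apply Half_hull
  obtain ⟨k, hk, hkm⟩ : ∃ k ≤ n, k ∉ m := by
    by_contra hcon
    push Not at hcon
    have : List.range (n + 1) ⊆ m := by
      intro k hk; rw [List.mem_range] at hk; exact hcon k (by omega)
    have := (List.nodup_range (n := n + 1)).subperm this
    have := this.length_le
    have h3 := hm.1
    omega
  have := Half_uu hn hθ {j | j ∈ m} hle k hk hkm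
  convert this using 1
  ext x; simp

/-- local homeomorphisms preserve the mod 2 degree -/
theorem deg_homeo (hn : 1 ≤ n) {ρ ρ' : ℝ} (hρ : 0 < ρ) (hρ' : 0 < ρ') (h g : V n → V n)
    (hc : ContinuousOn h (Metric.ball 0 ρ)) (h0 : ∀ v ∈ Metric.ball (0 : V n) ρ, v ≠ 0 → h v ≠ 0) (h00 : h 0 = 0)
    (gc : ContinuousOn g (Metric.ball 0 ρ')) (g0 : g 0 = 0) (hg : ∀ v ∈ Metric.ball (0 : V n) ρ', h (g v) = v)
    (z : Ch E) (hz : bd z = 0) (w : E → V n)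
    (hs : z ∈ Sup (fun L => L.length = n ∧ Good w L ∧ ∀ x ∈ hull L, w x ∈ Metric.ball (0 : V n) ρ)) (d : ZMod 2)
    (hw : HasDeg w z d) : HasDeg (fun x => h (w x)) z d := by
  obtain ⟨θ, hθ, hu⟩ := exists_theta (n := n) ρ hρ
  obtain ⟨dh, hd⟩ : ∃ dh, HasDeg h (bdL (us n θ)) dh := by
    apply hasDeg_exists
    · rw [← bd_one, bd_bd]
    · refine Sup_mono ?_ (good_us hn hθ hu)
      rintro L ⟨_, h1, h2⟩
      refine ⟨hc.mono h1, fun x hx => h0 x (h1 hx) ?_⟩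
      rintro rfl; exact h2 hx
  have hdh : dh = 1 := by
    have hgc : ContinuousAt g 0 := gc.continuousAt (Metric.ball_mem_nhds _ hρ')
    have hm : g ⁻¹' Metric.ball 0 ρ ∈ 𝓝 (0 : V n) := hgc.preimage_mem_nhds (by rw [g0]; exact Metric.ball_mem_nhds _ hρ)
    obtain ⟨ε, hε, hε2⟩ := Metric.mem_nhds_iff.1 (inter_mem hm (Metric.ball_mem_nhds _ hρ'))
    obtain ⟨θ', hθ', hu'⟩ := exists_theta (n := n) ε hε
    have hgood : bdL (us n θ') ∈ Sup (fun L => L.length = n ∧ Good g L ∧ ∀ x ∈ hull L, g x ∈ Metric.ball (0 : V n) ρ) := by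
      refine Sup_mono ?_ (good_us hn hθ' hu')
      rintro L ⟨hl, h1, h2⟩
      refine ⟨hl, ⟨gc.mono (fun x hx => (hε2 (h1 hx)).2), fun x hx e => ?_⟩, fun x hx => (hε2 (h1 hx)).1⟩
      have := hg x (hε2 (h1 hx)).2
      rw [e, h00] at this
      rw [← this] at hx
      exact h2 hx
    have hbz : bd (bdL (us n θ')) = 0 := by rw [← bd_one, bd_bd]
    obtain ⟨dg, hdg⟩ := hasDeg_exists hbz (Sup_mono (fun l hl => hl.2.1) hgood)
    have h1 := deg_comp hn hθ hu h hc h0 dh hd _ hbz g hgood dg hdg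
    have h2 : HasDeg (fun v : V n => v) (bdL (us n θ')) (dh * dg) := by
      refine h1.congr ?_
      refine Sup_mono ?_ (good_us hn hθ' hu')
      rintro L ⟨hl, h1, h2⟩ x hx
      exact hg x (hε2 (h1 hx)).2
    have h3 := h2.unique (hasDeg_id hn hθ')
    revert h3
    generalize dh = a
    generalize dg = b
    revert a b
    decide
  have := deg_comp hn hθ hu h hc h0 dh hd z hz w hs d hw
  rwa [hdh, one_mul] at this

end comp
end AC

namespace AC
open Filter Topology

section chart
variable {n : ℕ} {E : Type*} [NormedAddCommGroup E] [NormedSpace ℝ E]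

/-- chart independence of the degree of a difference -/
theorem deg_chart (hn : 1 ≤ n) (e : OpenPartialHomeomorph (V n) (V n)) (c : V n) (r : ℝ) (hr : 0 < r)
    (hb : Metric.ball c (2 * r) ⊆ e.source) (z : Ch E) (hz : bd z = 0) (a1 a2 : E → V n)
    (hs : z ∈ Sup (fun L => L.length = n ∧ ContinuousOn a1 (hull L) ∧ ContinuousOn a2 (hull L) ∧
      (∀ x ∈ hull L, a1 x ∈ Metric.ball c r ∧ a2 x ∈ Metric.ball c r ∧ a1 x ≠ a2 x))) (d : ZMod 2)
    (hd : HasDeg (fun x => a1 x - a2 x) z d) : HasDeg (fun x => e (a1 x) - e (a2 x)) z d := by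
  have hcs : c ∈ e.source := hb (Metric.mem_ball_self (by linarith))
  have hec : e c ∈ e.target := e.map_source hcs
  obtain ⟨ρ', hρ', hρ2⟩ := Metric.mem_nhds_iff.1 (e.open_target.mem_nhds hec)
  have hsrc : ∀ v ∈ Metric.ball (0 : V n) (2 * r), c + v ∈ e.source := by
    intro v hv; apply hb; simpa [dist_eq_norm] using hv
  have htgt : ∀ v ∈ Metric.ball (0 : V n) ρ', v + e c ∈ e.target := by
    intro v hv; apply hρ2; simpa [dist_eq_norm] using hv
  have h1 : HasDeg (fun x => e (c + (a1 x - a2 x)) - e c) z d := by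
    refine deg_homeo hn (ρ := 2 * r) (ρ' := ρ') (by linarith) hρ' (fun v => e (c + v) - e c) (fun v => e.symm (v + e c) - c)
      ?_ ?_ (by simp) ?_ ?_ ?_ z hz (fun x => a1 x - a2 x) ?_ d hd
    · exact (e.continuousOn.comp (by fun_prop) hsrc).sub continuousOn_const
    · intro v hv hv0 h
      have := e.injOn (hsrc v hv) hcs (sub_eq_zero.1 h)
      exact hv0 (by simpa using this)
    · exact (e.continuousOn_symm.comp (by fun_prop) htgt).sub continuousOn_const
    · simp [e.left_inv hcs]
    · intro v hv
      simp [e.right_inv (htgt v hv)]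
    · refine Sup_mono ?_ hs
      rintro L ⟨hl, c1, c2, h⟩
      refine ⟨hl, ⟨c1.sub c2, fun x hx => sub_ne_zero.2 (h x hx).2.2⟩, fun x hx => ?_⟩
      have b1 := (h x hx).1
      have b2 := (h x hx).2.1
      rw [mem_ball_zero_iff, ← dist_eq_norm]
      rw [Metric.mem_ball] at b1 b2
      have := dist_triangle_right (a1 x) (a2 x) c
      linarith
  let H : E × ℝ → V n := fun p =>
    e (a1 p.1 - (1 - p.2) • (a2 p.1 - c)) - e (a2 p.1 - (1 - p.2) • (a2 p.1 - c))
  have h2 := HasDeg.homotopy H hz (d := d) (by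
    refine Sup_mono ?_ hs
    rintro L ⟨hl, c1, c2, h⟩
    have m1 : ∀ p ∈ hull L ×ˢ Set.Icc (0:ℝ) 1, a1 p.1 - (1 - p.2) • (a2 p.1 - c) ∈ e.source := by
      rintro ⟨x, t⟩ ⟨hx, ht0, ht1⟩
      apply hb
      obtain ⟨b1, b2, -⟩ := h x hx
      rw [Metric.mem_ball, dist_eq_norm] at b1 b2 ⊢
      have e1 : a1 x - (1 - t) • (a2 x - c) - c = (a1 x - c) - (1 - t) • (a2 x - c) := by abel
      simp only at *
      rw [e1]
      refine (norm_sub_le _ _).trans_lt ?_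
      rw [norm_smul, Real.norm_of_nonneg (by linarith)]
      nlinarith [norm_nonneg (a2 x - c)]
    have m2 : ∀ p ∈ hull L ×ˢ Set.Icc (0:ℝ) 1, a2 p.1 - (1 - p.2) • (a2 p.1 - c) ∈ e.source := by
      rintro ⟨x, t⟩ ⟨hx, ht0, ht1⟩
      apply hb
      obtain ⟨b1, b2, -⟩ := h x hx
      rw [Metric.mem_ball, dist_eq_norm] at b1 b2 ⊢
      have e1 : a2 x - (1 - t) • (a2 x - c) - c = t • (a2 x - c) := by module
      simp only at *
      rw [e1]
      rw [norm_smul, Real.norm_of_nonneg (by linarith)]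
      nlinarith [norm_nonneg (a2 x - c)]
    have k1 : ContinuousOn (fun p : E × ℝ => a1 p.1) (hull L ×ˢ Set.Icc (0:ℝ) 1) :=
      c1.comp continuousOn_fst (fun p hp => hp.1)
    have k2 : ContinuousOn (fun p : E × ℝ => a2 p.1) (hull L ×ˢ Set.Icc (0:ℝ) 1) :=
      c2.comp continuousOn_fst (fun p hp => hp.1)
    have k3 : ContinuousOn (fun p : E × ℝ => (1 - p.2) • (a2 p.1 - c)) (hull L ×ˢ Set.Icc (0:ℝ) 1) :=
      (continuousOn_const.sub continuousOn_snd).smul (k2.sub continuousOn_const)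
    refine ⟨(e.continuousOn.comp (k1.sub k3) m1).sub (e.continuousOn.comp (k2.sub k3) m2), ?_⟩
    intro p hp h3
    have := e.injOn (m1 p hp) (m2 p hp) (sub_eq_zero.1 h3)
    exact (h p.1 hp.1).2.2 (by simpa using this)) (by
    refine h1.congr ?_
    refine Sup_mono ?_ hs
    rintro L - x hx
    simp only [H, sub_zero, one_smul, sub_sub_cancel]
    congr 2
    abel)
  simpa [H] using h2

end chart
end AC

namespace AC
open Filter Topology

section perturb
variable {n : ℕ} {X Y : Type*} [TopologicalSpace X] [CompactSpace X] [T2Space X] [TopologicalSpace Y]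

/-- open conditions on a map and its composition with `ι` -/
theorem ev_open (ι : C(X, X)) (a : C(X, Y)) (Ω : Set (Y × Y)) (hΩ : IsOpen Ω) (K : Set X) (hK : IsCompact K)
    (h : ∀ x ∈ K, (a x, a (ι x)) ∈ Ω) : ∀ᶠ a' : C(X, Y) in 𝓝 a, ∀ x ∈ K, (a' x, a' (ι x)) ∈ Ω := by
  apply hK.eventually_forall_of_forall_eventually
  intro x hx
  have hc : Continuous (fun p : C(X, Y) × X => (p.1 p.2, p.1 (ι p.2))) := by
    refine Continuous.prodMk ?_ ?_
    · exact continuous_eval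
    · exact continuous_eval.comp (continuous_fst.prodMk (ι.continuous.comp continuous_snd))
  exact hc.continuousAt.eventually (hΩ.mem_nhds (h x hx))

def Thin (n : ℕ) (T : Set X) : Prop := ∀ (w : C(X, V n)) (ε : ℝ), 0 < ε → ∃ g : C(X, V n), (∀ x, ‖g x - w x‖ < ε) ∧ ∀ x ∈ T, g x ≠ 0

theorem tietzeV {X : Type*} [TopologicalSpace X] [NormalSpace X] {s : Set X} (hs : IsClosed s) (f : C(s, V n)) :
    ∃ g : C(X, V n), ∀ x : s, g x = f x := by
  have : ∀ i : Fin n, ∃ g : C(X, ℝ), ∀ x : s, g x = f x i := by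
    intro i
    obtain ⟨g, hg⟩ := ContinuousMap.exists_restrict_eq hs
      (⟨fun x => f x i, (EuclideanSpace.proj (𝕜 := ℝ) i).continuous.comp f.continuous⟩ : C(s, ℝ))
    exact ⟨g, fun x => congrArg (fun q => q x) hg⟩
  choose g hg using this
  refine ⟨⟨fun x => WithLp.toLp 2 (fun i => g i x), ?_⟩, ?_⟩
  · exact (PiLp.continuous_toLp 2 _).comp (continuous_pi fun i => (g i).continuous)
  · intro x; ext i; exact hg i x

theorem perturb (ι : C(X, X)) (a : C(X, Y)) (e : OpenPartialHomeomorph Y (V n)) (T : Set X) (hT : IsClosed T)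
    (h1 : ∀ x ∈ T, a x ∈ e.source) (h2 : ∀ x ∈ T, a (ι x) ∈ e.source) (h3 : ∀ x ∈ T, ι x ∉ T) (hthin : Thin n T)
    (O : Set C(X, Y)) (hO : O ∈ 𝓝 a) : ∃ a' ∈ O, ∀ x ∈ T, a' x ≠ a' (ι x) := by
  have hTc : IsCompact T := hT.isCompact
  let O1 : Set X := a ⁻¹' e.source ∩ (ι '' T)ᶜ
  have hO1 : IsOpen O1 := (e.open_source.preimage a.continuous).inter (hTc.image ι.continuous).isClosed.isOpen_compl
  have hTO : T ⊆ O1 := by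
    intro x hx
    refine ⟨h1 x hx, ?_⟩
    rintro ⟨y, hy, rfl⟩
    exact h3 y hy hx
  obtain ⟨β, hβ1, hβ2, hβ3⟩ := exists_tsupport_one_of_isOpen_isClosed hO1 (isClosed_closure.isCompact) hT hTO
  have hKc : IsCompact ((fun x => e (a x)) '' tsupport β) := by
    refine (isClosed_tsupport β).isCompact.image_of_continuousOn ?_
    exact e.continuousOn.comp a.continuous.continuousOn (fun x hx => (hβ1 hx).1)
  obtain ⟨δ, hδ, hδ2⟩ := hKc.exists_thickening_subset_open e.open_target (by
    rintro _ ⟨x, hx, rfl⟩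
    exact e.map_source (hβ1 hx).1)
  let Z := Metric.ball (0 : C(X, V n)) δ
  have htar : ∀ (u : Z) (x : X), x ∈ O1 → e (a x) + β x • u.1 x ∈ e.target := by
    intro u x hx
    by_cases hxs : x ∈ tsupport β
    · apply hδ2
      rw [Metric.mem_thickening_iff]
      refine ⟨_, ⟨x, hxs, rfl⟩, ?_⟩
      rw [dist_eq_norm, add_sub_cancel_left, norm_smul, Real.norm_of_nonneg (hβ3 x).1]
      have b1 : ‖u.1 x‖ < δ := (u.1.norm_coe_le_norm x).trans_lt (mem_ball_zero_iff.1 u.2)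
      nlinarith [(hβ3 x).1, (hβ3 x).2, norm_nonneg (u.1 x)]
    · rw [image_eq_zero_of_notMem_tsupport hxs, zero_smul, add_zero]
      exact e.map_source hx.1
  classical
  let F : Z × X → Y := fun p => if p.2 ∈ O1 then e.symm (e (a p.2) + β p.2 • p.1.1 p.2) else a p.2
  have hF0 : ∀ p : Z × X, p.2 ∉ tsupport β → F p = a p.2 := by
    intro p hp
    by_cases hx : p.2 ∈ O1
    · simp only [F, if_pos hx, image_eq_zero_of_notMem_tsupport hp, zero_smul, add_zero]
      exact e.left_inv hx.1
    · simp only [F, if_neg hx]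
  have hF : Continuous F := by
    rw [continuous_iff_continuousAt]
    intro p
    by_cases hx : p.2 ∈ O1
    · have hop : IsOpen {q : Z × X | q.2 ∈ O1} := hO1.preimage continuous_snd
      have hev : Continuous (fun q : Z × X => q.1.1 q.2) :=
        continuous_eval.comp ((continuous_subtype_val.comp continuous_fst).prodMk continuous_snd)
      have hco : ContinuousOn (fun q : Z × X => e.symm (e (a q.2) + β q.2 • q.1.1 q.2)) {q : Z × X | q.2 ∈ O1} := by
        refine e.continuousOn_symm.comp (ContinuousOn.add ?_ ?_) (fun q hq => htar q.1 q.2 hq)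
        · exact e.continuousOn.comp (a.continuous.comp continuous_snd).continuousOn (fun q hq => hq.1)
        · exact ((β.continuous.comp continuous_snd).smul hev).continuousOn
      refine (hco.continuousAt (hop.mem_nhds hx)).congr ?_
      filter_upwards [hop.mem_nhds hx] with q hq
      simp only [F]
      rw [if_pos hq]
    · have hx' : p.2 ∉ tsupport β := fun h => hx (hβ1 h)
      have hop : IsOpen {q : Z × X | q.2 ∉ tsupport β} :=
        (isClosed_tsupport β).isOpen_compl.preimage continuous_snd
      refine (a.continuous.comp continuous_snd).continuousAt.congr ?_
      filter_upwards [hop.mem_nhds hx'] with q hq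
      exact (hF0 q hq).symm
  let Φ : C(Z, C(X, Y)) := ContinuousMap.curry ⟨F, hF⟩
  let z0 : Z := ⟨0, Metric.mem_ball_self hδ⟩
  have hΦ0 : Φ z0 = a := by
    ext x
    change F (z0, x) = a x
    by_cases hx : x ∈ O1
    · simp only [F, if_pos hx, z0, ContinuousMap.zero_apply, smul_zero, add_zero]
      exact e.left_inv hx.1
    · simp only [F, if_neg hx]
  have hnb : Φ ⁻¹' O ∈ 𝓝 z0 := Φ.continuous.continuousAt.preimage_mem_nhds (by rw [hΦ0]; exact hO)
  obtain ⟨ε, hε, hε2⟩ := Metric.mem_nhds_iff.1 hnb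
  obtain ⟨w, hw⟩ := tietzeV hT (⟨fun x : T => e (a x) - e (a (ι x)), by
    refine Continuous.sub ?_ ?_
    · exact e.continuousOn.comp_continuous (a.continuous.comp continuous_subtype_val) (fun x => h1 x x.2)
    · exact e.continuousOn.comp_continuous (a.continuous.comp (ι.continuous.comp continuous_subtype_val)) (fun x => h2 x x.2)⟩ : C(T, V n))
  obtain ⟨g, hg1, hg2⟩ := hthin w (min ε δ / 2) (by positivity)
  have hnorm : ‖g - w‖ ≤ min ε δ / 2 := by
    rw [ContinuousMap.norm_le _ (by positivity)]
    intro x; exact (hg1 x).le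
  have hm : 0 < min ε δ := by positivity
  let u : Z := ⟨g - w, by rw [mem_ball_zero_iff]; exact lt_of_le_of_lt hnorm (by linarith [min_le_right ε δ])⟩
  refine ⟨Φ u, hε2 ?_, ?_⟩
  · rw [Metric.mem_ball, Subtype.dist_eq]
    change dist (g - w) 0 < ε
    rw [dist_zero_right]; linarith [min_le_left ε δ]
  · intro x hx
    have hx1 : (Φ u) x = e.symm (e (a x) + β x • u.1 x) := by
      change F (u, x) = _
      simp only [F, if_pos (hTO hx)]
    have hx2 : (Φ u) (ι x) = a (ι x) := by
      change F (u, ι x) = _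
      simp only [F]
      rw [if_neg]
      intro h; exact h.2 ⟨x, hx, rfl⟩
    rw [hx1, hx2]
    intro he
    have h5 := congrArg e he
    rw [e.right_inv (htar u x (hTO hx))] at h5
    have hb : β x = 1 := hβ2 hx
    have hwx : w x = e (a x) - e (a (ι x)) := hw ⟨x, hx⟩
    rw [hb, one_smul] at h5
    change e (a x) + (g x - w x) = _ at h5
    rw [hwx] at h5
    apply hg2 x hx
    have : g x = (e (a x) + (g x - (e (a x) - e (a (ι x))))) - e (a (ι x)) := by abel
    rw [this, h5, sub_self]

/-- simplices of dimension less than `n` are thin -/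
theorem thin_hull {E : Type*} [NormedAddCommGroup E] [NormedSpace ℝ E] [FiniteDimensional ℝ E] (S : Set E)
    (hS : IsCompact S) (hn : 1 ≤ n) (τ : List E) (hτ : τ.length = n) :
    Thin n {x : S | x.1 ∈ hull τ} := by
  intro w ε hε
  obtain ⟨W, hW⟩ := tietzeV hS.isClosed w
  obtain ⟨P, hP1, hP2, -⟩ := W.continuous.exists_contDiff_approx 1 (continuous_const (y := ε / 2)) (fun _ => by positivity)
  cases τ with
  | nil => simp at hτ; omega
  | cons x0 l =>
    let A : (Fin l.length → ℝ) → E := fun t => x0 + ∑ i, t i • (l.get i - x0)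
    have hA : ContDiff ℝ 1 A := by
      refine contDiff_const.add (ContDiff.sum fun i _ => ?_)
      exact (contDiff_apply ℝ ℝ i).smul contDiff_const
    have hsub : hull (x0 :: l) ⊆ Set.range A := by
      have hconv : Convex ℝ (Set.range A) := by
        rintro _ ⟨s, rfl⟩ _ ⟨t, rfl⟩ p q hp hq hpq
        refine ⟨p • s + q • t, ?_⟩
        simp only [A, Pi.add_apply, Pi.smul_apply, add_smul, smul_add, Finset.sum_add_distrib, Finset.smul_sum, smul_smul, smul_eq_mul]
        have : x0 = p • x0 + q • x0 := by rw [← add_smul, hpq, one_smul]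
        nth_rewrite 1 [this]
        abel
      refine hull_sub hconv ?_
      intro x hx
      rcases List.mem_cons.1 hx with rfl | hx
      · exact ⟨0, by simp [A]⟩
      · obtain ⟨i, hi⟩ := List.get_of_mem hx
        refine ⟨Pi.single i 1, ?_⟩
        simp only [A]
        rw [Finset.sum_eq_single i]
        · rw [Pi.single_eq_same, one_smul, hi]; abel
        · intro j _ hj; rw [Pi.single_eq_of_ne hj, zero_smul]
        · simp
    have hd := (hP1.comp hA).dense_compl_range_of_finrank_lt_finrank (by simp at hτ ⊢; omega)
    obtain ⟨v, hv1, hv2⟩ := hd.exists_dist_lt 0 (half_pos hε)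
    refine ⟨⟨fun x => P x.1 - v, (hP1.continuous.comp continuous_subtype_val).sub continuous_const⟩, ?_, ?_⟩
    · intro x
      have a1 := hP2 x.1
      rw [dist_eq_norm] at a1
      rw [hW x] at a1
      rw [dist_zero_left] at hv2
      change ‖P x.1 - v - w x‖ < ε
      have : P x.1 - v - w x = (P x.1 - w x) - v := by abel
      rw [this]
      refine (norm_sub_le _ _).trans_lt ?_
      linarith
    · intro x hx h
      obtain ⟨t, ht⟩ := hsub hx
      apply hv1
      refine ⟨t, ?_⟩
      change P (A t) = v
      rw [ht]; exact sub_eq_zero.1 h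

end perturb
end AC

namespace AC
open Filter Topology

theorem bary_lin {E F : Type*} [NormedAddCommGroup E] [NormedSpace ℝ E] [NormedAddCommGroup F] [NormedSpace ℝ F]
    (f : E →L[ℝ] F) (x : E) (l : List E) : f (bary (x :: l)) = bary ((x :: l).map f) := by
  rw [bary, bary, map_smul, List.length_map, map_list_sum]

/-- configuration : a compact set with a free involution, charts of `Y` and compact sets in the domain -/
structure Cfg (n : ℕ) (E Y K : Type*) [NormedAddCommGroup E] [NormedSpace ℝ E] [TopologicalSpace Y] where
  S : Set E
  hS : IsCompact S
  ι : E →L[ℝ] E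
  hι : ∀ x, ι (ι x) = x
  hιS : ∀ x ∈ S, ι x ∈ S
  free : ∀ x ∈ S, ι x ≠ x
  y0 : Y
  e : K → OpenPartialHomeomorph Y (V n)
  A : K → Set E
  hA : ∀ k, IsCompact (A k)
  hAS : ∀ k, A k ⊆ S
  hAι : ∀ k, ∀ x ∈ A k, ι x ∈ A k

namespace Cfg
variable {n : ℕ} {E Y K : Type*} [NormedAddCommGroup E] [NormedSpace ℝ E] [TopologicalSpace Y]
  (C : Cfg n E Y K)

instance : CompactSpace C.S := isCompact_iff_compactSpace.1 C.hS

def iS : C(C.S, C.S) := ⟨fun x => ⟨C.ι x.1, C.hιS x.1 x.2⟩,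
  Continuous.subtype_mk (C.ι.continuous.comp continuous_subtype_val) _⟩

open Classical in
noncomputable def ex (a : C(C.S, Y)) (x : E) : Y := if h : x ∈ C.S then a ⟨x, h⟩ else C.y0

theorem ex_of (a : C(C.S, Y)) {x : E} (h : x ∈ C.S) : C.ex a x = a ⟨x, h⟩ := by
  simp [ex, h]

theorem ex_cont (a : C(C.S, Y)) : ContinuousOn (C.ex a) C.S := by
  rw [continuousOn_iff_continuous_domRestrict]
  have : C.S.domRestrict (C.ex a) = a := by
    ext x; exact C.ex_of a x.2
  rw [this]; exact a.continuous

theorem exι_cont (a : C(C.S, Y)) : ContinuousOn (fun x => C.ex a (C.ι x)) C.S :=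
  (C.ex_cont a).comp C.ι.continuous.continuousOn C.hιS

theorem ev_openE (a : C(C.S, Y)) (Ω : Set (Y × Y)) (hΩ : IsOpen Ω) (N : Set E) (hN : IsCompact N) (hNS : N ⊆ C.S)
    (h : ∀ x ∈ N, (C.ex a x, C.ex a (C.ι x)) ∈ Ω) :
    ∀ᶠ a' : C(C.S, Y) in 𝓝 a, ∀ x ∈ N, (C.ex a' x, C.ex a' (C.ι x)) ∈ Ω := by
  have hK : IsCompact ((fun x : C.S => x.1) ⁻¹' N) :=
    (hN.isClosed.preimage continuous_subtype_val).isCompact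
  have key : ∀ (b : C(C.S, Y)) (x : C.S), (C.ex b x.1, C.ex b (C.ι x.1)) = (b x, b (C.iS x)) := by
    intro b x
    rw [C.ex_of b x.2, C.ex_of b (C.hιS _ x.2)]; rfl
  filter_upwards [ev_open C.iS a Ω hΩ _ hK (fun x hx => by rw [← key]; exact h _ hx)] with a' ha x hx
  have := ha ⟨x, hNS hx⟩ hx
  rw [← key] at this; exact this

def NC (a : C(C.S, Y)) (N : Set E) : Prop := ∀ x ∈ N, C.ex a x ≠ C.ex a (C.ι x)

theorem NC_open [T2Space Y] (a : C(C.S, Y)) (N : Set E) (hN : IsCompact N) (hNS : N ⊆ C.S) (h : C.NC a N) :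
    ∀ᶠ a' : C(C.S, Y) in 𝓝 a, C.NC a' N :=
  C.ev_openE a {p | p.1 ≠ p.2} (isClosed_diagonal.isOpen_compl) N hN hNS h

def CL2 (a : C(C.S, Y)) (N : Set E) (j k : K) : Prop := (N ∩ C.A k).Nonempty → ∃ (c : V n) (r : ℝ), 0 < r ∧
    Metric.ball c (2 * r) ⊆ ((C.e j).symm.trans (C.e k)).source ∧
    ∀ x ∈ N, (C.ex a x ∈ (C.e j).source ∧ (C.e j) (C.ex a x) ∈ Metric.ball c r) ∧
      (C.ex a (C.ι x) ∈ (C.e j).source ∧ (C.e j) (C.ex a (C.ι x)) ∈ Metric.ball c r)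

def CL (a : C(C.S, Y)) (N : Set E) : Prop :=
  (∀ x ∈ N, C.ι x ∉ N) ∧ (C.NC a N ∨ ∃ j, N ⊆ C.A j ∧ ∀ k, C.CL2 a N j k)

theorem CL_mono (a : C(C.S, Y)) (N N' : Set E) (h : N ⊆ N') (hN : C.CL a N') : C.CL a N := by
  refine ⟨fun x hx hx' => hN.1 x (h hx) (h hx'), ?_⟩
  rcases hN.2 with h1 | ⟨j, hj, hk⟩
  · exact Or.inl fun x hx => h1 x (h hx)
  · refine Or.inr ⟨j, h.trans hj, fun k hne => ?_⟩
    obtain ⟨c, r, hr, hb, hx⟩ := hk k (hne.mono (Set.inter_subset_inter_left _ h))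
    exact ⟨c, r, hr, hb, fun x hx' => hx x (h hx')⟩

theorem CL_open [T2Space Y] [Finite K] (a : C(C.S, Y)) (N : Set E) (hN : IsCompact N) (hNS : N ⊆ C.S)
    (h : C.CL a N) : ∀ᶠ a' : C(C.S, Y) in 𝓝 a, C.CL a' N := by
  obtain ⟨h1, h2 | ⟨j, hj, hk⟩⟩ := h
  · filter_upwards [C.NC_open a N hN hNS h2] with a' ha'
    exact ⟨h1, Or.inl ha'⟩
  · have : ∀ k, ∀ᶠ a' : C(C.S, Y) in 𝓝 a, C.CL2 a' N j k := by
      intro k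
      by_cases hne : (N ∩ C.A k).Nonempty
      · obtain ⟨c, r, hr, hb, hx⟩ := hk k hne
        have hP : IsOpen ((C.e j).source ∩ (C.e j) ⁻¹' Metric.ball c r) :=
          (C.e j).isOpen_inter_preimage Metric.isOpen_ball
        filter_upwards [C.ev_openE a _ (hP.prod hP) N hN hNS (fun x hx' => hx x hx')] with a' ha' _
        exact ⟨c, r, hr, hb, fun x hx' => ha' x hx'⟩
      · exact Eventually.of_forall fun a' h => absurd h hne
    filter_upwards [eventually_all.2 this] with a' ha'
    exact ⟨h1, Or.inr ⟨j, hj, ha'⟩⟩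

theorem CL_local [T2Space Y] [Finite K] (a : C(C.S, Y))
    (hcov : ∀ x ∈ C.S, C.ex a x = C.ex a (C.ι x) → ∃ k, C.A k ∈ 𝓝[C.S] x)
    (haA : ∀ k, ∀ x ∈ C.A k, C.ex a x ∈ (C.e k).source) (x : E) (hx : x ∈ C.S) :
    ∃ N ∈ 𝓝[C.S] x, C.CL a N := by
  have hc1 : ContinuousWithinAt (C.ex a) C.S x := C.ex_cont a x hx
  have hc2 : ContinuousWithinAt (fun x => C.ex a (C.ι x)) C.S x := C.exι_cont a x hx
  have hfree : ∃ N ∈ 𝓝[C.S] x, ∀ y ∈ N, C.ι y ∉ N := by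
    obtain ⟨U, W, hU, hW, hxU, hxW, hd⟩ := t2_separation (C.free x hx)
    refine ⟨W ∩ C.ι ⁻¹' U, mem_nhdsWithin_of_mem_nhds
      (inter_mem (hW.mem_nhds hxW) (C.ι.continuous.continuousAt.preimage_mem_nhds (hU.mem_nhds hxU))), ?_⟩
    intro y hy hy'
    exact Set.disjoint_left.1 hd hy.2 hy'.1
  obtain ⟨N1, hN1, hf⟩ := hfree
  by_cases hco : C.ex a x = C.ex a (C.ι x)
  · obtain ⟨j, hj⟩ := hcov x hx hco
    have : ∀ k, ∃ N ∈ 𝓝[C.S] x, C.CL2 a N j k := by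
      intro k
      by_cases hk : x ∈ C.A k
      · have hxj : x ∈ C.A j := mem_of_mem_nhdsWithin hx hj
        have hs : (C.e j) (C.ex a x) ∈ ((C.e j).symm.trans (C.e k)).source := by
          rw [OpenPartialHomeomorph.trans_source]
          refine ⟨(C.e j).map_source (haA j x hxj), ?_⟩
          change (C.e j).symm ((C.e j) (C.ex a x)) ∈ (C.e k).source
          rw [(C.e j).left_inv (haA j x hxj)]; exact haA k x hk
        obtain ⟨r, hr, hb⟩ := Metric.isOpen_iff.1 (((C.e j).symm.trans (C.e k)).open_source) _ hs
        have hP : IsOpen ((C.e j).source ∩ (C.e j) ⁻¹' Metric.ball ((C.e j) (C.ex a x)) (r / 2)) :=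
          (C.e j).isOpen_inter_preimage Metric.isOpen_ball
        have hPx : ((C.e j).source ∩ (C.e j) ⁻¹' Metric.ball ((C.e j) (C.ex a x)) (r / 2)) ∈ 𝓝 (C.ex a x) :=
          hP.mem_nhds ⟨haA j x hxj, Metric.mem_ball_self (half_pos hr)⟩
        have hPx2 := hPx
        rw [congrArg 𝓝 hco] at hPx2
        refine ⟨_, inter_mem (hc1 hPx) (hc2 hPx2), fun _ => ?_⟩
        refine ⟨_, r / 2, half_pos hr, ?_, fun y hy => ⟨hy.1, hy.2⟩⟩
        rw [mul_div_cancel₀ _ (two_ne_zero)]; exact hb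
      · refine ⟨(C.A k)ᶜ, mem_nhdsWithin_of_mem_nhds ((C.hA k).isClosed.isOpen_compl.mem_nhds hk), ?_⟩
        rintro ⟨y, hy1, hy2⟩; exact absurd hy2 hy1
    choose N hN hN2 using this
    refine ⟨N1 ∩ (C.A j ∩ ⋂ k, N k), inter_mem hN1 (inter_mem hj (iInter_mem.2 hN)), ?_, Or.inr ⟨j, ?_, ?_⟩⟩
    · intro y hy hy'; exact hf y hy.1 hy'.1
    · intro y hy; exact hy.2.1
    · intro k hne
      have hsub : N1 ∩ (C.A j ∩ ⋂ k, N k) ⊆ N k := fun y hy => Set.mem_iInter.1 hy.2.2 k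
      obtain ⟨c, r, hr, hb, hx⟩ := hN2 k (hne.mono (Set.inter_subset_inter_left _ hsub))
      exact ⟨c, r, hr, hb, fun x hx' => hx x (hsub hx')⟩
  · have : {y | C.ex a y ≠ C.ex a (C.ι y)} ∈ 𝓝[C.S] x :=
      (hc1.prodMk hc2) ((isClosed_diagonal.isOpen_compl).mem_nhds hco)
    refine ⟨_, inter_mem hN1 this, ?_, Or.inl ?_⟩
    · intro y hy hy'; exact hf y hy.1 hy'.1
    · intro y hy; exact hy.2

theorem CL_leb [T2Space Y] [Finite K] (a : C(C.S, Y))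
    (hcov : ∀ x ∈ C.S, C.ex a x = C.ex a (C.ι x) → ∃ k, C.A k ∈ 𝓝[C.S] x)
    (haA : ∀ k, ∀ x ∈ C.A k, C.ex a x ∈ (C.e k).source) (p : ℕ) (z : Ch E)
    (hz : z ∈ Sup (fun L => L.length = p ∧ hull L ⊆ C.S)) :
    ∀ᶠ m in atTop, sd^[m] z ∈ Sup (fun L => L.length = p ∧ hull L ⊆ C.S ∧ C.CL a (hull L)) := by
  have := leb (C.CL a) (C.CL_mono a) ⟨by simp, Or.inl (by intro x hx; simp at hx)⟩ z (by
    intro L hL x hx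
    have h1 := (mem_Sup_iff.1 hz L hL).2
    obtain ⟨N, hN, hN2⟩ := C.CL_local a hcov haA x (h1 hx)
    exact ⟨N, nhdsWithin_mono _ h1 hN, hN2⟩)
  filter_upwards [this] with m hm
  refine Sup_mono ?_ hm
  rintro l ⟨L, hL, h1, h2, h3⟩
  have := mem_Sup_iff.1 hz L hL
  exact ⟨h1.trans this.1, h2.trans this.2, h3⟩

theorem _root_.AC.hull_ne {L : List E} (h : 1 ≤ L.length) : (hull L).Nonempty := by
  cases L with
  | nil => simp at h
  | cons x l => exact ⟨x, mem_hull (by simp)⟩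

theorem gen [T2Space Y] [Finite K] [FiniteDimensional ℝ E] (hn : 1 ≤ n) (a : C(C.S, Y)) (F : Finset (List E))
    (hF : ∀ τ ∈ F, τ.length = n ∧ hull τ ⊆ C.S ∧ C.CL a (hull τ)) (O : Set C(C.S, Y)) (hO : O ∈ 𝓝 a) :
    ∃ a' ∈ O, ∀ τ ∈ F, C.NC a' (hull τ) := by
  classical
  induction F using Finset.induction_on generalizing O with
  | empty => exact ⟨a, mem_of_mem_nhds hO, by simp⟩
  | insert τ F hτ ih =>
    obtain ⟨hl, hs, hcl⟩ := hF τ (by simp)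
    obtain ⟨O', hO', hO'o, haO'⟩ := mem_nhds_iff.1 (inter_mem hO (C.CL_open a _ (hull_compact τ) hs hcl))
    obtain ⟨a1, ha1, ha1F⟩ := ih (fun τ' h => hF τ' (by simp [h])) O' (hO'o.mem_nhds haO')
    have hcl1 : C.CL a1 (hull τ) := (hO' ha1).2
    rcases hcl1.2 with hnc | ⟨j, hj, hk⟩
    · refine ⟨a1, (hO' ha1).1, ?_⟩
      intro τ' h
      rcases Finset.mem_insert.1 h with rfl | h
      · exact hnc
      · exact ha1F _ h
    · have hne : (hull τ ∩ C.A j).Nonempty := by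
        rw [Set.inter_eq_left.2 hj]; exact hull_ne (by omega)
      obtain ⟨c, r, hr, hb, hx⟩ := hk j hne
      have hO2 : O' ∩ {b | ∀ τ ∈ F, C.NC b (hull τ)} ∈ 𝓝 a1 := by
        refine inter_mem (hO'o.mem_nhds ha1) ?_
        have : ∀ᶠ b in 𝓝 a1, ∀ τ ∈ F, C.NC b (hull τ) := by
          rw [Filter.eventually_all_finset]
          intro τ' h
          exact C.NC_open a1 _ (hull_compact τ') (hF τ' (by simp [h])).2.1 (ha1F τ' h)
        exact this
      obtain ⟨a', ha', hnc⟩ := perturb C.iS a1 (C.e j) {x : C.S | x.1 ∈ hull τ}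
        ((hull_compact τ).isClosed.preimage continuous_subtype_val)
        (fun x h => by have := (hx x.1 h).1.1; rwa [C.ex_of a1 x.2] at this)
        (fun x h => by have := (hx x.1 h).2.1; rwa [C.ex_of a1 (C.hιS _ x.2)] at this)
        (fun x h h' => hcl1.1 x.1 h h') (thin_hull C.S C.hS hn τ hl) _ hO2
      refine ⟨a', (hO' ha'.1).1, ?_⟩
      intro τ' h
      rcases Finset.mem_insert.1 h with rfl | h
      · intro x hx
        rw [C.ex_of a' (hs hx), C.ex_of a' (C.hιS _ (hs hx))]
        exact hnc ⟨x, hs hx⟩ hx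
      · exact ha'.2 _ h

noncomputable def wk (a : C(C.S, Y)) (k : K) (x : E) : V n := C.e k (C.ex a x) - C.e k (C.ex a (C.ι x))

def LD (a : C(C.S, Y)) (s : List E) (δ : ZMod 2) : Prop :=
  (C.NC a (hull s) → δ = 0) ∧ ∀ k, hull s ⊆ C.A k → HasDeg (C.wk a k) (bdL s) δ

theorem good_wk (a : C(C.S, Y)) (haA : ∀ k, ∀ x ∈ C.A k, C.ex a x ∈ (C.e k).source) (k : K) (τ : List E)
    (hτ : hull τ ⊆ C.A k) (hnc : C.NC a (hull τ)) : Good (C.wk a k) τ := by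
  refine ⟨ContinuousOn.sub ?_ ?_, ?_⟩
  · exact (C.e k).continuousOn.comp ((C.ex_cont a).mono (hτ.trans (C.hAS k))) (fun x hx => haA k x (hτ hx))
  · exact (C.e k).continuousOn.comp ((C.exι_cont a).mono (hτ.trans (C.hAS k)))
      (fun x hx => haA k _ (C.hAι k x (hτ hx)))
  · intro x hx h
    exact hnc x hx ((C.e k).injOn (haA k x (hτ hx)) (haA k _ (C.hAι k x (hτ hx))) (sub_eq_zero.1 h))

/-- faces of `s` are coincidence free -/
def FF (a : C(C.S, Y)) (s : List E) : Prop := ∀ τ ∈ (bdL s).support, C.NC a (hull τ)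

theorem face (s τ : List E) (h : τ ∈ (bdL s).support) : τ.length + 1 = s.length ∧ hull τ ⊆ hull s := by
  have := mem_Sup_iff.1 (bdL_mem s) τ h
  exact ⟨this.1, hull_mono this.2⟩

theorem LD_unique (a : C(C.S, Y)) (s : List E) (h : C.NC a (hull s) ∨ ∃ k, hull s ⊆ C.A k) {δ δ' : ZMod 2}
    (h1 : C.LD a s δ) (h2 : C.LD a s δ') : δ = δ' := by
  rcases h with h | ⟨k, h⟩
  · rw [h1.1 h, h2.1 h]
  · exact (h1.2 k h).unique (h2.2 k h)

theorem LD_exists (hn : 1 ≤ n) (a : C(C.S, Y)) (haA : ∀ k, ∀ x ∈ C.A k, C.ex a x ∈ (C.e k).source) (s : List E)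
    (hl : s.length = n + 1) (hcl : C.CL a (hull s)) (hf : C.FF a s) : ∃ δ, C.LD a s δ := by
  have hbb : bd (bdL s) = 0 := by rw [← bd_one, bd_bd]
  by_cases hnc : C.NC a (hull s)
  · refine ⟨0, fun _ => rfl, fun k hk => ?_⟩
    rw [← bd_one]
    exact hasDeg_bd (one_mem (C.good_wk a haA k s hk hnc))
  · obtain h | ⟨j, hj, hk⟩ := hcl.2
    · exact absurd h hnc
    · obtain ⟨δ, hδ⟩ := hasDeg_exists (w := C.wk a j) hbb (by
        rw [mem_Sup_iff]
        intro τ hτ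
        exact C.good_wk a haA j τ ((face s τ hτ).2.trans hj) (hf τ hτ))
      refine ⟨δ, fun h => absurd h hnc, fun k hsk => ?_⟩
      obtain ⟨c, r, hr, hb, hx⟩ := hk k (by rw [Set.inter_eq_left.2 hsk]; exact hull_ne (by omega))
      have := deg_chart hn ((C.e j).symm.trans (C.e k)) c r hr hb (bdL s) hbb
        (fun x => C.e j (C.ex a x)) (fun x => C.e j (C.ex a (C.ι x))) (by
          rw [mem_Sup_iff]
          intro τ hτ
          have hs := (face s τ hτ).2
          have hlen := (face s τ hτ).1
          refine ⟨by omega, ?_, ?_, ?_⟩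
          · exact (C.e j).continuousOn.comp ((C.ex_cont a).mono ((hs.trans hj).trans (C.hAS j)))
              (fun x hx' => (hx x (hs hx')).1.1)
          · exact (C.e j).continuousOn.comp ((C.exι_cont a).mono ((hs.trans hj).trans (C.hAS j)))
              (fun x hx' => (hx x (hs hx')).2.1)
          · intro x hx'
            refine ⟨(hx x (hs hx')).1.2, (hx x (hs hx')).2.2, fun h => ?_⟩
            exact hf τ hτ x hx' ((C.e j).injOn (hx x (hs hx')).1.1 (hx x (hs hx')).2.1 h)) δ hδ
      refine this.congr ?_
      rw [mem_Sup_iff]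
      intro τ hτ x hx'
      have hs := (face s τ hτ).2
      change (C.e k) ((C.e j).symm (C.e j (C.ex a x))) - (C.e k) ((C.e j).symm (C.e j (C.ex a (C.ι x)))) = _
      rw [(C.e j).left_inv (hx x (hs hx')).1.1, (C.e j).left_inv (hx x (hs hx')).2.1]; rfl

theorem hull_map (s : List E) (x : E) (hx : x ∈ hull (s.map C.ι)) : C.ι x ∈ hull s := by
  have hcv : Convex ℝ ((fun y => C.ι y) ⁻¹' hull s) := (hull_convex s).linear_preimage C.ι.toLinearMap
  refine hull_sub hcv ?_ hx
  intro y hy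
  obtain ⟨z, hz, rfl⟩ := List.mem_map.1 hy
  change C.ι (C.ι z) ∈ hull s
  rw [C.hι]; exact mem_hull hz

theorem map_map (s : List E) : (s.map C.ι).map C.ι = s := by
  rw [List.map_map]
  have : (C.ι ∘ C.ι : E → E) = id := by ext x; exact C.hι x
  rw [this, List.map_id]

theorem NC_map (a : C(C.S, Y)) (s : List E) (h : C.NC a (hull s)) : C.NC a (hull (s.map C.ι)) := by
  intro x hx he
  apply h _ (C.hull_map s x hx)
  rw [C.hι]; exact he.symm

theorem A_map (k : K) (s : List E) (h : hull s ⊆ C.A k) : hull (s.map C.ι) ⊆ C.A k := by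
  intro x hx
  have := C.hAι k _ (h (C.hull_map s x hx))
  rwa [C.hι] at this

theorem neg_deg (hn : 1 ≤ n) {w : E → V n} (z : Ch E) (hz : bd z = 0) (hs : z ∈ Sup (fun L => L.length = n ∧ Good w L))
    (d : ZMod 2) (hd : HasDeg w z d) : HasDeg (fun x => - w x) z d := by
  have hbdd : ∃ ρ : ℝ, 0 < ρ ∧ ∀ L ∈ z.support, ∀ x ∈ hull L, ‖w x‖ < ρ := by
    have h1 : ∀ L : z.support, ∃ M : ℝ, ∀ x ∈ hull L.1, ‖w x‖ ≤ M := by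
      intro L
      obtain ⟨M, hM⟩ := (hull_compact L.1).exists_bound_of_continuousOn (mem_Sup_iff.1 hs L.1 L.2).2.1
      exact ⟨M, hM⟩
    choose M hM using h1
    refine ⟨∑ L, |M L| + 1, by positivity, fun L hL x hx => ?_⟩
    have h2 := Finset.single_le_sum (f := fun L => |M L|) (fun i _ => abs_nonneg _) (Finset.mem_univ (⟨L, hL⟩ : z.support))
    have h3 := hM ⟨L, hL⟩ x hx
    have h4 := le_abs_self (M ⟨L, hL⟩)
    linarith
  obtain ⟨ρ, hρ, hb⟩ := hbdd
  refine deg_homeo hn hρ one_pos (fun v => -v) (fun v => -v) continuous_neg.continuousOn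
    (fun v _ h => neg_ne_zero.2 h) neg_zero continuous_neg.continuousOn neg_zero (fun v _ => neg_neg v) z hz w ?_ d hd
  rw [mem_Sup_iff]
  intro L hL
  have := mem_Sup_iff.1 hs L hL
  exact ⟨this.1, this.2, fun x hx => by rw [mem_ball_zero_iff]; exact hb L hL x hx⟩

theorem LD_map (hn : 1 ≤ n) (a : C(C.S, Y)) (haA : ∀ k, ∀ x ∈ C.A k, C.ex a x ∈ (C.e k).source) (s : List E)
    (hl : s.length = n + 1) (hf : C.FF a s) {δ : ZMod 2} (h : C.LD a s δ) : C.LD a (s.map C.ι) δ := by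
  refine ⟨fun hnc => h.1 ?_, fun k hk => ?_⟩
  · have := C.NC_map a _ hnc
    rwa [C.map_map] at this
  · have hk' : hull s ⊆ C.A k := by
      have := C.A_map k _ hk
      rwa [C.map_map] at this
    have h1 : bdL (s.map C.ι) = push C.ι (bdL s) := by
      rw [← bd_one, ← bd_one, ← bd_push, push_one]
    rw [h1, hasDeg_push (bary_lin C.ι)]
    have h2 := neg_deg hn (w := C.wk a k) (bdL s) (by rw [← bd_one, bd_bd]) (by
      rw [mem_Sup_iff]
      intro τ hτ
      have := face s τ hτ
      exact ⟨by omega, C.good_wk a haA k τ (this.2.trans hk') (hf τ hτ)⟩) δ (h.2 k hk')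
    have h3 : (fun x => C.wk a k (C.ι x)) = fun x => - C.wk a k x := by
      ext1 x
      rw [wk, wk, C.hι]; abel
    rw [h3]; exact h2

end Cfg
end AC

namespace AC
open Filter Topology
namespace Cfg
variable {n : ℕ} {E Y K : Type*} [NormedAddCommGroup E] [NormedSpace ℝ E] [TopologicalSpace Y]
  (C : Cfg n E Y K)

theorem main [T2Space Y] [Finite K] [FiniteDimensional ℝ E] (hn : 1 ≤ n) (a : C(C.S, Y))
    (hcov : ∀ x ∈ C.S, C.ex a x = C.ex a (C.ι x) → ∃ k, C.A k ∈ 𝓝[C.S] x)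
    (haA : ∀ k, ∀ x ∈ C.A k, C.ex a x ∈ (C.e k).source) (c0 z1 z0 q : Ch E)
    (hc0 : c0 ∈ Sup (fun L => L.length = n + 2 ∧ hull L ⊆ C.S))
    (hz1 : z1 ∈ Sup (fun L => L.length = n + 1 ∧ hull L ⊆ C.S))
    (hz0 : z0 ∈ Sup (fun L => L.length = n + 1 ∧ hull L ⊆ C.S))
    (hq : q ∈ Sup (fun L => L.length = n + 1 ∧ hull L ⊆ C.S))
    (hbd : bd c0 = z1 + z0 + (q + push C.ι q)) :
    ∀ᶠ m in atTop, ∀ O ∈ 𝓝 a, ∃ a' ∈ O, ∃ d : List E → ZMod 2,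
      (∀ s, s ∈ (sd^[m] z1).support ∨ s ∈ (sd^[m] z0).support → C.LD a' s (d s) ∧ C.FF a' s) ∧
      lin d (sd^[m] z1) + lin d (sd^[m] z0) = 0 := by
  classical
  filter_upwards [C.CL_leb a hcov haA _ c0 hc0, C.CL_leb a hcov haA _ z1 hz1, C.CL_leb a hcov haA _ z0 hz0,
    C.CL_leb a hcov haA _ q hq] with m m0 m1 m2 m3 O hO
  let F1 : Finset (List E) := ((sd^[m] z1).support ∪ (sd^[m] z0).support ∪ (sd^[m] q).support) ∪
    (sd^[m] c0).support.biUnion (fun σ => (bdL σ).support)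
  have hF1 : ∀ s ∈ F1, s.length = n + 1 ∧ hull s ⊆ C.S ∧ C.CL a (hull s) := by
    intro s hs
    simp only [F1, Finset.mem_union, Finset.mem_biUnion] at hs
    rcases hs with ((h | h) | h) | ⟨σ, hσ, h⟩
    · exact mem_Sup_iff.1 m1 s h
    · exact mem_Sup_iff.1 m2 s h
    · exact mem_Sup_iff.1 m3 s h
    · obtain ⟨b1, b2, b3⟩ := mem_Sup_iff.1 m0 σ hσ
      have := face σ s h
      exact ⟨by omega, this.2.trans b2, C.CL_mono a _ _ this.2 b3⟩
  let F2 := F1.biUnion (fun s => (bdL s).support)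
  have hF2 : ∀ τ ∈ F2, τ.length = n ∧ hull τ ⊆ C.S ∧ C.CL a (hull τ) := by
    intro τ hτ
    obtain ⟨s, hs, h⟩ := Finset.mem_biUnion.1 hτ
    obtain ⟨b1, b2, b3⟩ := hF1 s hs
    have := face s τ h
    exact ⟨by omega, this.2.trans b2, C.CL_mono a _ _ this.2 b3⟩
  have o1 : ∀ᶠ a' : C(C.S, Y) in 𝓝 a, ∀ s ∈ F1, C.CL a' (hull s) := by
    rw [Filter.eventually_all_finset]
    intro s hs
    exact C.CL_open a _ (hull_compact s) (hF1 s hs).2.1 (hF1 s hs).2.2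
  have o1' : ∀ᶠ a' : C(C.S, Y) in 𝓝 a, ∀ s ∈ (sd^[m] c0).support, C.CL a' (hull s) := by
    rw [Filter.eventually_all_finset]
    intro s hs
    obtain ⟨b1, b2, b3⟩ := mem_Sup_iff.1 m0 s hs
    exact C.CL_open a _ (hull_compact s) b2 b3
  have o2 : ∀ᶠ a' : C(C.S, Y) in 𝓝 a, ∀ k, ∀ x ∈ C.A k, C.ex a' x ∈ (C.e k).source := by
    rw [eventually_all]
    intro k
    have := C.ev_openE a ((C.e k).source ×ˢ Set.univ) ((C.e k).open_source.prod isOpen_univ) (C.A k) (C.hA k) (C.hAS k)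
      (fun x hx => ⟨haA k x hx, trivial⟩)
    filter_upwards [this] with a' ha' x hx
    exact (ha' x hx).1
  obtain ⟨a', ha', hgen⟩ := C.gen hn a F2 hF2 _ (inter_mem hO (inter_mem o1 (inter_mem o1' o2)))
  obtain ⟨haO, ho1, ho1', ho2⟩ := ha'
  have hFF : ∀ s ∈ F1, C.FF a' s := fun s hs τ hτ => hgen τ (Finset.mem_biUnion.2 ⟨s, hs, hτ⟩)
  let d : List E → ZMod 2 := fun s => if h : ∃ δ, C.LD a' s δ then h.choose else 0
  have hd : ∀ s, (∃ δ, C.LD a' s δ) → C.LD a' s (d s) := by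
    intro s h
    simp only [d, dif_pos h]; exact h.choose_spec
  have hd1 : ∀ s ∈ F1, C.LD a' s (d s) := fun s hs =>
    hd s (C.LD_exists hn a' ho2 s (hF1 s hs).1 (ho1 s hs) (hFF s hs))
  refine ⟨a', haO, d, ?_, ?_⟩
  · intro s hs
    have : s ∈ F1 := by
      simp only [F1, Finset.mem_union]
      tauto
    exact ⟨hd1 s this, hFF s this⟩
  · have hcoc : lin d (bd (sd^[m] c0)) = 0 := by
      have : (lin d ∘ₗ bd) (sd^[m] c0) = (0 : Ch E →ₗ[ZMod 2] ZMod 2) (sd^[m] c0) := by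
        apply map_eq _ _ _ (self_mem (sd^[m] c0))
        intro σ hσ
        rw [LinearMap.comp_apply, bd_one, LinearMap.zero_apply]
        have hfaces : ∀ s ∈ (bdL σ).support, s ∈ F1 := by
          intro s hs
          exact Finset.mem_union_right _ (Finset.mem_biUnion.2 ⟨σ, hσ, hs⟩)
        rcases (ho1' σ hσ).2 with hnc | ⟨j, hj, -⟩
        · have : lin d (bdL σ) = (0 : Ch E →ₗ[ZMod 2] ZMod 2) (bdL σ) := by
            apply map_eq _ _ _ (self_mem (bdL σ))
            intro s hs
            rw [lin_one, LinearMap.zero_apply]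
            exact (hd1 s (hfaces s hs)).1 (fun x hx => hnc x ((face σ s hs).2 hx))
          rw [this, LinearMap.zero_apply]
        · have h1 : HasDeg (C.wk a' j) (bd (bdL σ)) (lin d (bdL σ)) := by
            apply hasDeg_lin
            rw [mem_Sup_iff]
            intro s hs
            exact (hd1 s (hfaces s hs)).2 j ((face σ s hs).2.trans hj)
          rw [← bd_one, bd_bd] at h1
          rw [← bd_one]
          exact h1.unique (HasDeg.zero _)
      simpa [LinearMap.comp_apply] using this
    have hinv : lin d (push C.ι (sd^[m] q)) = lin d (sd^[m] q) := by
      rw [lin_push]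
      apply map_eq _ _ _ (self_mem (sd^[m] q))
      intro s hs
      rw [lin_one, lin_one]
      have hsF : s ∈ F1 := by
        simp only [F1, Finset.mem_union]
        tauto
      have h1 := C.LD_map hn a' ho2 s (hF1 s hsF).1 (hFF s hsF) (hd1 s hsF)
      refine C.LD_unique a' _ ?_ (hd _ ⟨_, h1⟩) h1
      rcases (ho1 s hsF).2 with h | ⟨j, hj, -⟩
      · exact Or.inl (C.NC_map a' s h)
      · exact Or.inr ⟨j, C.A_map j s hj⟩
    rw [bd_iter, hbd, iter_add, iter_add, iter_add, iter_push _ (bary_lin C.ι), map_add, map_add, map_add, hinv,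
      CharTwo.add_self_eq_zero, add_zero] at hcoc
    exact hcoc

end Cfg
end AC

namespace AC
open Filter Topology
namespace Cfg
variable {n : ℕ} {E Y : Type*} [NormedAddCommGroup E] [NormedSpace ℝ E] [TopologicalSpace Y]

theorem main' [T2Space Y] [ChartedSpace (V n) Y] [FiniteDimensional ℝ E] (hn : 1 ≤ n) (b : Cfg n E Y Unit) (a : C(b.S, Y))
    (haA : ∀ x ∈ b.A (), b.ex a x ∈ (b.e ()).source) (c0 z1 z0 q : Ch E)
    (hc0 : c0 ∈ Sup (fun L => L.length = n + 2 ∧ hull L ⊆ b.S))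
    (hz1 : z1 ∈ Sup (fun L => L.length = n + 1 ∧ hull L ⊆ b.S))
    (hz0 : z0 ∈ Sup (fun L => L.length = n + 1 ∧ hull L ⊆ b.S))
    (hq : q ∈ Sup (fun L => L.length = n + 1 ∧ hull L ⊆ b.S))
    (hbd : bd c0 = z1 + z0 + (q + push b.ι q)) :
    ∀ᶠ m in atTop, ∀ O ∈ 𝓝 a, ∃ a' ∈ O, ∃ d : List E → ZMod 2,
      (∀ s, s ∈ (sd^[m] z1).support ∨ s ∈ (sd^[m] z0).support → b.LD a' s (d s) ∧ b.FF a' s) ∧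
      lin d (sd^[m] z1) + lin d (sd^[m] z0) = 0 := by
  classical
  let Z : Set E := b.S ∩ (fun x => (b.ex a x, b.ex a (b.ι x))) ⁻¹' (Set.diagonal Y)
  have hZ : IsCompact Z := by
    refine b.hS.of_isClosed_subset ?_ Set.inter_subset_left
    exact ((b.ex_cont a).prodMk (b.exι_cont a)).preimage_isClosed_of_isClosed b.hS.isClosed isClosed_diagonal
  let ch : E → OpenPartialHomeomorph Y (V n) := fun q => chartAt (V n) (b.ex a q)
  have hr : ∀ q : E, ∃ r : ℝ, 0 < r ∧ (q ∈ Z → ∀ x ∈ b.S, x ∈ Metric.closedBall q r →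
      b.ex a x ∈ (ch q).source ∧ b.ex a (b.ι x) ∈ (ch q).source) := by
    intro q
    by_cases hq : q ∈ Z
    · have h1 := (b.ex_cont a) q hq.1
      have h2 := (b.exι_cont a) q hq.1
      have hs : (ch q).source ∈ 𝓝 (b.ex a q) := (ch q).open_source.mem_nhds (mem_chart_source _ _)
      have hs2 := hs
      rw [congrArg 𝓝 (show b.ex a q = b.ex a (b.ι q) from hq.2)] at hs2
      obtain ⟨r, hr, hb⟩ := Metric.mem_nhdsWithin_iff.1 (inter_mem (h1 hs) (h2 hs2))
      refine ⟨r / 2, half_pos hr, fun _ x hx hxb => ?_⟩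
      exact hb ⟨Metric.closedBall_subset_ball (half_lt_self hr) hxb, hx⟩
    · exact ⟨1, one_pos, fun h => absurd h hq⟩
  choose r hr0 hr using hr
  obtain ⟨t, ht, hcovt⟩ := hZ.elim_nhds_subcover (fun q => Metric.ball q (r q)) (fun q _ => Metric.ball_mem_nhds q (hr0 q))
  let AA : E → Set E := fun q => b.S ∩ (Metric.closedBall q (r q) ∪ b.ι ⁻¹' Metric.closedBall q (r q))
  let C : Cfg n E Y (Option t) :=
    { S := b.S, hS := b.hS, ι := b.ι, hι := b.hι, hιS := b.hιS, free := b.free, y0 := b.y0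
      e := fun k => match k with
        | none => b.e ()
        | some q => ch q.1
      A := fun k => match k with
        | none => b.A ()
        | some q => AA q.1
      hA := fun k => match k with
        | none => b.hA ()
        | some q => b.hS.inter_right (Metric.isClosed_closedBall.union
            (Metric.isClosed_closedBall.preimage b.ι.continuous))
      hAS := fun k => match k with
        | none => b.hAS ()
        | some q => Set.inter_subset_left
      hAι := fun k => match k with
        | none => b.hAι ()
        | some q => by
            rintro x ⟨h1, h2⟩
            refine ⟨b.hιS x h1, ?_⟩
            rcases h2 with h2 | h2
            · right; change b.ι (b.ι x) ∈ Metric.closedBall q.1 (r q.1); rw [b.hι]; exact h2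
            · left; exact h2 }
  have key := C.main hn a ?_ ?_ c0 z1 z0 q hc0 hz1 hz0 hq hbd
  · filter_upwards [key] with m hm O hO
    obtain ⟨a', ha', d, h1, h2⟩ := hm O hO
    refine ⟨a', ha', d, fun s hs => ⟨⟨(h1 s hs).1.1, fun k hk => (h1 s hs).1.2 none hk⟩, (h1 s hs).2⟩, h2⟩
  · intro x hx hco
    obtain ⟨q, hq, hxq⟩ := Set.mem_iUnion₂.1 (hcovt (show x ∈ Z from ⟨hx, hco⟩))
    refine ⟨some ⟨q, hq⟩, ?_⟩
    change AA q ∈ 𝓝[b.S] x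
    refine inter_mem self_mem_nhdsWithin (mem_nhdsWithin_of_mem_nhds ?_)
    exact mem_of_superset (Metric.isOpen_ball.mem_nhds hxq) (fun y hy => Or.inl (Metric.ball_subset_closedBall hy))
  · intro k
    match k with
    | none => exact haA
    | some q =>
      rintro x ⟨h1, h2⟩
      rcases h2 with h2 | h2
      · exact (hr q.1 (ht q.1 q.2) x h1 h2).1
      · have := (hr q.1 (ht q.1 q.2) (b.ι x) (b.hιS x h1) h2).2
        rw [b.hι] at this
        exact this

end Cfg
end AC

namespace AC
open Filter Topology

section chains
variable {n : ℕ}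

abbrev W (n : ℕ) := V n × ℝ

noncomputable def bs (n : ℕ) (i : ℕ) : W n := if h : i < n then (EuclideanSpace.single ⟨i, h⟩ 1, 0) else (0, 1)

theorem bs_lt (i : ℕ) (h : i < n) : bs n i = (EuclideanSpace.single ⟨i, h⟩ 1, 0) := by simp [bs, h]
theorem bs_n : bs n n = (0, 1) := by simp [bs]

noncomputable def GG (n : ℕ) : ℕ → Ch (W n)
  | 0 => one [bs n 0]
  | k + 1 => cone (bs n (k + 1)) (GG n k + push (fun x => -x) (GG n k))

theorem GG_succ (k : ℕ) : GG n (k + 1) = cone (bs n (k + 1)) (GG n k + push (fun x => -x) (GG n k)) := rfl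

theorem neg_neg_ch (c : Ch (W n)) : push (fun x => -x) (push (fun x => -x) c) = c := by
  have : (push (fun x : W n => -x) ∘ₗ push (fun x : W n => -x)) = LinearMap.id := by
    apply lin_ext
    intro l
    simp [push_one]
  exact congrArg (fun g => g c) this

theorem bd_GG_inv (k : ℕ) : bd (GG n k) + push (fun x => -x) (bd (GG n k)) = 0 ∧
    bd (GG n (k + 1)) = GG n k + push (fun x => -x) (GG n k) := by
  induction k with
  | zero =>
    have h : bd (GG n 0) + push (fun x => -x) (bd (GG n 0)) = 0 := by
      have : bd (GG n 0) = one [] := by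
        rw [GG, bd_one]; simp [bdL]
      rw [this, push_one]; exact ch_add_self _
    refine ⟨h, ?_⟩
    rw [GG_succ, bd_cone, map_add, bd_push, h, map_zero, add_zero]
  | succ k ih =>
    have h : bd (GG n (k + 1)) + push (fun x => -x) (bd (GG n (k + 1))) = 0 := by
      rw [ih.2, map_add, neg_neg_ch, add_comm (push (fun x => -x) (GG n k)), ch_add_self]
    refine ⟨h, ?_⟩
    rw [GG_succ, bd_cone, map_add, bd_push, h, map_zero, add_zero]

/-- vertices with prescribed signs -/
def RR (s : ℕ → ℝ) (k : ℕ) (L : List (W n)) : Prop := (∀ i, s i = 1 ∨ s i = -1) ∧ ∀ x ∈ L, ∃ i ≤ k, x = s i • bs n i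

theorem RR_neg {s : ℕ → ℝ} {k : ℕ} {L : List (W n)} (h : RR s k L) : RR (fun i => - s i) k (L.map (fun x => -x)) := by
  refine ⟨fun i => ?_, ?_⟩
  · rcases h.1 i with h | h <;> simp [h]
  · intro x hx
    obtain ⟨y, hy, rfl⟩ := List.mem_map.1 hx
    obtain ⟨i, hi, rfl⟩ := h.2 y hy
    exact ⟨i, hi, by simp⟩

theorem RR_cons {s : ℕ → ℝ} {k : ℕ} {L : List (W n)} (h : RR s k L) :
    RR (fun i => if i = k + 1 then 1 else s i) (k + 1) (bs n (k + 1) :: L) := by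
  refine ⟨fun i => ?_, ?_⟩
  · by_cases hi : i = k + 1
    · simp [hi]
    · simpa [hi] using h.1 i
  · intro x hx
    rcases List.mem_cons.1 hx with rfl | hx
    · exact ⟨k + 1, le_rfl, by simp⟩
    · obtain ⟨i, hi, rfl⟩ := h.2 x hx
      exact ⟨i, by omega, by simp [show i ≠ k + 1 by omega]⟩

theorem GG_mem (k : ℕ) : GG n k ∈ Sup (fun L => L.length = k + 1 ∧ bs n k ∈ L ∧ ∃ s, RR s k L ∧ s k = 1) := by
  induction k with
  | zero =>
    rw [GG]
    apply one_mem
    refine ⟨rfl, by simp, fun _ => 1, ⟨by simp, ?_⟩, rfl⟩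
    intro x hx
    exact ⟨0, le_rfl, by simpa using hx⟩
  | succ k ih =>
    rw [GG, map_add]
    refine Submodule.add_mem _ ?_ ?_
    · refine map_mem _ _ ?_ ih
      rintro l ⟨h1, h2, s, h3, h4⟩
      rw [cone_one]
      exact one_mem ⟨by simp [h1], by simp, _, RR_cons h3, by simp⟩
    · have := map_mem (cone (bs n (k + 1)) ∘ₗ push (fun x : W n => -x))
        (Sup (fun L => L.length = (k + 1) + 1 ∧ bs n (k + 1) ∈ L ∧ ∃ s, RR s (k + 1) L ∧ s (k + 1) = 1)) (by
          rintro l ⟨h1, h2, s, h3, h4⟩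
          rw [LinearMap.comp_apply, push_one, cone_one]
          exact one_mem ⟨by simp [h1], by simp, _, RR_cons (RR_neg h3), by simp⟩) ih
      exact this

theorem ev_GG1 (c : ℝ) (hc : 0 < c) (k m : ℕ) (hk : k < n) (hm : m ≤ n) :
    lin (chi (Multiset.range m)) (push (fun x : W n => lab (c • x.1)) (GG n k)) = 0 := by
  have : (lin (chi (Multiset.range m)) ∘ₗ push (fun x : W n => lab (c • x.1))) (GG n k) =
      (0 : Ch (W n) →ₗ[ZMod 2] ZMod 2) (GG n k) := by
    apply map_eq _ _ _ (GG_mem k)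
    rintro l ⟨h1, h2, -⟩
    rw [LinearMap.comp_apply, push_one, lin_one, LinearMap.zero_apply, chi, if_neg]
    intro he
    have h3 : lab (c • (bs n k).1) ∈ (Multiset.range m) := by
      rw [← he]; exact Multiset.mem_coe.2 (List.mem_map.2 ⟨_, h2, rfl⟩)
    rw [Multiset.mem_range] at h3
    have h4 := lab_lt (lt_of_lt_of_le h3 hm)
    have h5 : ∀ i : Fin n, 0 ≤ (c • (bs n k).1) i := by
      intro i
      rw [bs_lt k hk]
      simp only [PiLp.smul_apply, smul_eq_mul, PiLp.single_apply]
      split_ifs <;> linarith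
    exact absurd (h5 _) (not_le.2 h4)
  simpa using this

theorem lab_neg_bs (c : ℝ) (hc : 0 < c) (k : ℕ) (hk : k < n) : lab (c • (-bs n k).1) = k := by
  have h0 : ∀ i : Fin n, (c • (-bs n k).1) i < 0 ↔ i.1 = k := by
    intro i
    rw [bs_lt k hk]
    simp only [PiLp.smul_apply, smul_eq_mul, Prod.fst_neg, PiLp.neg_apply, PiLp.single_apply, Fin.ext_iff]
    split_ifs with h
    · simp [h, hc]
    · simp [h]
  by_cases h : lab (c • (-bs n k).1) < n
  · exact (h0 _).1 (lab_lt h)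
  · have := lab_ge (not_lt.1 h) ⟨k, hk⟩
    have h2 := (h0 ⟨k, hk⟩).2 rfl
    linarith

theorem ev_GG2 (c : ℝ) (hc : 0 < c) (k : ℕ) (hk : k < n) :
    lin (chi (Multiset.range (k + 1))) (push (fun x : W n => lab (c • (-x).1)) (GG n k)) = 1 := by
  induction k with
  | zero =>
    rw [GG, push_one, lin_one, chi, if_pos]
    simp only [List.map_cons, List.map_nil]
    rw [lab_neg_bs c hc 0 hk]; rfl
  | succ k ih =>
    rw [GG, push_cone, lab_neg_bs c hc (k + 1) hk]
    have h1 : lin (chi (Multiset.range (k + 1 + 1))) ∘ₗ cone (k + 1) = lin (chi (Multiset.range (k + 1))) := by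
      apply lin_ext
      intro l
      rw [LinearMap.comp_apply, cone_one, lin_one, lin_one, chi, chi]
      congr 1
      rw [Multiset.range_succ, ← Multiset.cons_coe, Multiset.cons_inj_right]
    have h2 := congrArg (fun g => g (push (fun x : W n => lab (c • (-x).1)) (GG n k + push (fun x => -x) (GG n k)))) h1
    simp only [LinearMap.comp_apply] at h2
    rw [h2, map_add, map_add, ih (by omega), push_push]
    have h3 : ((fun x : W n => lab (c • (-x).1)) ∘ fun x => -x) = (fun x : W n => lab (c • x.1)) := by
      funext x; simp
    rw [h3, ev_GG1 c hc k (k + 1) (by omega) (by omega), add_zero]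

/-- the orthant face -/
def CS (s : ℕ → ℝ) : Set (W n) := {x | (∀ i : Fin n, 0 ≤ s i * x.1 i) ∧ 0 ≤ s n * x.2 ∧ ∑ i : Fin n, s i * x.1 i + s n * x.2 = 1}

theorem CS_convex (s : ℕ → ℝ) : Convex ℝ (CS (n := n) s) := by
  rintro x ⟨x1, x2, x3⟩ y ⟨y1, y2, y3⟩ a b ha hb hab
  refine ⟨fun i => ?_, ?_, ?_⟩
  · have := add_nonneg (mul_nonneg ha (x1 i)) (mul_nonneg hb (y1 i))
    simp only [Prod.fst_add, Prod.smul_fst, PiLp.add_apply, PiLp.smul_apply, smul_eq_mul]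
    linarith
  · have := add_nonneg (mul_nonneg ha x2) (mul_nonneg hb y2)
    simp only [Prod.snd_add, Prod.smul_snd, smul_eq_mul]
    linarith
  · have : ∑ i : Fin n, s i * (a • x + b • y).1 i = a * ∑ i : Fin n, s i * x.1 i + b * ∑ i : Fin n, s i * y.1 i := by
      rw [Finset.mul_sum, Finset.mul_sum, ← Finset.sum_add_distrib]
      refine Finset.sum_congr rfl fun i _ => ?_
      simp only [Prod.fst_add, Prod.smul_fst, PiLp.add_apply, PiLp.smul_apply, smul_eq_mul]; ring
    rw [this]
    simp only [Prod.snd_add, Prod.smul_snd, smul_eq_mul]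
    calc _ = a * (∑ i : Fin n, s i * x.1 i + s n * x.2) + b * (∑ i : Fin n, s i * y.1 i + s n * y.2) := by ring
      _ = 1 := by rw [x3, y3]; linarith

theorem CS_vert {s : ℕ → ℝ} (hs : ∀ i, s i = 1 ∨ s i = -1) (i : ℕ) (hi : i ≤ n) : s i • bs n i ∈ CS (n := n) s := by
  have hsq : ∀ i, s i * s i = 1 := by
    intro i; rcases hs i with h | h <;> simp [h]
  by_cases h : i < n
  · rw [bs_lt i h]
    have hv : ∀ j : Fin n, s j * (s i • ((EuclideanSpace.single ⟨i, h⟩ (1:ℝ), (0:ℝ)) : W n)).1 j = if j = ⟨i, h⟩ then 1 else 0 := by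
      intro j
      simp only [Prod.smul_fst, PiLp.smul_apply, smul_eq_mul, PiLp.single_apply]
      by_cases hj : j = ⟨i, h⟩
      · subst hj; simp [hsq]
      · simp [hj]
    refine ⟨fun j => ?_, by simp, ?_⟩
    · rw [hv]; split_ifs <;> norm_num
    · rw [Finset.sum_congr rfl (fun j _ => hv j)]; simp
  · obtain rfl : i = n := by omega
    rw [bs_n]
    refine ⟨fun j => by simp, by simp [hsq], by simp [hsq]⟩

theorem CS_hull {s : ℕ → ℝ} {k : ℕ} (hk : k ≤ n) {L : List (W n)} (h : RR s k L) : hull L ⊆ CS s := by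
  refine hull_sub (CS_convex s) ?_
  intro x hx
  obtain ⟨i, hi, rfl⟩ := h.2 x hx
  exact CS_vert h.1 i (hi.trans hk)

theorem hull_zero {s : ℕ → ℝ} {k : ℕ} (hk : k < n) {L : List (W n)} (h : RR s k L) : ∀ x ∈ hull L, x.2 = 0 := by
  have hc : Convex ℝ {x : W n | x.2 = 0} := by
    intro x hx y hy a b _ _ _
    simp only [Set.mem_ofPred_eq] at hx hy ⊢
    simp [hx, hy]
  intro x hx
  refine hull_sub hc ?_ hx
  intro x hx
  obtain ⟨i, hi, rfl⟩ := h.2 x hx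
  rw [bs_lt i (by omega)]; simp

theorem CS_sphere {s : ℕ → ℝ} (hs : ∀ i, s i = 1 ∨ s i = -1) {x : W n} (h : x ∈ CS s) : ∑ i, |x.1 i| + |x.2| = 1 := by
  have ha : ∀ (i : ℕ) (t : ℝ), 0 ≤ s i * t → |t| = s i * t := by
    intro i t ht
    rcases hs i with h | h
    · rw [h] at ht ⊢; rw [abs_of_nonneg] <;> linarith
    · rw [h] at ht ⊢; rw [abs_of_nonpos] <;> linarith
  rw [Finset.sum_congr rfl (fun (i : Fin n) _ => ha i _ (h.1 i)), ha n _ h.2.1]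
  exact h.2.2

theorem NF_CS {s : ℕ → ℝ} (hs : ∀ i, s i = 1 ∨ s i = -1) (c : ℝ) (hc : 0 < c) (B : Set (W n)) (h : B ⊆ CS s)
    (h0 : ∀ x ∈ B, x.2 = 0) : NF ((fun x : W n => c • x.1) '' B) := by
  rintro ⟨h1, _, ⟨x, hx, rfl⟩, h2⟩
  have hneg : ∀ i : Fin n, s i = -1 := by
    intro i
    obtain ⟨_, ⟨y, hy, rfl⟩, h3⟩ := h1 i
    rcases hs i with h4 | h4
    · have h5 := (h hy).1 i
      simp only [PiLp.smul_apply, smul_eq_mul] at h3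
      rw [h4] at h5
      nlinarith
    · exact h4
  have hz := (h hx).2.2
  rw [h0 x hx] at hz
  have : ∑ i : Fin n, s i * x.1 i ≤ 0 := by
    apply Finset.sum_nonpos
    intro i _
    have h3 := h2 i
    simp only [PiLp.smul_apply, smul_eq_mul] at h3
    rw [hneg i]
    have := nonneg_of_mul_nonneg_right h3 hc
    linarith
  linarith

/-- the equator has degree one -/
theorem equator (p : ℕ) (c : ℝ) (hc : 0 < c) :
    HasDeg (fun x : W (p + 1) => c • x.1) (GG (p + 1) p + push (fun x => -x) (GG (p + 1) p)) 1 := by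
  have h1 : ev (fun x : W (p + 1) => c • x.1) (GG (p + 1) p + push (fun x => -x) (GG (p + 1) p)) = 1 := by
    rw [map_add, ev_push, ev_eq, ev_eq, ev_GG1 c hc p (p + 1) (by omega) le_rfl, zero_add]
    exact ev_GG2 c hc p (by omega)
  rw [← h1]
  apply hasDeg_NF
  · rw [← (bd_GG_inv p).2, bd_bd]
  · have hm := GG_mem (n := p + 1) p
    refine Submodule.add_mem _ (Sup_mono ?_ hm) (map_mem _ _ ?_ hm)
    · rintro l ⟨-, -, s, h, -⟩
      exact NF_CS h.1 c hc _ (CS_hull (by omega) h) (hull_zero (by omega) h)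
    · rintro l ⟨-, -, s, h, -⟩
      rw [push_one]
      apply one_mem
      have h' := RR_neg h
      exact NF_CS h'.1 c hc _ (CS_hull (by omega) h') (hull_zero (by omega) h')

end chains
end AC

namespace AC
open Filter Topology

abbrev EE (n : ℕ) := W n × ℝ

structure Dat (n : ℕ) (Y : Type*) [TopologicalSpace Y] where
  g : W n → Y
  hg : ContinuousOn g {0}ᶜ
  hom : ∀ (t : ℝ) (x : W n), 0 < t → x ≠ 0 → g (t • x) = g x
  nc : ∀ x : W n, x ≠ 0 → g x ≠ g (-x)
  e : OpenPartialHomeomorph Y (V n)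
  hy0 : g (0, -1) ∈ e.source
  η : V n
  ε : ℝ
  hε : 0 < ε
  hη : 3 * ε ≤ ‖η‖
  hball : ∀ v : V n, ‖v‖ ≤ ‖η‖ + ε → e (g (0, -1)) + v ∈ e.target
  hout : ∀ v : V n, ‖v‖ ≤ ε → ∀ x : W n, x ≠ 0 → g x ≠ e.symm (e (g (0, -1)) + (η + v))

def SS (n : ℕ) : Set (EE n) := {P | ∑ i, |P.1.1 i| + |P.1.2| = 1 ∧ P.2 ∈ Set.Icc (0:ℝ) 2}

section
variable {n : ℕ}

theorem norm_le_sum (v : V n) : ‖v‖ ≤ ∑ i, |v i| := by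
  have h : v = ∑ i, v i • EuclideanSpace.single i (1:ℝ) := by
    ext j
    simp [Finset.sum_apply, Pi.single_apply]
  calc ‖v‖ = ‖∑ i, v i • EuclideanSpace.single i (1:ℝ)‖ := by rw [← h]
    _ ≤ ∑ i, ‖v i • EuclideanSpace.single i (1:ℝ)‖ := norm_sum_le _ _
    _ = ∑ i, |v i| := by
      refine Finset.sum_congr rfl fun i _ => ?_
      rw [norm_smul]; simp

theorem SS_norm {P : EE n} (h : P ∈ SS n) : ‖P.1.1‖ + |P.1.2| ≤ 1 := by
  have := norm_le_sum P.1.1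
  linarith [h.1]

theorem SS_closed : IsClosed (SS n) := by
  refine IsClosed.inter (isClosed_eq ?_ continuous_const) (isClosed_Icc.preimage continuous_snd)
  refine Continuous.add (continuous_finsetSum _ fun i _ => ?_) (continuous_abs.comp (continuous_snd.comp continuous_fst))
  exact continuous_abs.comp ((EuclideanSpace.proj (𝕜 := ℝ) i).continuous.comp (continuous_fst.comp continuous_fst))

theorem SS_compact : IsCompact (SS n) := by
  refine Metric.isCompact_of_isClosed_isBounded SS_closed ?_
  refine (Metric.isBounded_closedBall (x := (0 : EE n)) (r := 2)).subset ?_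
  intro P hP
  rw [mem_closedBall_zero_iff, Prod.norm_def, Prod.norm_def]
  have h1 := SS_norm hP
  have h2 := hP.2
  have h3 := norm_nonneg P.1.1
  have h4 := abs_nonneg P.1.2
  refine max_le (max_le (by linarith) (by rw [Real.norm_eq_abs]; linarith)) ?_
  rw [Real.norm_eq_abs, abs_le]
  constructor <;> linarith [h2.1, h2.2]

theorem SS_zero {P : EE n} (h : P ∈ SS n) (h0 : P.1.1 = 0) : |P.1.2| = 1 := by
  have := h.1
  rw [h0] at this; simpa using this

noncomputable def chi1 (h : ℝ) : ℝ := min 1 (max 0 (1 - 2 * h))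

theorem chi1_cont : Continuous chi1 := by unfold chi1; fun_prop
theorem chi1_nonneg (h : ℝ) : 0 ≤ chi1 h := by unfold chi1; positivity
theorem chi1_le (h : ℝ) : chi1 h ≤ 1 := min_le_left _ _
theorem chi1_neg {h : ℝ} (hh : h ≤ 0) : chi1 h = 1 := by
  unfold chi1; apply min_eq_left; apply le_max_of_le_right; linarith
theorem chi1_half {h : ℝ} (hh : 1 / 2 ≤ h) : chi1 h = 0 := by
  unfold chi1; rw [max_eq_left (by linarith)]; norm_num
theorem chi1_quarter {h : ℝ} (hh : 1 / 4 ≤ h) : chi1 h ≤ 1 / 2 := by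
  unfold chi1; apply min_le_of_right_le; apply max_le <;> linarith

noncomputable def HH (P : EE n) : W n :=
  ((1 - min P.2 1 + min P.2 1 * max (P.1.2 - 1 / 2) 0) • P.1.1, P.1.2 - 3 / 4 * min P.2 1)

theorem HH_cont : Continuous (HH (n := n)) := by unfold HH; fun_prop

theorem HH_ne {P : EE n} (h : P ∈ SS n) : HH P ≠ 0 := by
  intro he
  have h1 : (1 - min P.2 1 + min P.2 1 * max (P.1.2 - 1 / 2) 0) • P.1.1 = 0 := congrArg Prod.fst he
  have h2 : P.1.2 - 3 / 4 * min P.2 1 = 0 := congrArg Prod.snd he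
  have h3 : min P.2 1 ≤ 1 := min_le_right _ _
  have h4 : 0 ≤ min P.2 1 := le_min h.2.1 zero_le_one
  rcases smul_eq_zero.1 h1 with h5 | h5
  · have h6 : 0 ≤ min P.2 1 * max (P.1.2 - 1 / 2) 0 := by positivity
    have h7 : min P.2 1 = 1 := by linarith
    rw [h7] at h2 h5
    have : P.1.2 = 3 / 4 := by linarith
    rw [this] at h5; norm_num at h5
  · have := SS_zero h h5
    rw [abs_of_nonneg (by linarith)] at this
    linarith

noncomputable def io (n : ℕ) : EE n →L[ℝ] EE n := (-ContinuousLinearMap.id ℝ (W n)).prodMap (ContinuousLinearMap.id ℝ ℝ)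

theorem io_apply (P : EE n) : io n P = (-P.1, P.2) := rfl

theorem io_SS (P : EE n) (h : P ∈ SS n) : io n P ∈ SS n := by
  rw [io_apply]
  refine ⟨?_, h.2⟩
  simpa using h.1

theorem io_free (P : EE n) (h : P ∈ SS n) : io n P ≠ P := by
  intro he
  rw [io_apply] at he
  have h1 : -P.1 = P.1 := congrArg Prod.fst he
  have h2 : P.1 = 0 := by
    have h3 : (2 : ℝ) • P.1 = 0 := by
      rw [two_smul]
      nth_rewrite 1 [← h1]
      simp
    exact (smul_eq_zero.1 h3).resolve_left two_ne_zero
  have := SS_zero h (by rw [h2]; rfl)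
  rw [h2] at this; simp at this

end

namespace Dat
variable {n : ℕ} {Y : Type*} [TopologicalSpace Y] (D : Dat n Y)

def y0 : Y := D.g (0, -1)

open Classical in
noncomputable def a0 (P : EE n) : Y := if 1 ≤ P.2 ∧ P.1.2 ≤ 1 / 2 then
  D.e.symm (D.e D.y0 + ((P.2 - 1) * chi1 P.1.2) • (D.η + D.ε • P.1.1)) else D.g (HH P)

theorem a0_1 {P : EE n} (h1 : 1 ≤ P.2) (h2 : P.1.2 ≤ 1 / 2) :
    D.a0 P = D.e.symm (D.e D.y0 + ((P.2 - 1) * chi1 P.1.2) • (D.η + D.ε • P.1.1)) := if_pos ⟨h1, h2⟩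

theorem a0_2 {P : EE n} (h : P.2 ≤ 1 ∨ 1 / 2 ≤ P.1.2) : D.a0 P = D.g (HH P) := by
  by_cases hc : 1 ≤ P.2 ∧ P.1.2 ≤ 1 / 2
  · rw [D.a0_1 hc.1 hc.2]
    have h0 : (P.2 - 1) * chi1 P.1.2 = 0 := by
      rcases h with h | h
      · rw [le_antisymm h hc.1]; simp
      · rw [chi1_half h]; simp
    rw [h0, zero_smul, add_zero]
    have hy : D.e.symm (D.e D.y0) = D.y0 := D.e.left_inv D.hy0
    rw [hy]
    have hH : HH P = (3 / 4 - P.1.2) • ((0, -1) : W n) := by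
      unfold HH
      rw [min_eq_right hc.1, max_eq_right (by linarith [hc.2])]
      ext1
      · simp
      · simp
    rw [hH, D.hom _ _ (by linarith [hc.2])]
    · rfl
    · intro h; have := congrArg Prod.snd h; simp at this
  · exact if_neg hc

theorem norm_aux {P : EE n} (h : P ∈ SS n) : ‖D.ε • P.1.1‖ ≤ D.ε := by
  rw [norm_smul, Real.norm_of_nonneg D.hε.le]
  have := SS_norm h
  have h2 := abs_nonneg P.1.2
  have h3 := D.hε
  nlinarith [norm_nonneg P.1.1]

theorem tgt {P : EE n} (h : P ∈ SS n) (h1 : 1 ≤ P.2) :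
    D.e D.y0 + ((P.2 - 1) * chi1 P.1.2) • (D.η + D.ε • P.1.1) ∈ D.e.target := by
  apply D.hball
  have h2 : (P.2 - 1) * chi1 P.1.2 ≤ 1 := by
    nlinarith [chi1_le P.1.2, chi1_nonneg P.1.2, h.2.2]
  have h3 : 0 ≤ (P.2 - 1) * chi1 P.1.2 := mul_nonneg (by linarith) (chi1_nonneg _)
  rw [norm_smul, Real.norm_of_nonneg h3]
  have h4 := norm_add_le D.η (D.ε • P.1.1)
  have h5 := D.norm_aux h
  nlinarith [norm_nonneg (D.η + D.ε • P.1.1)]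

theorem a0_cont : ContinuousOn D.a0 (SS n) := by
  have hS1 : ContinuousOn D.a0 (SS n ∩ {P | 1 ≤ P.2 ∧ P.1.2 ≤ 1 / 2}) := by
    have : ContinuousOn (fun P : EE n => D.e.symm (D.e D.y0 + ((P.2 - 1) * chi1 P.1.2) • (D.η + D.ε • P.1.1)))
        (SS n ∩ {P | 1 ≤ P.2 ∧ P.1.2 ≤ 1 / 2}) := by
      refine D.e.continuousOn_symm.comp (Continuous.continuousOn ?_) (fun P hP => D.tgt hP.1 hP.2.1)
      have := chi1_cont
      fun_prop
    exact this.congr (fun P hP => D.a0_1 hP.2.1 hP.2.2)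
  have hS2 : ContinuousOn D.a0 (SS n ∩ {P | P.2 ≤ 1 ∨ 1 / 2 ≤ P.1.2}) := by
    have : ContinuousOn (fun P : EE n => D.g (HH P)) (SS n ∩ {P | P.2 ≤ 1 ∨ 1 / 2 ≤ P.1.2}) :=
      D.hg.comp HH_cont.continuousOn (fun P hP => HH_ne hP.1)
    exact this.congr (fun P hP => D.a0_2 hP.2)
  have c1 : IsClosed (SS n ∩ {P : EE n | 1 ≤ P.2 ∧ P.1.2 ≤ 1 / 2}) := by
    refine SS_closed.inter (IsClosed.inter (isClosed_le continuous_const continuous_snd) ?_)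
    exact isClosed_le (continuous_snd.comp continuous_fst) continuous_const
  have c2 : IsClosed (SS n ∩ {P : EE n | P.2 ≤ 1 ∨ 1 / 2 ≤ P.1.2}) := by
    refine SS_closed.inter (IsClosed.union (isClosed_le continuous_snd continuous_const) ?_)
    exact isClosed_le continuous_const (continuous_snd.comp continuous_fst)
  refine (hS1.union_of_isClosed hS2 c1 c2).mono ?_
  intro P hP
  by_cases h : 1 ≤ P.2 ∧ P.1.2 ≤ 1 / 2
  · exact Or.inl ⟨hP, h⟩
  · right
    refine ⟨hP, ?_⟩
    by_contra hc
    simp only [Set.mem_ofPred_eq] at hc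
    push Not at hc
    exact h ⟨hc.1.le, hc.2.le⟩

noncomputable def wt (P : EE n) : V n := (1 + chi1 P.1.2) • (D.ε • P.1.1) - (1 - chi1 P.1.2) • D.η

theorem wt_cont : Continuous D.wt := by
  have := chi1_cont
  unfold wt; fun_prop

theorem wt_quarter {P : EE n} (h : P ∈ SS n) (hq : 1 / 4 ≤ P.1.2) : D.wt P ≠ 0 := by
  intro he
  have h1 := sub_eq_zero.1 he
  have h2 := congrArg norm h1
  have hc := chi1_quarter hq
  have hc0 := chi1_nonneg P.1.2
  rw [norm_smul, norm_smul, norm_smul, Real.norm_of_nonneg D.hε.le, Real.norm_of_nonneg (by linarith),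
    Real.norm_of_nonneg (by linarith)] at h2
  have h3 := SS_norm h
  rw [abs_of_nonneg (by linarith)] at h3
  have h4 : ‖P.1.1‖ ≤ 3 / 4 := by linarith
  have h5 := D.hη
  have h6 := D.hε
  have h7 : (1 + chi1 P.1.2) * (D.ε * ‖P.1.1‖) ≤ (3 / 2) * (D.ε * (3 / 4)) := by
    apply mul_le_mul (by linarith) (by nlinarith) (by positivity) (by norm_num)
  have h8 : (1 / 2) * (3 * D.ε) ≤ (1 - chi1 P.1.2) * ‖D.η‖ := by
    apply mul_le_mul (by linarith) h5 (by positivity) (by linarith)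
  nlinarith

theorem wt_zero {P : EE n} (h : P.1.2 = 0) : D.wt P = (2 * D.ε) • P.1.1 := by
  rw [wt, h, chi1_neg le_rfl, sub_self, zero_smul, sub_zero, smul_smul]; norm_num

theorem wt_zero_ne {P : EE n} (hP : P ∈ SS n) (h : P.1.2 = 0) : D.wt P ≠ 0 := by
  rw [D.wt_zero h]
  intro he
  rcases smul_eq_zero.1 he with h1 | h1
  · linarith [D.hε]
  · have := SS_zero hP h1
    rw [h] at this; simp at this

theorem wt_eq {P : EE n} (hP : P ∈ SS n) (h2 : P.2 = 2) (h0 : 0 ≤ P.1.2) (h1 : P.1.2 ≤ 1 / 2) :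
    D.e (D.a0 P) - D.e (D.a0 (io n P)) = D.wt P := by
  have hio := io_SS P hP
  have b1 : 1 ≤ P.2 := by rw [h2]; norm_num
  have b2 : (io n P).1.2 ≤ 0 := by rw [io_apply]; simpa using h0
  rw [D.a0_1 b1 h1, D.a0_1 (P := io n P) b1 (by linarith), D.e.right_inv (D.tgt hP b1),
    D.e.right_inv (D.tgt hio b1), chi1_neg b2]
  rw [io_apply]
  simp only [h2, wt, Prod.fst_neg]
  module

theorem a0_src {P : EE n} (hP : P ∈ SS n) (h2 : P.2 = 2) (h1 : P.1.2 ≤ 1 / 2) : D.a0 P ∈ D.e.source := by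
  have b1 : 1 ≤ P.2 := by rw [h2]; norm_num
  rw [D.a0_1 b1 h1]
  exact D.e.map_target (D.tgt hP b1)

/-- no coincidences at time 0 -/
theorem nc0 {P : EE n} (hP : P ∈ SS n) (h : P.2 = 0) : D.a0 P ≠ D.a0 (io n P) := by
  have hH : ∀ Q : EE n, Q.2 = 0 → HH Q = Q.1 := by
    intro Q hQ
    unfold HH
    rw [hQ]; ext1 <;> simp
  rw [D.a0_2 (Or.inl (by rw [h]; norm_num)), D.a0_2 (P := io n P) (Or.inl (by rw [io_apply]; simp [h])),
    hH _ h, hH (io n P) h, io_apply]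
  have := HH_ne hP
  rw [hH _ h] at this
  exact D.nc _ this

theorem nc2 {P : EE n} (hP : P ∈ SS n) (h2 : P.2 = 2) (h : 1 / 4 ≤ P.1.2) : D.a0 P ≠ D.a0 (io n P) := by
  have b1 : 1 ≤ P.2 := by rw [h2]; norm_num
  by_cases h1 : P.1.2 ≤ 1 / 2
  · intro he
    apply D.wt_quarter hP h
    rw [← D.wt_eq hP h2 (by linarith) h1, he, sub_self]
  · have b2 : (io n P).1.2 ≤ 0 := by rw [io_apply]; simp; linarith
    rw [D.a0_2 (Or.inr (by linarith)), D.a0_1 (P := io n P) b1 (by linarith), chi1_neg b2]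
    have := D.hout (-(D.ε • P.1.1)) (by rw [norm_neg]; exact D.norm_aux hP) _ (HH_ne hP)
    convert this using 4
    · rfl
    rw [io_apply]
    simp only [h2, Prod.fst_neg]
    module

end Dat
end AC

namespace AC
open Filter Topology

section
variable {n : ℕ} {E Y K : Type*} [NormedAddCommGroup E] [NormedSpace ℝ E] [TopologicalSpace Y]

theorem Cfg.ev_openX (C : Cfg n E Y K) (a : C(C.S, Y)) (Ω : Set ((Y × Y) × E)) (hΩ : IsOpen Ω) (N : Set E)
    (hN : IsCompact N) (hNS : N ⊆ C.S)
    (h : ∀ x ∈ N, ((C.ex a x, C.ex a (C.ι x)), x) ∈ Ω) :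
    ∀ᶠ a' : C(C.S, Y) in 𝓝 a, ∀ x ∈ N, ((C.ex a' x, C.ex a' (C.ι x)), x) ∈ Ω := by
  have hK : IsCompact ((fun x : C.S => x.1) ⁻¹' N) :=
    (hN.isClosed.preimage continuous_subtype_val).isCompact
  have key : ∀ (b : C(C.S, Y)) (x : C.S), (C.ex b x.1, C.ex b (C.ι x.1)) = (b x, b (C.iS x)) := by
    intro b x
    rw [C.ex_of b x.2, C.ex_of b (C.hιS _ x.2)]; rfl
  have hev : ∀ᶠ a' : C(C.S, Y) in 𝓝 a, ∀ x ∈ ((fun x : C.S => x.1) ⁻¹' N), ((a' x, a' (C.iS x)), x.1) ∈ Ω := by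
    apply hK.eventually_forall_of_forall_eventually
    intro x hx
    have hc : Continuous (fun p : C(C.S, Y) × C.S => ((p.1 p.2, p.1 (C.iS p.2)), p.2.1)) := by
      refine Continuous.prodMk (Continuous.prodMk ?_ ?_) ?_
      · exact continuous_eval
      · exact continuous_eval.comp (continuous_fst.prodMk (C.iS.continuous.comp continuous_snd))
      · exact continuous_subtype_val.comp continuous_snd
    refine hc.continuousAt.eventually (hΩ.mem_nhds ?_)
    have := h _ hx
    rw [key] at this; exact this
  filter_upwards [hev] with a' ha x hx
  have := ha ⟨x, hNS hx⟩ hx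
  rw [← key] at this; exact this

theorem split (c : Ch E) (P : List E → Prop) : ∃ c1 c2 : Ch E, c = c1 + c2 ∧
    c1 ∈ Sup (fun l => l ∈ c.support ∧ P l) ∧ c2 ∈ Sup (fun l => l ∈ c.support ∧ ¬ P l) := by
  classical
  refine ⟨c.filter P, c.filter (fun l => ¬ P l), (Finsupp.filter_add_filter_not c P).symm, ?_, ?_⟩
  · rw [mem_Sup_iff]; intro l hl
    rw [Finsupp.support_filter, Finset.mem_filter] at hl; exact hl
  · rw [mem_Sup_iff]; intro l hl
    rw [Finsupp.support_filter, Finset.mem_filter] at hl; exact hl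

theorem HasDeg.shift {w : E → V n} {z : Ch E} {d : ZMod 2} (h : HasDeg w z d) (m : ℕ) : HasDeg w (sd^[m] z) d := by
  have := (tendsto_add_atTop_nat m).eventually h
  filter_upwards [this] with M hM
  rw [← Function.iterate_add_apply]; exact hM

theorem hull_map_sub {L : List (W n)} {s : ℕ → ℝ} (h : RR s n L) (t : ℝ) :
    hull (L.map (fun x => ((x, t) : EE n))) ⊆ CS s ×ˢ {t} := by
  refine hull_sub ((CS_convex s).prod (convex_singleton t)) ?_
  intro P hP
  obtain ⟨x, hx, rfl⟩ := List.mem_map.1 hP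
  exact ⟨CS_hull le_rfl h (mem_hull hx), rfl⟩

theorem CS_SS {s : ℕ → ℝ} (hs : ∀ i, s i = 1 ∨ s i = -1) {P : EE n} (h : P.1 ∈ CS s) (ht : P.2 ∈ Set.Icc (0:ℝ) 2) :
    P ∈ SS n := ⟨CS_sphere hs h, ht⟩

theorem push_GG_mem (t : ℝ) (ht : t ∈ Set.Icc (0:ℝ) 2) : push (fun x => ((x, t) : EE n)) (GG n n) ∈
    Sup (fun L => L.length = n + 1 ∧ hull L ⊆ {P : EE n | P ∈ SS n ∧ P.2 = t ∧ 0 ≤ P.1.2}) := by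
  refine map_mem _ _ ?_ (GG_mem (n := n) n)
  rintro l ⟨h1, _, s, h2, h3⟩
  rw [push_one]
  refine one_mem ⟨by simpa using h1, fun P hP => ?_⟩
  have := hull_map_sub h2 t hP
  have h4 : P.2 = t := this.2
  refine ⟨CS_SS h2.1 this.1 (by rw [h4]; exact ht), h4, ?_⟩
  have := this.1.2.1
  rw [h3, one_mul] at this; exact this

theorem pr_GG_mem (k : ℕ) (hk : k ≤ n) : pr (fun x => ((x, 0) : EE n)) (fun x => (x, 2)) (GG n k) ∈
    Sup (fun L => L.length = k + 2 ∧ hull L ⊆ SS n) := by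
  refine map_mem _ _ ?_ (GG_mem (n := n) k)
  rintro l ⟨h1, _, s, h2, h3⟩
  rw [pr_one]
  refine Sup_mono ?_ (prL_mem _ _ l)
  rintro m ⟨hm, hm2⟩
  refine ⟨by omega, ?_⟩
  have : hull m ⊆ CS s ×ˢ Set.Icc (0:ℝ) 2 := by
    refine hull_sub ((CS_convex s).prod (convex_Icc 0 2)) ?_
    intro P hP
    obtain ⟨x, hx, h | h⟩ := hm2 P hP
    · rw [h]; exact ⟨CS_hull hk h2 (mem_hull hx), by norm_num⟩
    · rw [h]; exact ⟨CS_hull hk h2 (mem_hull hx), by norm_num⟩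
  intro P hP
  exact CS_SS h2.1 (this hP).1 (this hP).2

theorem bd_rel (p : ℕ) : bd (pr (fun x => ((x, 0) : EE (p + 1))) (fun x => (x, 2)) (GG (p + 1) (p + 1))) =
    push (fun x => ((x, 2) : EE (p + 1))) (GG (p + 1) (p + 1)) + push (fun x => ((x, 0) : EE (p + 1))) (GG (p + 1) (p + 1))
    + (pr (fun x => ((x, 0) : EE (p + 1))) (fun x => (x, 2)) (GG (p + 1) p) +
      push (io (p + 1)) (pr (fun x => ((x, 0) : EE (p + 1))) (fun x => (x, 2)) (GG (p + 1) p))) := by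
  have h := bd_pr (fun x => ((x, 0) : EE (p + 1))) (fun x => (x, 2)) (GG (p + 1) (p + 1))
  rw [(bd_GG_inv p).2, map_add, pr_push (fun x => ((x, 0) : EE (p + 1))) (fun x => (x, 2)) (fun x => -x)
    (fun x => ((x, 0) : EE (p + 1))) (fun x => (x, 2)) (io (p + 1)) (fun x => rfl) (fun x => rfl)] at h
  rw [add_comm (push (fun x => ((x, 2) : EE (p + 1))) (GG (p + 1) (p + 1))), ← h, add_assoc, ch_add_self, add_zero]

end

namespace Dat
variable {p : ℕ} {Y : Type*} [TopologicalSpace Y] (D : Dat (p + 1) Y)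

theorem hcont : Continuous (fun P : EE (p + 1) => P.1.2) := continuous_snd.comp continuous_fst

noncomputable def cfg {n : ℕ} (D : Dat n Y) : Cfg n (EE n) Y Unit where
  S := SS n
  hS := SS_compact
  ι := io n
  hι := fun x => by rw [io_apply, io_apply]; simp
  hιS := io_SS
  free := io_free
  y0 := D.y0
  e := fun _ => D.e
  A := fun _ => SS n ∩ {P | P.2 = 2 ∧ |P.1.2| ≤ 1 / 2}
  hA := fun _ => SS_compact.inter_right ((isClosed_eq continuous_snd continuous_const).inter
    (isClosed_le (continuous_abs.comp (continuous_snd.comp continuous_fst)) continuous_const))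
  hAS := fun _ => Set.inter_subset_left
  hAι := fun _ x hx => ⟨io_SS x hx.1, hx.2.1, by rw [io_apply]; simpa using hx.2.2⟩

noncomputable def aa {n : ℕ} (D : Dat n Y) : C(D.cfg.S, Y) :=
  ⟨fun x => D.a0 x.1, continuousOn_iff_continuous_domRestrict.1 D.a0_cont⟩

theorem ex_aa {n : ℕ} (D : Dat n Y) {P : EE n} (hP : P ∈ SS n) : D.cfg.ex D.aa P = D.a0 P := D.cfg.ex_of D.aa hP

def BB (n : ℕ) : Set (EE n) := SS n ∩ ({P | P.2 = 2} ∩ ({P | 0 ≤ P.1.2} ∩ ({P | P.1.2 ≤ 1 / 2} ∩ ({P | P.1.2 = 0} ∪ {P | 1 / 4 ≤ P.1.2}))))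

theorem BB_compact : IsCompact (BB (p + 1)) := by
  refine SS_compact.inter_right ((isClosed_eq continuous_snd continuous_const).inter ?_)
  refine (isClosed_le continuous_const hcont).inter ((isClosed_le hcont continuous_const).inter ?_)
  exact (isClosed_eq hcont continuous_const).union (isClosed_le continuous_const hcont)

def OM : Set ((Y × Y) × EE (p + 1)) := ((D.e.source ×ˢ D.e.source) ×ˢ Set.univ) ∩
  {q | ‖D.e q.1.1 - D.e q.1.2 - D.wt q.2‖ - ‖D.wt q.2‖ < 0}

theorem OM_open : IsOpen D.OM := by
  have hc : ContinuousOn (fun q : (Y × Y) × EE (p + 1) => ‖D.e q.1.1 - D.e q.1.2 - D.wt q.2‖ - ‖D.wt q.2‖)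
      ((D.e.source ×ˢ D.e.source) ×ˢ Set.univ) := by
    have hw : ContinuousOn (fun q : (Y × Y) × EE (p + 1) => D.wt q.2) ((D.e.source ×ˢ D.e.source) ×ˢ Set.univ) :=
      (D.wt_cont.comp continuous_snd).continuousOn
    refine (ContinuousOn.norm (ContinuousOn.sub (ContinuousOn.sub ?_ ?_) hw)).sub hw.norm
    · exact D.e.continuousOn.comp (continuous_fst.comp continuous_fst).continuousOn (fun q hq => hq.1.1)
    · exact D.e.continuousOn.comp (continuous_snd.comp continuous_fst).continuousOn (fun q hq => hq.1.2)
  exact hc.isOpen_inter_preimage ((D.e.open_source.prod D.e.open_source).prod isOpen_univ) isOpen_Iio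

theorem ev_all [T2Space Y] : ∀ᶠ a' in 𝓝 D.aa, D.cfg.NC a' (SS (p + 1) ∩ {P | P.2 = 0}) ∧
    D.cfg.NC a' (SS (p + 1) ∩ {P | P.2 = 2 ∧ 1 / 4 ≤ P.1.2}) ∧
    (∀ x ∈ D.cfg.A (), D.cfg.ex a' x ∈ D.e.source) ∧
    ∀ x ∈ BB (p + 1), ‖D.cfg.wk a' () x - D.wt x‖ < ‖D.wt x‖ := by
  refine Filter.Eventually.and ?_ (Filter.Eventually.and ?_ (Filter.Eventually.and ?_ ?_))
  · refine D.cfg.NC_open _ _ (SS_compact.inter_right (isClosed_eq continuous_snd continuous_const)) Set.inter_subset_left ?_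
    intro x hx
    rw [D.ex_aa hx.1]
    refine (D.nc0 hx.1 hx.2).trans_eq ?_
    exact (D.ex_aa (io_SS x hx.1)).symm
  · refine D.cfg.NC_open _ _ (SS_compact.inter_right ((isClosed_eq continuous_snd continuous_const).inter
      (isClosed_le continuous_const hcont))) Set.inter_subset_left ?_
    intro x hx
    rw [D.ex_aa hx.1]
    refine (D.nc2 hx.1 hx.2.1 hx.2.2).trans_eq ?_
    exact (D.ex_aa (io_SS x hx.1)).symm
  · have := D.cfg.ev_openE D.aa (D.e.source ×ˢ Set.univ) (D.e.open_source.prod isOpen_univ) _ (D.cfg.hA ()) (D.cfg.hAS ())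
      (fun x hx => ⟨by rw [D.ex_aa hx.1]; exact D.a0_src hx.1 hx.2.1 (abs_le.1 hx.2.2).2, trivial⟩)
    filter_upwards [this] with a' ha x hx
    exact (ha x hx).1
  · have := D.cfg.ev_openX D.aa D.OM D.OM_open (BB (p + 1)) BB_compact Set.inter_subset_left ?_
    · filter_upwards [this] with a' ha x hx
      have := (ha x hx).2
      exact sub_neg.1 this
    · rintro x ⟨hx, h2, h0, h1, h3⟩
      have e1 : D.cfg.ex D.aa (D.cfg.ι x) = D.a0 (io (p + 1) x) := D.ex_aa (io_SS x hx)
      rw [D.ex_aa hx, e1]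
      refine ⟨⟨⟨D.a0_src hx h2 h1, D.a0_src (io_SS x hx) h2 ?_⟩, trivial⟩, ?_⟩
      · rw [io_apply]
        have : (0:ℝ) ≤ x.1.2 := h0
        simp only [Prod.snd_neg]; linarith
      · simp only [Set.mem_ofPred_eq]
        rw [D.wt_eq hx h2 h0 h1, sub_self, norm_zero, zero_sub, neg_lt_zero, norm_pos_iff]
        rcases h3 with h3 | h3
        · exact D.wt_zero_ne hx h3
        · exact D.wt_quarter hx h3

theorem core {p : ℕ} {Y : Type*} [TopologicalSpace Y] (D : Dat (p + 1) Y) [T2Space Y] [ChartedSpace (V (p + 1)) Y] : False := by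
  set z1 := push (fun x => ((x, 2) : EE (p + 1))) (GG (p + 1) (p + 1)) with hz1
  have m1 := push_GG_mem (n := p + 1) 2 (by norm_num)
  have m0 := push_GG_mem (n := p + 1) 0 (by norm_num)
  have hmain := D.cfg.main' (by omega) D.aa
    (fun x hx => by rw [D.ex_aa hx.1]; exact D.a0_src hx.1 hx.2.1 (abs_le.1 hx.2.2).2)
    _ _ _ _ (pr_GG_mem (p + 1) le_rfl) (Sup_mono (fun L hL => ⟨hL.1, fun x hx => (hL.2 hx).1⟩) m1)
    (Sup_mono (fun L hL => ⟨hL.1, fun x hx => (hL.2 hx).1⟩) m0) (pr_GG_mem p (by omega)) (bd_rel p)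
  have hleb := leb (fun N : Set (EE (p + 1)) => N ⊆ {P | P.1.2 ≤ 1 / 2} ∨ N ⊆ {P | 1 / 4 ≤ P.1.2})
    (fun A B hAB hB => hB.imp (fun h => hAB.trans h) (fun h => hAB.trans h)) (Or.inl (Set.empty_subset _)) z1 (by
      intro L _ x _
      rcases lt_or_ge (1 / 4 : ℝ) x.1.2 with h | h
      · exact ⟨_, mem_nhdsWithin_of_mem_nhds ((isOpen_lt continuous_const hcont).mem_nhds h),
          Or.inr (fun P hP => by simp only [Set.mem_ofPred_eq] at hP ⊢; exact hP.le)⟩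
      · exact ⟨{P | P.1.2 < 1 / 2}, mem_nhdsWithin_of_mem_nhds ((isOpen_lt hcont continuous_const).mem_nhds
          (by simp only [Set.mem_ofPred_eq]; linarith)),
          Or.inl (fun P hP => by simp only [Set.mem_ofPred_eq] at hP ⊢; exact hP.le)⟩)
  obtain ⟨m, hm, hl⟩ := (hmain.and hleb).exists
  obtain ⟨a', ⟨hn0, hn2, hsrc, hB⟩, d, hd, hsum⟩ := hm _ D.ev_all
  have hX : ∀ (X : Set (EE (p + 1))), ∀ A B : Set (EE (p + 1)), A ⊆ B → B ⊆ X → A ⊆ X := fun X A B h h' => h.trans h'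
  have k1 := mem_Sup_iff.1 (iter_hull (fun A => A ⊆ {P : EE (p + 1) | P ∈ SS (p + 1) ∧ P.2 = 2 ∧ 0 ≤ P.1.2}) (hX _) _
    (Sup_mono (fun L hL => hL.2) m1) m)
  have k0 := mem_Sup_iff.1 (iter_hull (fun A => A ⊆ {P : EE (p + 1) | P ∈ SS (p + 1) ∧ P.2 = 0 ∧ 0 ≤ P.1.2}) (hX _) _
    (Sup_mono (fun L hL => hL.2) m0) m)
  rw [← hz1] at k1 hsum hd
  have hs0 : lin d (sd^[m] (push (fun x => ((x, 0) : EE (p + 1))) (GG (p + 1) (p + 1)))) = 0 := by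
    have := map_eq (lin d) 0 (P := fun s => d s = 0) (fun l hl => by simp [hl]) (mem_Sup_iff.2 (fun s hs => 
      (hd s (Or.inr hs)).1.1 (fun x hx => hn0 x ⟨(k0 s hs hx).1, (k0 s hs hx).2.1⟩)))
    exact this
  rw [hs0, add_zero] at hsum
  obtain ⟨c1, c2, hc, hc1, hc2⟩ := split (sd^[m] z1) (fun l => hull l ⊆ {P | P.1.2 ≤ 1 / 2})
  have hc2' : c2 ∈ Sup (fun l => l ∈ (sd^[m] z1).support ∧ hull l ⊆ {P | P.1.2 ≥ 1 / 4}) := by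
    refine Sup_mono ?_ hc2
    rintro l ⟨h1, h2⟩
    refine ⟨h1, ?_⟩
    obtain ⟨_, _, _, _, h3⟩ := mem_Sup_iff.1 hl l h1
    exact h3.resolve_left h2
  have hs2 : lin d c2 = 0 := by
    have := map_eq (lin d) 0 (P := fun s => d s = 0) (fun l hl => by simp [hl]) (Sup_mono ?_ hc2')
    · exact this
    · rintro l ⟨h1, h2⟩
      exact (hd l (Or.inl h1)).1.1 (fun x hx => hn2 x ⟨(k1 l h1 hx).1, (k1 l h1 hx).2.1, h2 hx⟩)
  rw [hc, map_add, hs2, add_zero] at hsum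
  -- degrees
  have g1 : HasDeg (D.cfg.wk a' ()) (bd c1) (lin d c1) := by
    apply hasDeg_lin
    refine Sup_mono ?_ hc1
    rintro l ⟨h1, h2⟩
    refine (hd l (Or.inl h1)).1.2 () (fun x hx => ?_)
    have := k1 l h1 hx
    refine ⟨this.1, this.2.1, abs_le.2 ⟨?_, h2 hx⟩⟩
    linarith [this.2.2]
  have hbz : bd z1 = push (fun x => ((x, 2) : EE (p + 1))) (GG (p + 1) p + push (fun x => -x) (GG (p + 1) p)) := by
    rw [hz1, bd_push, (bd_GG_inv p).2]
  have hGp : GG (p + 1) p + push (fun x => -x) (GG (p + 1) p) ∈ Sup (fun L : List (W (p + 1)) => ∃ s, RR s p L) := by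
    refine Submodule.add_mem _ (Sup_mono ?_ (GG_mem p)) (map_mem _ _ ?_ (GG_mem p))
    · rintro l ⟨_, _, s, h, _⟩; exact ⟨s, h⟩
    · rintro l ⟨_, _, s, h, _⟩
      rw [push_one]; exact one_mem ⟨_, RR_neg h⟩
  have hzero : bd (sd^[m] z1) ∈ Sup (fun L => hull L ⊆ {P : EE (p + 1) | P.1.2 = 0}) := by
    rw [bd_iter]
    refine iter_hull (fun A => A ⊆ {P : EE (p + 1) | P.1.2 = 0}) (hX _) _ ?_ m
    rw [hbz]
    refine map_mem _ _ ?_ hGp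
    rintro l ⟨s, h⟩
    rw [push_one]
    refine one_mem (hull_sub ?_ ?_)
    · intro x hx y hy a b _ _ _
      simp only [Set.mem_ofPred_eq] at hx hy ⊢
      simp [hx, hy]
    · intro P hP
      obtain ⟨x, hx, rfl⟩ := List.mem_map.1 hP
      exact hull_zero (by omega) h x (mem_hull hx)
  have g2 : HasDeg D.wt (bd (sd^[m] z1)) 1 := by
    rw [bd_iter]
    apply HasDeg.shift
    rw [hbz, hasDeg_push (bary_pair 2)]
    refine (equator p (2 * D.ε) (by linarith [D.hε])).congr ?_
    refine Sup_mono ?_ hGp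
    rintro l ⟨s, h⟩ x hx
    rw [D.wt_zero]
    exact hull_zero (by omega) h x hx
  have g3 : HasDeg D.wt (bd c2) 0 := by
    apply hasDeg_bd
    refine Sup_mono ?_ hc2'
    rintro l ⟨h1, h2⟩
    exact ⟨D.wt_cont.continuousOn, fun x hx => D.wt_quarter (k1 l h1 hx).1 (h2 hx)⟩
  have hb : bd c1 = bd (sd^[m] z1) + bd c2 := by
    rw [hc, map_add, add_assoc, ch_add_self, add_zero]
  have g4 : HasDeg D.wt (bd c1) 1 := by
    rw [hb]; simpa using g2.add g3
  have hfac : bd c1 ∈ Sup (fun L => hull L ⊆ BB (p + 1)) := by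
    rw [mem_Sup_iff]
    intro τ hτ
    have q1 := mem_Sup_iff.1 (bd_hull (fun A => A ⊆ {P : EE (p + 1) | (P ∈ SS (p + 1) ∧ P.2 = 2 ∧ 0 ≤ P.1.2) ∧ P.1.2 ≤ 1 / 2}) (hX _) c1
      (Sup_mono (fun l hl x hx => ⟨k1 l hl.1 hx, hl.2 hx⟩) hc1)) τ hτ
    have q2 : τ ∈ (bd (sd^[m] z1)).support ∨ τ ∈ (bd c2).support := by
      classical
      rw [hb] at hτ
      exact Finset.mem_union.1 (Finsupp.support_add hτ)
    intro x hx
    refine ⟨(q1 hx).1.1, (q1 hx).1.2.1, (q1 hx).1.2.2, (q1 hx).2, ?_⟩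
    rcases q2 with q | q
    · exact Or.inl (mem_Sup_iff.1 hzero τ q hx)
    · exact Or.inr (mem_Sup_iff.1 (bd_hull (fun A => A ⊆ {P : EE (p + 1) | P.1.2 ≥ 1 / 4}) (hX _) c2
        (Sup_mono (fun l hl => hl.2) hc2')) τ q hx)
  have g5 : HasDeg (D.cfg.wk a' ()) (bd c1) 1 := by
    have := HasDeg.homotopy (fun q : EE (p + 1) × ℝ => D.wt q.1 + q.2 • (D.cfg.wk a' () q.1 - D.wt q.1)) (bd_bd c1) (d := 1) ?_ ?_
    · simpa using this
    · refine Sup_mono ?_ hfac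
      intro L hL
      have hLA : hull L ⊆ D.cfg.A () := fun x hx => by
        obtain ⟨h1, h2, h3, h4, _⟩ := hL hx
        have h3' : (0:ℝ) ≤ x.1.2 := h3
        exact ⟨h1, h2, abs_le.2 ⟨by linarith, h4⟩⟩
      have hNC : D.cfg.NC a' (hull L) := by
        intro x hx he
        have := hB x (hL hx)
        rw [Cfg.wk, he, sub_self, zero_sub, norm_neg] at this
        exact lt_irrefl _ this
      have hgood := D.cfg.good_wk a' (fun _ => hsrc) () L hLA hNC
      constructor
      · have c1 : ContinuousOn (fun q : EE (p + 1) × ℝ => D.cfg.wk a' () q.1) (hull L ×ˢ Set.Icc (0:ℝ) 1) :=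
          hgood.1.comp continuous_fst.continuousOn (fun q hq => hq.1)
        have c2 : ContinuousOn (fun q : EE (p + 1) × ℝ => D.wt q.1) (hull L ×ˢ Set.Icc (0:ℝ) 1) :=
          (D.wt_cont.comp continuous_fst).continuousOn
        exact c2.add (continuous_snd.continuousOn.smul (c1.sub c2))
      · rintro ⟨x, t⟩ ⟨hx, ht⟩ he
        have h1 := hB x (hL hx)
        have h2 : D.wt x = -(t • (D.cfg.wk a' () x - D.wt x)) := eq_neg_of_add_eq_zero_left he
        have h3 := congrArg norm h2
        rw [norm_neg, norm_smul, Real.norm_of_nonneg ht.1] at h3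
        have h4 : t ≤ 1 := ht.2
        nlinarith [norm_nonneg (D.cfg.wk a' () x - D.wt x)]
    · simpa using g4
  have := g1.unique g5
  rw [hsum] at this
  exact zero_ne_one this

end Dat
end AC


theorem antipodal_coincidence_sphere_to_open_manifold (n : ℕ) (hn : 1 ≤ n) (Y : Type*) [TopologicalSpace Y] [T2Space Y] [ChartedSpace (EuclideanSpace ℝ (Fin n)) Y] [ConnectedSpace Y] (hY : ¬ CompactSpace Y) (f : EuclideanSpace ℝ (Fin (n + 1)) → Y) (hf : ContinuousOn f (Metric.sphere 0 1)) : ∃ x : EuclideanSpace ℝ (Fin (n + 1)), ‖x‖ = 1 ∧ f x = f (-x) := by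
  by_contra hno
  push Not at hno
  have hKc : IsCompact (f '' Metric.sphere 0 1) := (isCompact_sphere _ _).image_of_continuousOn hf
  have hKne : (f '' Metric.sphere 0 1).Nonempty :=
    (NormedSpace.sphere_nonempty.2 zero_le_one).image f
  have hex : ∃ y0 ∈ f '' Metric.sphere 0 1, f '' Metric.sphere 0 1 ∉ nhds y0 := by
    by_contra hc
    push Not at hc
    have ho : IsOpen (f '' Metric.sphere 0 1) := isOpen_iff_mem_nhds.2 hc
    have := IsClopen.eq_univ ⟨hKc.isClosed, ho⟩ hKne
    rw [this] at hKc
    exact hY ⟨hKc⟩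
  obtain ⟨y0, ⟨p, hp, rfl⟩, hnn⟩ := hex
  have hp1 : ‖p‖ = 1 := mem_sphere_zero_iff_norm.1 hp
  obtain ⟨L, hL⟩ : ∃ L : AC.W n ≃L[ℝ] EuclideanSpace ℝ (Fin (n + 1)), L (0, -1) = p := by
    have hfr : Module.finrank ℝ (AC.W n) = Module.finrank ℝ (EuclideanSpace ℝ (Fin (n + 1))) := by
      simp [AC.W, AC.V]
    let L0 := ContinuousLinearEquiv.ofFinrankEq hfr
    obtain ⟨M, hM⟩ := SeparatingDual.exists_continuousLinearEquiv_apply_eq (R := ℝ) (x := L0 (0, -1)) (y := p)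
      (by simp) (by rintro rfl; simp at hp1)
    exact ⟨L0.trans M, hM⟩
  have hnm : ∀ x : AC.W n, x ≠ 0 → ‖‖L x‖⁻¹ • L x‖ = 1 := by
    intro x hx
    have : L x ≠ 0 := by simpa using hx
    rw [norm_smul, norm_inv, norm_norm, inv_mul_cancel₀ (norm_ne_zero_iff.2 this)]
  set g : AC.W n → Y := fun x => f (‖L x‖⁻¹ • L x) with hg
  have hg0 : g (0, -1) = f p := by
    simp only [hg]; rw [hL, hp1]; simp
  set e := chartAt (EuclideanSpace ℝ (Fin n)) (f p) with he
  have hsrc : f p ∈ e.source := mem_chart_source _ _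
  obtain ⟨R, hR, hball⟩ := Metric.isOpen_iff.1 e.open_target (e (f p)) (e.map_source hsrc)
  obtain ⟨y, ⟨hy1, hy2⟩, hyK⟩ : ∃ y ∈ e.source ∩ e ⁻¹' Metric.ball (e (f p)) (R / 2), y ∉ f '' Metric.sphere 0 1 := by
    by_contra hc
    push Not at hc
    apply hnn
    refine Filter.mem_of_superset ?_ hc
    exact (e.isOpen_inter_preimage Metric.isOpen_ball).mem_nhds ⟨hsrc, Metric.mem_ball_self (by linarith)⟩
  have hη : 0 < ‖e y - e (f p)‖ := by
    rw [norm_pos_iff, sub_ne_zero]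
    intro h
    exact hyK (by rw [e.injOn hy1 hsrc h]; exact ⟨p, hp, rfl⟩)
  have hη2 : ‖e y - e (f p)‖ < R / 2 := by rw [← dist_eq_norm]; exact hy2
  have hop : IsOpen (e.target ∩ e.symm ⁻¹' (f '' Metric.sphere 0 1)ᶜ) :=
    e.symm.isOpen_inter_preimage hKc.isClosed.isOpen_compl
  obtain ⟨ε1, hε1, hb1⟩ := Metric.isOpen_iff.1 hop (e y) ⟨e.map_source hy1, by
    rw [Set.mem_preimage, e.left_inv hy1]; exact hyK⟩
  have hgc : ContinuousOn g {0}ᶜ := by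
    refine hf.comp ?_ (fun x hx => mem_sphere_zero_iff_norm.2 (hnm x hx))
    refine ContinuousOn.smul (ContinuousOn.inv₀ L.continuous.norm.continuousOn ?_) L.continuous.continuousOn
    intro x hx
    rw [norm_ne_zero_iff]; simpa using hx
  set ε := min (ε1 / 2) (‖e y - e (f p)‖ / 3) with hε
  have hεpos : 0 < ε := lt_min (by linarith) (by linarith)
  have hε2 : ε ≤ ε1 / 2 := min_le_left _ _
  have hε3 : ε ≤ ‖e y - e (f p)‖ / 3 := min_le_right _ _
  let D : AC.Dat n Y :=
    { g := g
      hg := hgc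
      hom := by
        intro t x ht hx
        simp only [hg]
        congr 1
        have : ‖L x‖ ≠ 0 := by rw [norm_ne_zero_iff]; simpa using hx
        rw [map_smul, norm_smul, Real.norm_of_nonneg ht.le, smul_smul]
        congr 1
        field_simp
      nc := by
        intro x hx
        simp only [hg]
        rw [map_neg, norm_neg, smul_neg]
        exact hno _ (hnm x hx)
      e := e
      hy0 := by rw [hg0]; exact hsrc
      η := e y - e (f p)
      ε := ε
      hε := hεpos
      hη := by linarith
      hball := by
        intro v hv
        rw [hg0]
        apply hball
        rw [mem_ball_iff_norm, add_sub_cancel_left]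
        linarith
      hout := by
        intro v hv x hx h
        rw [hg0] at h
        have h1 : e (f p) + (e y - e (f p) + v) = e y + v := by abel
        rw [h1] at h
        have h2 := (hb1 (show e y + v ∈ Metric.ball (e y) ε1 by
          rw [mem_ball_iff_norm, add_sub_cancel_left]; linarith)).2
        apply h2
        rw [← h]
        exact ⟨_, mem_sphere_zero_iff_norm.2 (hnm x hx), rfl⟩ }
  obtain ⟨q, rfl⟩ : ∃ q, n = q + 1 := ⟨n - 1, by omega⟩
  exact D.core
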